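/- For every set S of N points in the plane in general position, ĥv_x^3(S) ≥ N/2^26. -/

import Mathlib

open scoped Classical

noncomputable section

/-- A point in the plane. -/
abbrev Pt : Type := ℝ × ℝ

/-- `S` is in general position: no three distinct points of `S` are collinear. -/
def GenPos (S : Finset Pt) : Prop :=
  ∀ p ∈ S, ∀ q ∈ S, ∀ r ∈ S, p ≠ q → p ≠ r → q ≠ r →
    ¬ Collinear ℝ ({p, q, r} : Set Pt)

/-- Two straight edges cross if their relative interiors (open segments) meet. -/
def EdgesCross (e f : Sym2 Pt) : Prop :=
  ∃ a b c d : Pt, e = s(a, b) ∧ f = s(c, d) ∧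
    (openSegment ℝ a b ∩ openSegment ℝ c d).Nonempty

/-- `G` is a crossing-free straight-edge (plane) graph on the point set `S`:
its edges are nondegenerate straight segments between points of `S`,
and no two distinct edges cross. -/
def IsPlaneGraph (S : Finset Pt) (G : Finset (Sym2 Pt)) : Prop :=
  (∀ e ∈ G, ¬ e.IsDiag ∧ ∀ p ∈ e, p ∈ S) ∧
    ∀ e ∈ G, ∀ f ∈ G, e ≠ f → ¬ EdgesCross e f

/-- The (finite) collection of all plane graphs on `S`. -/
def planeGraphs (S : Finset Pt) : Finset (Finset (Sym2 Pt)) :=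
  S.sym2.powerset.filter (IsPlaneGraph S)

/-- The degree of the point `p` in the graph `G`. -/
def vingDeg (G : Finset (Sym2 Pt)) (p : Pt) : ℕ :=
  (G.filter fun e => p ∈ e).card

/-- The ving `(p, G)` is an x-ving: no straight edge from `p` to another point
of `S` can be added to `G` while keeping the graph plane. -/
def IsXVing (S : Finset Pt) (G : Finset (Sym2 Pt)) (p : Pt) : Prop :=
  ∀ q ∈ S, q ≠ p → s(p, q) ∉ G → ¬ IsPlaneGraph S (insert s(p, q) G)

/-- `v_x(G)`: the number of x-vings of `G`. -/
def vx (S : Finset Pt) (G : Finset (Sym2 Pt)) : ℕ :=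
  (S.filter (IsXVing S G)).card

/-- `v_i(G)`: the number of vertices of degree exactly `i` in `G`. -/
def vdeg (S : Finset Pt) (G : Finset (Sym2 Pt)) (i : ℕ) : ℕ :=
  (S.filter fun p => vingDeg G p = i).card

/-- `ĥv_x(S)`: the average of `v_x(G)` over a uniformly random plane graph on `S`. -/
def hvx (S : Finset Pt) : ℝ :=
  (∑ G ∈ planeGraphs S, (vx S G : ℝ)) / (planeGraphs S).card

/-- `ĥv_i(S)`: the average of `v_i(G)` over a uniformly random plane graph on `S`. -/
def hvdeg (S : Finset Pt) (i : ℕ) : ℝ :=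
  (∑ G ∈ planeGraphs S, (vdeg S G i : ℝ)) / (planeGraphs S).card

/-- `pg(N)`: the maximum number of plane graphs over all sets of `N` points in
general position. -/
def pgMax (N : ℕ) : ℕ :=
  sSup {n : ℕ | ∃ S : Finset Pt, S.card = N ∧ GenPos S ∧ (planeGraphs S).card = n}

/-- The plane graphs on `S` with at most `m` edges. -/
def planeGraphsLE (S : Finset Pt) (m : ℝ) : Finset (Finset (Sym2 Pt)) :=
  (planeGraphs S).filter fun G => (G.card : ℝ) ≤ m

/-- `ĥv_{x,m}(S)`: the average of `v_x(G)` over a uniformly random plane graph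
on `S` with at most `m` edges. -/
def hvxLE (S : Finset Pt) (m : ℝ) : ℝ :=
  (∑ G ∈ planeGraphsLE S m, (vx S G : ℝ)) / (planeGraphsLE S m).card

/-- `G` has no vertex (point of `S`) of degree smaller than `i`. -/
def MinDegGe (S : Finset Pt) (G : Finset (Sym2 Pt)) (i : ℕ) : Prop :=
  ∀ p ∈ S, i ≤ vingDeg G p

/-- The plane graphs on `S` with no vertex of degree smaller than `i`. -/
def planeGraphsDeg (S : Finset Pt) (i : ℕ) : Finset (Finset (Sym2 Pt)) :=
  (planeGraphs S).filter fun G => MinDegGe S G i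

/-- The plane graphs on `S` with at most `m` edges and no vertex of degree
smaller than `i`. -/
def planeGraphsLEDeg (S : Finset Pt) (m : ℝ) (i : ℕ) : Finset (Finset (Sym2 Pt)) :=
  (planeGraphs S).filter fun G => (G.card : ℝ) ≤ m ∧ MinDegGe S G i

/-- `ĥv_{x,m}(S,i)`: the average of `v_x(G)` over a uniformly random plane graph
on `S` with at most `m` edges and no vertex of degree smaller than `i`. -/
def hvxLEDeg (S : Finset Pt) (m : ℝ) (i : ℕ) : ℝ :=
  (∑ G ∈ planeGraphsLEDeg S m i, (vx S G : ℝ)) / (planeGraphsLEDeg S m i).card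

/-- `pg(N, i)`: the maximum, over sets `S` of `N` points in general position, of
the number of plane graphs on `S` with no vertex of degree smaller than `i`. -/
def pgMaxDeg (N i : ℕ) : ℕ :=
  sSup {n : ℕ | ∃ S : Finset Pt, S.card = N ∧ GenPos S ∧ (planeGraphsDeg S i).card = n}

/-- The underlying abstract graph of `G` on the vertex set `S`. -/
def abstractGraph (S : Finset Pt) (G : Finset (Sym2 Pt)) :
    SimpleGraph (S : Set Pt) :=
  SimpleGraph.induce (S : Set Pt) (SimpleGraph.fromEdgeSet (G : Set (Sym2 Pt)))

/-- The connected plane graphs on `S`. -/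
def connPlaneGraphs (S : Finset Pt) : Finset (Finset (Sym2 Pt)) :=
  (planeGraphs S).filter fun G => (abstractGraph S G).Connected

/-- The underlying abstract graph of `G` is bi-connected (2-vertex-connected):
it is connected and remains connected after deletion of any single vertex. -/
def Biconnected (S : Finset Pt) (G : Finset (Sym2 Pt)) : Prop :=
  (abstractGraph S G).Connected ∧
    ∀ v ∈ S, (SimpleGraph.induce ((S : Set Pt) \ {v})
      (SimpleGraph.fromEdgeSet (G : Set (Sym2 Pt)))).Connected

/-- The bi-connected plane graphs on `S`. -/
def biconnPlaneGraphs (S : Finset Pt) : Finset (Finset (Sym2 Pt)) :=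
  (planeGraphs S).filter (Biconnected S)

/-- `G` is a `k`-quasi-plane graph on `S`: a straight-edge graph on `S`
(crossings allowed) with no `k` pairwise crossing edges. -/
def IsQuasiPlane (k : ℕ) (S : Finset Pt) (G : Finset (Sym2 Pt)) : Prop :=
  (∀ e ∈ G, ¬ e.IsDiag ∧ ∀ p ∈ e, p ∈ S) ∧
    ¬ ∃ T ⊆ G, T.card = k ∧ ∀ e ∈ T, ∀ f ∈ T, e ≠ f → EdgesCross e f

/-- The (finite) collection of all `k`-quasi-plane graphs on `S`. -/
def qpGraphs (k : ℕ) (S : Finset Pt) : Finset (Finset (Sym2 Pt)) :=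
  S.sym2.powerset.filter (IsQuasiPlane k S)

/-- The ving `(p, G)` is an x-ving of the `k`-quasi-plane graph `G`: no straight
edge from `p` to another point of `S` can be added to `G` without violating
`k`-quasi-planarity. -/
def IsXVingQP (k : ℕ) (S : Finset Pt) (G : Finset (Sym2 Pt)) (p : Pt) : Prop :=
  ∀ q ∈ S, q ≠ p → s(p, q) ∉ G → ¬ IsQuasiPlane k S (insert s(p, q) G)

/-- `v_x(G)` for a `k`-quasi-plane graph `G`. -/
def vxQP (k : ℕ) (S : Finset Pt) (G : Finset (Sym2 Pt)) : ℕ :=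
  (S.filter (IsXVingQP k S G)).card

/-- `ĥv_x^k(S)`: the average of `v_x(G)` over a uniformly random `k`-quasi-plane
graph on `S`. -/
def hvxQP (k : ℕ) (S : Finset Pt) : ℝ :=
  (∑ G ∈ qpGraphs k S, (vxQP k S G : ℝ)) / (qpGraphs k S).card

/-- `qp_k(N)`: the maximum number of `k`-quasi-plane graphs over all sets of `N`
points in general position. -/
def qpMax (k N : ℕ) : ℕ :=
  sSup {n : ℕ | ∃ S : Finset Pt, S.card = N ∧ GenPos S ∧ (qpGraphs k S).card = n}

section FirstReturn

variable {D : Type*}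

theorem exists_iterate_return [Finite D] (ψ : Equiv.Perm D) (A : D → Prop) {x : D} (hx : A x) :
    ∃ n : ℕ, A (ψ^[n + 1] x) := by
  refine ⟨orderOf ψ - 1, ?_⟩
  have h : 0 < orderOf ψ := orderOf_pos ψ
  rw [Nat.sub_add_cancel h, Equiv.Perm.iterate_eq_pow, pow_orderOf_eq_one]
  exact hx

/-- The first return map of a permutation to a subset. -/
def firstReturn [Finite D] (ψ : Equiv.Perm D) (A : D → Prop) (x : D) : D :=
  if h : A x then ψ^[Nat.find (exists_iterate_return ψ A h) + 1] x else x

theorem firstReturn_mem [Finite D] (ψ : Equiv.Perm D) (A : D → Prop) {x : D} (hx : A x) :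
    A (firstReturn ψ A x) := by
  rw [firstReturn, dif_pos hx]
  exact Nat.find_spec (exists_iterate_return ψ A hx)

theorem firstReturn_induct [Finite D] (ψ : Equiv.Perm D) (A I : D → Prop) {x : D} (hx : A x)
    (h0 : I (ψ x)) (hs : ∀ d, ¬ A d → I d → I (ψ d)) : I (firstReturn ψ A x) := by
  rw [firstReturn, dif_pos hx]
  have key : ∀ i, i ≤ Nat.find (exists_iterate_return ψ A hx) → I (ψ^[i + 1] x) := by
    intro i
    induction i with
    | zero => intro _; simpa using h0
    | succ i ih =>
      intro hi
      have h1 := ih (by omega)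
      have h2 := Nat.find_min (exists_iterate_return ψ A hx) (m := i) (by omega)
      rw [Function.iterate_succ_apply']
      exact hs _ h2 h1
  exact key _ le_rfl

theorem firstReturn_inj [Finite D] (ψ : Equiv.Perm D) (A : D → Prop) {x y : D} (hx : A x)
    (hy : A y) (h : firstReturn ψ A x = firstReturn ψ A y) : x = y := by
  have aux : ∀ {x y : D} (hx : A x) (hy : A y),
      Nat.find (exists_iterate_return ψ A hx) ≤ Nat.find (exists_iterate_return ψ A hy) →
      firstReturn ψ A x = firstReturn ψ A y → x = y := by
    intro x y hx hy hle h
    rw [firstReturn, dif_pos hx, firstReturn, dif_pos hy] at h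
    obtain ⟨c, hc⟩ := Nat.exists_eq_add_of_le hle
    rw [hc, show Nat.find (exists_iterate_return ψ A hx) + c + 1
      = Nat.find (exists_iterate_return ψ A hx) + 1 + c by ring,
      Function.iterate_add_apply _ _ c] at h
    have h' : x = ψ^[c] y := (ψ.injective.iterate _) h
    rcases c with _ | c
    · simpa using h'
    · exact absurd (h' ▸ hx) (Nat.find_min (exists_iterate_return ψ A hy) (by omega))
  rcases le_total (Nat.find (exists_iterate_return ψ A hx))
    (Nat.find (exists_iterate_return ψ A hy)) with hle | hle
  · exact aux hx hy hle h
  · exact (aux hy hx hle h.symm).symm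

end FirstReturn

section Orbit

variable {D : Type*} [Fintype D]

/-- The orbit of a point under a permutation, as a finset. -/
def permOrbit (φ : Equiv.Perm D) (a : D) : Finset D := Finset.univ.filter fun d => φ.SameCycle a d

variable {φ : Equiv.Perm D} {a b d : D}

theorem mem_permOrbit : d ∈ permOrbit φ a ↔ φ.SameCycle a d := by simp [permOrbit]

theorem self_mem_permOrbit : a ∈ permOrbit φ a := by
  rw [mem_permOrbit]

theorem permOrbit_eq (h : d ∈ permOrbit φ a) : permOrbit φ d = permOrbit φ a := by
  ext x
  rw [mem_permOrbit] at *
  rw [mem_permOrbit]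
  exact ⟨fun h' => h.trans h', fun h' => h.symm.trans h'⟩

theorem map_mem_permOrbit (h : d ∈ permOrbit φ a) : φ d ∈ permOrbit φ a := by
  rw [mem_permOrbit] at *
  exact Equiv.Perm.sameCycle_apply_right.2 h

theorem symm_mem_permOrbit (h : d ∈ permOrbit φ a) : φ.symm d ∈ permOrbit φ a := by
  rw [mem_permOrbit] at *
  rwa [← Equiv.Perm.sameCycle_apply_right, Equiv.apply_symm_apply]

theorem permOrbit_closed {P : D → Prop} (hP : ∀ x, P x → P (φ x)) (ha : P a)
    (h : d ∈ permOrbit φ a) : P d := by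
  rw [mem_permOrbit] at h
  obtain ⟨i, rfl⟩ := h.exists_nat_pow_eq
  rw [← Equiv.Perm.iterate_eq_pow]
  induction i with
  | zero => exact ha
  | succ i ih =>
    rw [Function.iterate_succ_apply']
    exact hP _ (ih ((Equiv.Perm.sameCycle_pow_right).2 (Equiv.Perm.SameCycle.refl _ _)))

theorem permOrbit_eq_image (φ : Equiv.Perm D) (a : D) :
    permOrbit φ a = (Finset.range (Function.minimalPeriod φ a)).image fun i => φ^[i] a := by
  have hper : a ∈ Function.periodicPts φ := by
    refine ⟨orderOf φ, orderOf_pos φ, ?_⟩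
    rw [Function.IsPeriodicPt, Function.IsFixedPt, Equiv.Perm.iterate_eq_pow, pow_orderOf_eq_one]
    rfl
  have hpos := Function.minimalPeriod_pos_of_mem_periodicPts hper
  ext x
  rw [mem_permOrbit, Finset.mem_image]
  constructor
  · intro h
    obtain ⟨i, rfl⟩ := h.exists_nat_pow_eq
    refine ⟨i % Function.minimalPeriod φ a, Finset.mem_range.2 (Nat.mod_lt _ hpos), ?_⟩
    rw [Function.iterate_mod_minimalPeriod_eq, Equiv.Perm.iterate_eq_pow]
  · rintro ⟨i, -, rfl⟩
    rw [Equiv.Perm.iterate_eq_pow]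
    exact (Equiv.Perm.sameCycle_pow_right).2 (Equiv.Perm.SameCycle.refl _ _)

theorem card_permOrbit (φ : Equiv.Perm D) (a : D) :
    (permOrbit φ a).card = Function.minimalPeriod φ a := by
  rw [permOrbit_eq_image, Finset.card_image_of_injOn, Finset.card_range]
  intro i hi j hj h
  exact Function.iterate_injOn_Iio_minimalPeriod (Finset.mem_range.1 (Finset.mem_coe.1 hi))
    (Finset.mem_range.1 (Finset.mem_coe.1 hj)) h

theorem exists_iterate_of_mem_permOrbit (h : d ∈ permOrbit φ a) :
    ∃ i < (permOrbit φ a).card, φ^[i] a = d := by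
  rw [card_permOrbit]
  rw [permOrbit_eq_image, Finset.mem_image] at h
  obtain ⟨i, hi, h⟩ := h
  exact ⟨i, Finset.mem_range.1 hi, h⟩

theorem iterate_card_permOrbit (φ : Equiv.Perm D) (a : D) :
    φ^[(permOrbit φ a).card] a = a := by
  rw [card_permOrbit]; exact Function.iterate_minimalPeriod

theorem iterate_ne_of_lt_card {i : ℕ} (h0 : 0 < i) (hi : i < (permOrbit φ a).card) :
    φ^[i] a ≠ a := by
  rw [card_permOrbit] at hi
  intro h
  have : Function.IsPeriodicPt φ i a := h
  exact absurd (this.minimalPeriod_le h0) (by omega)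

end Orbit

/-- Combinatorial planarisation of a straight-line drawing without three pairwise crossing edges.
Darts are the directed pieces of edges; `ι` reverses a dart, `ρ` rotates it about its origin,
`o` says that the origin is a vertex of the drawing, `e` is the directed edge carrying the dart,
`X` is the crossing relation between directed edges, `pos` is the position along the edge and
`Lft v ε` says that the vertex `v` is to the left of `ε`. -/
structure CrossMap (D P : Type*) where
  ι : Equiv.Perm D
  ρ : Equiv.Perm D
  o : D → Prop
  e : D → P × P
  X : P × P → P × P → Prop
  pos : D → ℝ
  Lft : P → P × P → Prop
  ι_ι : ∀ d, ι (ι d) = d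
  e_ι : ∀ d, e (ι d) = (e d).swap
  e_ne : ∀ d, (e d).1 ≠ (e d).2
  o_ρ : ∀ d, o (ρ d) ↔ o d
  e_ρ : ∀ d, o d → (e (ρ d)).1 = (e d).1
  e_ρρ : ∀ d, ¬ o d → e (ρ (ρ d)) = (e d).swap
  ρ_four : ∀ d, ¬ o d → ρ (ρ (ρ (ρ d))) = d
  X_ρ : ∀ d, ¬ o d → X (e d) (e (ρ d))
  X_symm : ∀ x y, X x y → X y x
  X_swap : ∀ x y, X x y → X x y.swap
  X_ne : ∀ x y, X x y → x.1 ≠ y.1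
  X_no3 : ∀ x y z, X x y → X y z → X x z → False
  uniq_o : ∀ d d', o d → o d' → e d = e d' → d = d'
  uniq_X : ∀ d d', ¬ o d → ¬ o d' → e d = e d' →
    e (ρ d) = e (ρ d') ∨ e (ρ d) = (e (ρ d')).swap → d = d'
  pos_lt : ∀ d, ¬ o (ι d) → pos d < pos (ρ (ρ (ι d)))
  whole : ∀ d d', o d → o (ι d) → e d' = e d → d' = d
  lft : ∀ d, o d → ¬ o (ι d) → Lft (e d).1 (e (ρ.symm (ι d)))
  lft_swap : ∀ v ε, Lft v ε → ¬ Lft v ε.swap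
  deg : ∀ d, o d → ρ (ρ d) ≠ d

namespace CrossMap

variable {D P : Type*} (M : CrossMap D P)

/-- The face permutation. -/
def φ : Equiv.Perm D := M.ι.trans M.ρ.symm

theorem φ_def (d : D) : M.φ d = M.ρ.symm (M.ι d) := rfl

variable {M} {d a b c : D}

theorem ρ_φ (d : D) : M.ρ (M.φ d) = M.ι d := by simp [φ_def]

theorem φ_ι_ρ (d : D) : M.φ (M.ι (M.ρ d)) = d := by simp [φ_def, M.ι_ι]

theorem φ_symm (d : D) : M.φ.symm d = M.ι (M.ρ d) := by
  rw [Equiv.symm_apply_eq, φ_ι_ρ]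

theorem X_ne12 {x y : P × P} (h : M.X x y) : x.1 ≠ y.2 := M.X_ne _ _ (M.X_swap _ _ h)

theorem X_irrefl (x : P × P) : ¬ M.X x x := fun h => M.X_ne _ _ h rfl

theorem o_φ (d : D) : M.o (M.φ d) ↔ M.o (M.ι d) := by rw [← M.o_ρ, ρ_φ]

theorem e_ρ_φ (d : D) : M.e (M.ρ (M.φ d)) = (M.e d).swap := by rw [ρ_φ, M.e_ι]

theorem X_φ (h : ¬ M.o (M.φ d)) : M.X (M.e d) (M.e (M.φ d)) := by
  have := M.X_ρ _ h
  rw [e_ρ_φ] at this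
  exact M.X_symm _ _ (by simpa using M.X_swap _ _ this)

theorem e_φ (h : M.o (M.φ d)) : (M.e (M.φ d)).1 = (M.e d).2 := by
  have := M.e_ρ _ h
  rw [e_ρ_φ] at this
  exact this.symm

/-- The last dart before the corner is the reverse of the next dart around the vertex. -/
theorem o_φ_symm (a : D) : M.o (M.φ.symm a) ↔ M.o (M.φ (M.ρ a)) := by
  rw [φ_symm, o_φ]

theorem e_φ_symm (a : D) : M.e (M.φ.symm a) = (M.e (M.ρ a)).swap := by
  rw [φ_symm, M.e_ι]

theorem ρ_ρ_symm (h : ¬ M.o d) : M.ρ (M.ρ d) = M.ρ.symm (M.ρ.symm d) := by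
  have h1 : ¬ M.o (M.ρ.symm (M.ρ.symm d)) := by
    rwa [← M.o_ρ, ← M.o_ρ, Equiv.apply_symm_apply, Equiv.apply_symm_apply]
  have := M.ρ_four _ h1
  simpa using this

/-- Two steps back from a corner one runs along the edge crossing the next edge. -/
theorem e_φ_symm_symm (h : ¬ M.o (M.φ.symm a)) :
    M.e (M.φ.symm (M.φ.symm a)) = M.e (M.φ (M.ρ a)) := by
  rw [e_φ_symm (M.φ.symm a), φ_symm a, φ_def]
  rw [φ_symm] at h
  rw [← M.o_ρ] at h
  have h2 := M.e_ρρ _ h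
  rw [← h2, ρ_ρ_symm (d := M.ι (M.ρ a)) ((M.o_ρ _).not.1 h), Equiv.apply_symm_apply]

theorem pos_φ_symm_symm (h : ¬ M.o (M.φ.symm a)) :
    M.pos (M.φ.symm (M.φ.symm a)) < M.pos (M.φ (M.ρ a)) := by
  have h1 : ¬ M.o (M.ι (M.φ.symm (M.φ.symm a))) := by
    rwa [← o_φ, Equiv.apply_symm_apply]
  have := M.pos_lt _ h1
  rw [φ_symm (M.φ.symm a), M.ι_ι, φ_symm a] at this
  rw [φ_symm a] at h
  rw [φ_symm (M.φ.symm a), φ_symm a, φ_def]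
  rwa [ρ_ρ_symm ((M.o_ρ _).not.2 h), Equiv.symm_apply_apply] at this

theorem φ_eq_symm (h : M.φ b = a) : M.φ.symm a = b := by
  rw [Equiv.symm_apply_eq, h]

theorem φ_ne_self : M.o (M.φ d) → M.φ d ≠ d := by
  intro h h'
  have := e_φ h
  rw [h'] at this
  exact M.e_ne _ this

/-- An edge between two vertices cannot bound its face from both sides consecutively. -/
theorem φ_ne_ι (h : M.o (M.φ d)) : M.φ d ≠ M.ι d := by
  intro h'
  rw [φ_def, Equiv.symm_apply_eq] at h'
  have h1 : M.o (M.ι d) := (o_φ d).1 h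
  apply M.deg _ h1
  rw [← h', ← h']

/-- Two consecutive crossings of the same two edges cannot follow each other on a face. -/
theorem e_φ_φ_φ_ne (h2 : ¬ M.o (M.φ (M.φ d)))
    (h3 : ¬ M.o (M.φ (M.φ (M.φ d)))) : M.e (M.φ d) ≠ M.e (M.φ (M.φ (M.φ d))) := by
  intro h
  set x := M.φ d with hx
  set y := M.φ x with hy
  set z := M.φ y with hz
  have ho : ¬ M.o (M.ι y) := by rw [← o_φ]; exact h3
  have hρ : M.ρ z = M.ι y := by rw [hz, ρ_φ]
  have hρy : M.ρ y = M.ι x := by rw [hy, ρ_φ]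
  have hρ2 : ¬ M.o (M.ρ (M.ρ (M.ι y))) := by rwa [M.o_ρ, M.o_ρ]
  have key : y = M.ρ (M.ρ (M.ι y)) := by
    apply M.uniq_X _ _ h2 hρ2
    · rw [M.e_ρρ _ ho, M.e_ι, Prod.swap_swap]
    · right
      rw [← hρ, M.ρ_four _ h3, hρy, M.e_ι, h]
  have := M.pos_lt y ho
  rw [← key] at this
  exact lt_irrefl _ this

/-- The reversal of a dart between two crossings sees the neighbouring edges interchanged. -/
theorem reverse_inner (h1 : ¬ M.o d) (h2 : ¬ M.o (M.φ d)) :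
    ¬ M.o (M.ι d) ∧ ¬ M.o (M.φ (M.ι d)) ∧ M.e (M.φ (M.ι d)) = M.e (M.φ.symm d) ∧
      M.e (M.φ.symm (M.ι d)) = M.e (M.φ d) := by
  refine ⟨by rwa [← o_φ], by rwa [o_φ, M.ι_ι], ?_, ?_⟩
  · rw [e_φ_symm, φ_def, M.ι_ι]
    have : ¬ M.o (M.ρ.symm d) := by rwa [← M.o_ρ, Equiv.apply_symm_apply]
    have := M.e_ρρ _ this
    rw [Equiv.apply_symm_apply] at this
    rw [this, Prod.swap_swap]
  · rw [e_φ_symm, ← ρ_φ, M.e_ρρ _ h2, Prod.swap_swap]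

end CrossMap

namespace CrossMap

variable {D P : Type*} [Fintype D] (M : CrossMap D P)

/-- The orbit of a dart under the face permutation. -/
def orb (a : D) : Finset D := permOrbit M.φ a

/-- The darts of the face of `a` that leave a vertex. -/
def origs (a : D) : Finset D := (M.orb a).filter M.o

/-- The darts of the face of `a` that join two vertices. -/
def wholes (a : D) : Finset D := (M.orb a).filter fun d => M.o d ∧ M.o (M.φ d)

/-- The corner `a` is the only vertex of a triangular face. -/
def Tri (a : D) : Prop := (M.origs a).card = 1 ∧ (M.orb a).card = 3

/-- The share of the charge of its face that the corner `a` receives. -/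
def val (a : D) : ℤ :=
  if M.Tri a then 0
  else if (M.origs a).card = 1 then 24 * (M.orb a).card - 84
  else if (M.origs a).card = 2 then 12 * (M.orb a).card - 24 - 3 * (M.wholes a).card
  else if (M.origs a).card = 3 then
    44 - 10 * (M.wholes a).card
      + 12 * ((if ¬ M.o (M.φ a) ∧ ¬ M.o (M.φ (M.φ a)) then 1 else 0)
        + (if ¬ M.o (M.φ.symm a) ∧ ¬ M.o (M.φ.symm (M.φ.symm a)) then 1 else 0))
  else 24 + 15 * ((if ¬ M.o (M.φ a) then 1 else 0) + (if ¬ M.o (M.φ.symm a) then 1 else 0))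

variable {M} {a b c d : D}

theorem self_orb : a ∈ M.orb a := self_mem_permOrbit

theorem φ_orb (h : d ∈ M.orb a) : M.φ d ∈ M.orb a := map_mem_permOrbit h

theorem φs_orb (h : d ∈ M.orb a) : M.φ.symm d ∈ M.orb a := symm_mem_permOrbit h

theorem iter1 (h : (M.orb a).card = 1) : M.φ a = a := by
  have := iterate_card_permOrbit M.φ a
  rwa [show (permOrbit M.φ a).card = 1 from h] at this

theorem iter2 (h : (M.orb a).card = 2) : M.φ (M.φ a) = a := by
  have := iterate_card_permOrbit M.φ a
  rwa [show (permOrbit M.φ a).card = 2 from h] at this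

theorem iter3 (h : (M.orb a).card = 3) : M.φ (M.φ (M.φ a)) = a := by
  have := iterate_card_permOrbit M.φ a
  rwa [show (permOrbit M.φ a).card = 3 from h] at this

theorem iter4 (h : (M.orb a).card = 4) : M.φ (M.φ (M.φ (M.φ a))) = a := by
  have := iterate_card_permOrbit M.φ a
  rwa [show (permOrbit M.φ a).card = 4 from h] at this

theorem iter5 (h : (M.orb a).card = 5) : M.φ (M.φ (M.φ (M.φ (M.φ a)))) = a := by
  have := iterate_card_permOrbit M.φ a
  rwa [show (permOrbit M.φ a).card = 5 from h] at this

theorem iter_ne (i : ℕ) (h0 : 0 < i) (h : i < (M.orb a).card) : M.φ^[i] a ≠ a :=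
  iterate_ne_of_lt_card h0 h

theorem orb_cases2 (h : (M.orb a).card = 2) (hd : d ∈ M.orb a) : d = a ∨ d = M.φ a := by
  obtain ⟨i, hi, rfl⟩ := exists_iterate_of_mem_permOrbit hd
  rw [show (permOrbit M.φ a).card = 2 from h] at hi
  interval_cases i <;> simp

theorem orb_cases3 (h : (M.orb a).card = 3) (hd : d ∈ M.orb a) :
    d = a ∨ d = M.φ a ∨ d = M.φ (M.φ a) := by
  obtain ⟨i, hi, rfl⟩ := exists_iterate_of_mem_permOrbit hd
  rw [show (permOrbit M.φ a).card = 3 from h] at hi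
  interval_cases i <;> simp

theorem orb_cases4 (h : (M.orb a).card = 4) (hd : d ∈ M.orb a) :
    d = a ∨ d = M.φ a ∨ d = M.φ (M.φ a) ∨ d = M.φ (M.φ (M.φ a)) := by
  obtain ⟨i, hi, rfl⟩ := exists_iterate_of_mem_permOrbit hd
  rw [show (permOrbit M.φ a).card = 4 from h] at hi
  interval_cases i <;> simp

theorem card_orb_pos : 0 < (M.orb a).card := Finset.card_pos.2 ⟨a, self_orb⟩

theorem mem_origs : d ∈ M.origs a ↔ d ∈ M.orb a ∧ M.o d := by simp [origs]

theorem mem_wholes : d ∈ M.wholes a ↔ d ∈ M.orb a ∧ M.o d ∧ M.o (M.φ d) := by simp [wholes]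

theorem origs_two (hn : (M.origs a).card = 2) (hb : b ∈ M.origs a) (hc : c ∈ M.origs a)
    (h : b ≠ c) (hd : d ∈ M.origs a) : d = b ∨ d = c := by
  by_contra hh
  push Not at hh
  have : ({d, b, c} : Finset D) ⊆ M.origs a := by
    intro x hx
    simp only [Finset.mem_insert, Finset.mem_singleton] at hx
    rcases hx with rfl | rfl | rfl <;> assumption
  have := Finset.card_le_card this
  rw [Finset.card_eq_three.2 ⟨d, b, c, hh.1, hh.2, h, rfl⟩] at this
  omega

theorem origs_one (hn : (M.origs a).card = 1) (hb : b ∈ M.origs a) (hd : d ∈ M.origs a) :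
    d = b := Finset.card_le_one.1 hn.le _ hd _ hb

theorem origs_three (hn : (M.origs a).card = 3) (ha : a ∈ M.origs a) (hb : b ∈ M.origs a)
    (hc : c ∈ M.origs a) (hab : a ≠ b) (hac : a ≠ c) (hbc : b ≠ c) (hd : d ∈ M.origs a) :
    d = a ∨ d = b ∨ d = c := by
  have h3 : ({a, b, c} : Finset D) ⊆ M.origs a := by
    intro x hx
    simp only [Finset.mem_insert, Finset.mem_singleton] at hx
    rcases hx with rfl | rfl | rfl <;> assumption
  have h4 := Finset.eq_of_subset_of_card_le h3
    (by rw [hn, Finset.card_eq_three.2 ⟨a, b, c, hab, hac, hbc, rfl⟩])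
  rw [← h4] at hd
  simpa using hd

theorem wholes_le : (M.wholes a).card ≤ (M.origs a).card :=
  Finset.card_le_card fun x hx => by
    rw [mem_wholes] at hx; rw [mem_origs]; exact ⟨hx.1, hx.2.1⟩

theorem wholes_lt (ho : M.o a) (h : ¬ M.o (M.φ a) ∨ ¬ M.o (M.φ.symm a)) :
    (M.wholes a).card < (M.origs a).card := by
  have ha : a ∈ M.origs a := mem_origs.2 ⟨self_orb, ho⟩
  rcases h with h | h
  · have : M.wholes a ⊆ (M.origs a).erase a := by
      intro x hx
      rw [mem_wholes] at hx
      refine Finset.mem_erase.2 ⟨?_, mem_origs.2 ⟨hx.1, hx.2.1⟩⟩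
      rintro rfl
      exact h hx.2.2
    have := Finset.card_le_card this
    rw [Finset.card_erase_of_mem ha] at this
    have := Finset.card_pos.2 ⟨a, ha⟩
    omega
  · have : (M.wholes a).image M.φ ⊆ (M.origs a).erase a := by
      intro x hx
      obtain ⟨y, hy, rfl⟩ := Finset.mem_image.1 hx
      rw [mem_wholes] at hy
      refine Finset.mem_erase.2 ⟨?_, mem_origs.2 ⟨φ_orb hy.1, hy.2.2⟩⟩
      intro hya
      rw [← hya, Equiv.symm_apply_apply] at h
      exact h hy.2.1
    have := Finset.card_le_card this
    rw [Finset.card_erase_of_mem ha, Finset.card_image_of_injective _ M.φ.injective] at this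
    have := Finset.card_pos.2 ⟨a, ha⟩
    omega

end CrossMap

namespace CrossMap

variable {D P : Type*} [Fintype D] {M : CrossMap D P} {a b c d : D}

theorem val_one (h : (M.origs a).card = 1) (ht : ¬ M.Tri a) :
    M.val a = 24 * (M.orb a).card - 84 := by
  rw [val, if_neg ht, if_pos h]

theorem val_two (h : (M.origs a).card = 2) :
    M.val a = 12 * (M.orb a).card - 24 - 3 * (M.wholes a).card := by
  have ht : ¬ M.Tri a := fun ht => by have := ht.1; omega
  rw [val, if_neg ht, if_neg (by omega), if_pos h]

theorem val_three (h : (M.origs a).card = 3) :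
    M.val a = 44 - 10 * (M.wholes a).card
      + 12 * ((if ¬ M.o (M.φ a) ∧ ¬ M.o (M.φ (M.φ a)) then 1 else 0)
        + (if ¬ M.o (M.φ.symm a) ∧ ¬ M.o (M.φ.symm (M.φ.symm a)) then 1 else 0)) := by
  have ht : ¬ M.Tri a := fun ht => by have := ht.1; omega
  rw [val, if_neg ht, if_neg (by omega), if_neg (by omega), if_pos h]

theorem val_ge_three (h : (M.origs a).card = 3) : 44 - 10 * ((M.wholes a).card : ℤ) ≤ M.val a := by
  rw [val_three h]; split_ifs <;> norm_num

theorem val_four (h : 4 ≤ (M.origs a).card) :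
    M.val a = 24 + 15 * ((if ¬ M.o (M.φ a) then 1 else 0)
      + (if ¬ M.o (M.φ.symm a) then 1 else 0)) := by
  have ht : ¬ M.Tri a := fun ht => by have := ht.1; omega
  rw [val, if_neg ht, if_neg (by omega), if_neg (by omega), if_neg (by omega)]

theorem self_origs (h : M.o a) : a ∈ M.origs a := mem_origs.2 ⟨self_orb, h⟩

theorem origs_pos (h : M.o a) : 0 < (M.origs a).card := Finset.card_pos.2 ⟨a, self_origs h⟩


theorem sector_CC (ho : M.o a) (ht : ¬ M.Tri a) (h1 : ¬ M.o (M.φ a)) (h2 : ¬ M.o (M.φ.symm a)) :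
    ((M.val a = 12 ∧ M.X (M.e (M.φ a)) (M.e (M.φ (M.ρ a))) ∧ ¬ M.o (M.φ (M.φ a)) ∧
        M.e (M.φ (M.φ a)) = M.e (M.φ (M.ρ a)) ∧
        M.pos (M.φ (M.φ a)) < M.pos (M.φ (M.ρ a))) ∨
      (M.val a = 24 ∧ (M.e (M.φ a)).2 = (M.e (M.φ (M.ρ a))).1) ∨ 34 ≤ M.val a) ∧
    (M.e (M.φ a) = M.e (M.φ (M.ρ a)) → 42 ≤ M.val a) := by
  have hA := e_φ_symm_symm h2
  have hB := pos_φ_symm_symm h2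
  rw [← hA]
  have ha := self_origs ho
  have hpos := origs_pos ho
  have hkp : 0 < (M.orb a).card := card_orb_pos
  have hw : ∀ d ∈ M.wholes a, d ≠ a ∧ M.φ d ≠ a := by
    intro d hd
    rw [mem_wholes] at hd
    constructor
    · rintro rfl; exact h1 hd.2.2
    · intro h
      rw [← h, Equiv.symm_apply_apply] at h2
      exact h2 hd.2.1
  have hw0 : (M.origs a).card = 2 → (M.wholes a).card = 0 := by
    intro hn
    rw [Finset.card_eq_zero, Finset.eq_empty_iff_forall_notMem]
    intro d hd
    have hd' := mem_wholes.1 hd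
    have := origs_one (M := M) (a := a) (b := d) (d := M.φ d)
    have h5 := origs_two hn ha (mem_origs.2 ⟨hd'.1, hd'.2.1⟩) (hw d hd).1.symm
      (mem_origs.2 ⟨φ_orb hd'.1, hd'.2.2⟩)
    rcases h5 with h5 | h5
    · exact (hw d hd).2 h5
    · exact φ_ne_self hd'.2.2 h5
  have hw1 : (M.origs a).card = 3 → (M.wholes a).card ≤ 1 := by
    intro hn
    by_contra! hc
    obtain ⟨b, hb, c, hc, hbc⟩ := Finset.one_lt_card.1 hc
    have hb' := mem_wholes.1 hb
    have hc' := mem_wholes.1 hc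
    have key := fun d => origs_three (d := d) hn ha (mem_origs.2 ⟨hb'.1, hb'.2.1⟩)
      (mem_origs.2 ⟨hc'.1, hc'.2.1⟩) (hw b hb).1.symm (hw c hc).1.symm hbc
    have hφb : M.φ b = c := by
      rcases key _ (mem_origs.2 ⟨φ_orb hb'.1, hb'.2.2⟩) with h | h | h
      · exact absurd h (hw b hb).2
      · exact absurd h (φ_ne_self hb'.2.2)
      · exact h
    have hφc : M.φ c = b := by
      rcases key _ (mem_origs.2 ⟨φ_orb hc'.1, hc'.2.2⟩) with h | h | h
      · exact absurd h (hw c hc).2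
      · exact h
      · exact absurd h (φ_ne_self hc'.2.2)
    have : a = b ∨ a = c := by
      have hab : a ∈ permOrbit M.φ b := by
        rw [permOrbit_eq hb'.1]; exact self_orb
      refine permOrbit_closed (P := fun x => x = b ∨ x = c) ?_ (Or.inl rfl) hab
      rintro x (rfl | rfl)
      · exact Or.inr hφb
      · exact Or.inl hφc
    rcases this with h | h
    · exact (hw b hb).1 h.symm
    · exact (hw c hc).1 h.symm
  rcases (by omega : (M.origs a).card = 1 ∨ (M.origs a).card = 2 ∨ (M.origs a).card = 3 ∨
    4 ≤ (M.origs a).card) with hn | hn | hn | hn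
  · have hv := val_one hn ht
    have hno : ∀ d ∈ M.orb a, d ≠ a → ¬ M.o d := fun d hd hda hod =>
      hda (origs_one hn ha (mem_origs.2 ⟨hd, hod⟩))
    have h3 : (M.orb a).card ≠ 3 := fun h => ht ⟨hn, h⟩
    rcases (by omega : (M.orb a).card = 1 ∨ (M.orb a).card = 2 ∨ (M.orb a).card = 4 ∨
      (M.orb a).card = 5 ∨ 6 ≤ (M.orb a).card) with hk | hk | hk | hk | hk
    · exact absurd (by rwa [iter1 hk]) h1
    · exfalso
      have hx := X_φ h1
      have hk := iter2 hk
      have := e_φ (d := M.φ a) (by rwa [hk])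
      rw [hk] at this
      exact X_ne12 hx this
    · have h4 := iter4 hk
      have hs := φ_eq_symm h4
      have hss := φ_eq_symm (show M.φ (M.φ (M.φ a)) = M.φ.symm a from hs.symm)
      rw [hss] at hA hB ⊢
      have hy : ¬ M.o (M.φ (M.φ a)) := hno _ (φ_orb (φ_orb self_orb))
        (iter_ne 2 (by norm_num) (by omega))
      have hX := X_φ hy
      refine ⟨Or.inl ⟨by rw [hv, hk]; norm_num, hX, hy, rfl, hB⟩, fun h => ?_⟩
      rw [← h] at hX
      exact absurd hX (X_irrefl _)
    · have h4 := iter5 hk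
      have hs := φ_eq_symm h4
      have hss := φ_eq_symm (show M.φ (M.φ (M.φ (M.φ a))) = M.φ.symm a from hs.symm)
      rw [hss] at hA hB ⊢
      refine ⟨Or.inr (Or.inr (by rw [hv, hk]; norm_num)), fun h => ?_⟩
      refine absurd h (e_φ_φ_φ_ne ?_ ?_)
      · exact hno _ (φ_orb (φ_orb self_orb)) (iter_ne 2 (by norm_num) (by omega))
      · exact hno _ (φ_orb (φ_orb (φ_orb self_orb))) (iter_ne 3 (by norm_num) (by omega))
    · exact ⟨Or.inr (Or.inr (by rw [hv]; omega)), fun _ => by rw [hv]; omega⟩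
  · have hv := val_two hn
    rw [hw0 hn] at hv
    obtain ⟨b, hb, hba⟩ : ∃ b ∈ M.origs a, b ≠ a := Finset.exists_mem_ne (by omega) a
    have hb' := mem_origs.1 hb
    rcases (by omega : (M.orb a).card = 1 ∨ (M.orb a).card = 2 ∨ (M.orb a).card = 3 ∨
      (M.orb a).card = 4 ∨ (M.orb a).card = 5 ∨ 6 ≤ (M.orb a).card)
      with hk | hk | hk | hk | hk | hk
    · exact absurd (by rwa [iter1 hk]) h1
    · rcases orb_cases2 hk hb'.1 with rfl | rfl
      · exact absurd rfl hba
      · exact absurd hb'.2 h1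
    · rw [φ_eq_symm (iter3 hk)] at h2
      rcases orb_cases3 hk hb'.1 with rfl | rfl | rfl
      · exact absurd rfl hba
      · exact absurd hb'.2 h1
      · exact absurd hb'.2 h2
    · have hs := φ_eq_symm (iter4 hk)
      have hss := φ_eq_symm (show M.φ (M.φ (M.φ a)) = M.φ.symm a from hs.symm)
      have hbb : b = M.φ (M.φ a) := by
        rw [hs] at h2
        rcases orb_cases4 hk hb'.1 with rfl | rfl | rfl | rfl
        · exact absurd rfl hba
        · exact absurd hb'.2 h1
        · rfl
        · exact absurd hb'.2 h2
      rw [hss]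
      have h12 : (M.e (M.φ a)).2 = (M.e (M.φ (M.φ a))).1 := (e_φ (hbb ▸ hb'.2)).symm
      refine ⟨Or.inr (Or.inl ⟨by rw [hv, hk]; norm_num, h12⟩), fun h => ?_⟩
      rw [← h] at h12
      exact absurd h12.symm (M.e_ne _)
    · have hs := φ_eq_symm (iter5 hk)
      have hss := φ_eq_symm (show M.φ (M.φ (M.φ (M.φ a))) = M.φ.symm a from hs.symm)
      rw [hss]
      refine ⟨Or.inr (Or.inr (by rw [hv, hk]; norm_num)), fun h => ?_⟩
      exfalso
      by_cases h3 : M.o (M.φ (M.φ a))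
      · have hne2 : M.φ (M.φ a) ≠ a := iter_ne 2 (by norm_num) (by omega)
        have hx : ¬ M.o (M.φ (M.φ (M.φ a))) := by
          intro hx
          rcases origs_two hn ha (mem_origs.2 ⟨φ_orb (φ_orb self_orb), h3⟩) hne2.symm
            (mem_origs.2 ⟨φ_orb (φ_orb (φ_orb self_orb)), hx⟩) with h' | h'
          · exact iter_ne (M := M) (a := a) 3 (by norm_num) (by omega) h'
          · exact φ_ne_self hx h'
        have hX := X_φ hx
        have h4 := e_φ h3
        rw [← h] at hX
        exact X_ne12 hX h4
      · have hX := X_φ h3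
        by_cases hx : M.o (M.φ (M.φ (M.φ a)))
        · have h4 := e_φ hx
          rw [← h] at h4
          exact X_ne12 hX h4
        · exact e_φ_φ_φ_ne h3 hx h
    · exact ⟨Or.inr (Or.inr (by rw [hv]; omega)), fun _ => by rw [hv]; omega⟩
  · have hv := val_ge_three hn
    have hw1 := hw1 hn
    refine ⟨Or.inr (Or.inr (by omega)), fun h => ?_⟩
    by_contra! hlt
    have hw1' : (M.wholes a).card = 1 := by omega
    have hv3 := val_three hn
    rw [hw1'] at hv3
    have hb : M.o (M.φ (M.φ a)) := by
      by_contra hb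
      rw [if_pos ⟨h1, hb⟩] at hv3
      split_ifs at hv3 <;> norm_num at hv3 <;> omega
    have hc : M.o (M.φ.symm (M.φ.symm a)) := by
      by_contra hb
      rw [if_pos (c := _ ∧ ¬ M.o (M.φ.symm (M.φ.symm a))) ⟨h2, hb⟩] at hv3
      split_ifs at hv3 <;> norm_num at hv3 <;> omega
    set b := M.φ (M.φ a) with hbd
    set c := M.φ.symm (M.φ.symm a) with hcd
    have hφc : M.φ c = M.φ.symm a := by rw [hcd, Equiv.apply_symm_apply]
    have hbo : b ∈ M.orb a := φ_orb (φ_orb self_orb)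
    have hco : c ∈ M.orb a := φs_orb (φs_orb self_orb)
    have hba : b ≠ a := by
      intro hba
      rw [hbd] at hba
      rw [φ_eq_symm hba] at h2
      have := e_φ (d := M.φ a) (by rwa [hba])
      rw [hba] at this
      exact X_ne12 (X_φ h1) this
    obtain ⟨d, hd⟩ := Finset.card_pos.1 (by omega : 0 < (M.wholes a).card)
    have hd' := mem_wholes.1 hd
    have hda := hw d hd
    have hca : c ≠ a := by
      intro hca
      rw [hca] at hφc
      have h3 : M.φ (M.φ a) = a := by rw [hφc, Equiv.apply_symm_apply]
      exact hba h3
    have hdc : d ≠ c := by rintro rfl; rw [hφc] at hd'; exact h2 hd'.2.2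
    have hφdb : M.φ d ≠ b := by
      intro h'
      have := M.φ.injective h'
      rw [this] at hd'
      exact h1 hd'.2.1
    have hbc : b ≠ c := by
      intro hbc
      have h4 : M.φ (M.φ (M.φ (M.φ a))) = a := by
        rw [← hbd, hbc, hφc, Equiv.apply_symm_apply]
      have : ∀ x ∈ M.origs a, x = a ∨ x = b := by
        intro x hx
        have hx' := mem_origs.1 hx
        have : x = a ∨ x = M.φ a ∨ x = b ∨ x = M.φ b := by
          refine permOrbit_closed (P := fun x => x = a ∨ x = M.φ a ∨ x = b ∨ x = M.φ b)
            ?_ (Or.inl rfl) hx'.1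
          rintro x (rfl | rfl | rfl | rfl)
          · simp
          · simp [hbd]
          · simp
          · left; exact h4
        rcases this with h | h | h | h
        · exact Or.inl h
        · rw [h] at hx'; exact absurd hx'.2 h1
        · exact Or.inr h
        · rw [h, hbc, hφc] at hx'; exact absurd hx'.2 h2
      have h5 : M.origs a ⊆ {a, b} := fun x hx => by simpa using this x hx
      have := (Finset.card_le_card h5).trans Finset.card_le_two
      omega
    have key := fun d => origs_three (d := d) hn ha (mem_origs.2 ⟨hbo, hb⟩)
      (mem_origs.2 ⟨hco, hc⟩) hba.symm hca.symm hbc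
    have hdb : d = b := by
      rcases key d (mem_origs.2 ⟨hd'.1, hd'.2.1⟩) with h | h | h
      · exact absurd h hda.1
      · exact h
      · exact absurd h hdc
    have hφbc : M.φ b = c := by
      rw [hdb] at hd' hda hφdb
      rcases key _ (mem_origs.2 ⟨φ_orb hd'.1, hd'.2.2⟩) with h | h | h
      · exact absurd h hda.2
      · exact absurd h hφdb
      · exact h
    have e1 := e_φ (d := M.φ a) hb
    have e2 := e_φ (d := b) (hφbc ▸ hc)
    rw [hφbc] at e2
    have e3 : M.e (M.ι (M.φ a)) = M.e b := by
      rw [M.e_ι]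
      ext
      · rw [Prod.fst_swap]; exact e1.symm
      · rw [Prod.snd_swap, ← e2, h]
    have e4 := M.whole b (M.ι (M.φ a)) hb ((o_φ b).1 (hφbc ▸ hc)) e3
    have e5 : M.o (M.ι b) := (o_φ b).1 (hφbc ▸ hc)
    rw [← e4, M.ι_ι] at e5
    exact h1 e5
  · have hv := val_four hn
    rw [if_pos h1, if_pos h2] at hv
    exact ⟨Or.inr (Or.inr (by omega)), fun _ => by omega⟩

end CrossMap

namespace CrossMap

variable {D P : Type*} [Fintype D] {M : CrossMap D P} {a b c d : D}

theorem sector_UC (ho : M.o a) (h1 : M.o (M.φ a)) (h2 : ¬ M.o (M.φ.symm a)) :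
    ((M.val a = 9 ∧ (M.e (M.φ (M.ρ a))).1 = (M.e a).2) ∨ 21 ≤ M.val a) ∧
    ((M.e (M.φ (M.ρ a))).2 = (M.e a).2 → 33 ≤ M.val a) := by
  rw [← e_φ_symm_symm h2]
  have ha := self_origs ho
  have hkp : 0 < (M.orb a).card := card_orb_pos
  have hb := mem_origs.2 ⟨φ_orb self_orb, h1⟩
  have hba : M.φ a ≠ a := φ_ne_self h1
  have heb := e_φ h1
  have hwpos : 0 < (M.wholes a).card := Finset.card_pos.2 ⟨a, mem_wholes.2 ⟨self_orb, ho, h1⟩⟩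
  have hwlt := wholes_lt ho (Or.inr h2)
  rcases (by omega : (M.origs a).card = 2 ∨ (M.origs a).card = 3 ∨ 4 ≤ (M.origs a).card)
    with hn | hn | hn
  · have hv := val_two hn
    have hw : (M.wholes a).card = 1 := by omega
    rw [hw] at hv
    rcases (by omega : (M.orb a).card = 1 ∨ (M.orb a).card = 2 ∨ (M.orb a).card = 3 ∨
      (M.orb a).card = 4 ∨ 5 ≤ (M.orb a).card) with hk | hk | hk | hk | hk
    · exact absurd (iter1 hk) hba
    · rw [φ_eq_symm (iter2 hk)] at h2; exact absurd h1 h2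
    · have hs := φ_eq_symm (iter3 hk)
      have hss := φ_eq_symm (show M.φ (M.φ a) = M.φ.symm a from hs.symm)
      rw [hss]
      refine ⟨Or.inl ⟨by rw [hv, hk]; norm_num, heb⟩, fun h => ?_⟩
      exact absurd (heb.trans h.symm) (M.e_ne _)
    · have hs := φ_eq_symm (iter4 hk)
      have hss := φ_eq_symm (show M.φ (M.φ (M.φ a)) = M.φ.symm a from hs.symm)
      rw [hss]
      refine ⟨Or.inr (by rw [hv, hk]; norm_num), fun h => ?_⟩
      have hx : ¬ M.o (M.φ (M.φ a)) := by
        intro hx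
        rcases origs_two hn ha hb hba.symm
          (mem_origs.2 ⟨φ_orb (φ_orb self_orb), hx⟩) with h' | h'
        · exact iter_ne (M := M) (a := a) 2 (by norm_num) (by omega) h'
        · exact φ_ne_self hx h'
      exact absurd (heb.trans h.symm) (X_ne12 (X_φ hx))
    · exact ⟨Or.inr (by rw [hv]; omega), fun _ => by rw [hv]; omega⟩
  · have hv := val_ge_three hn
    refine ⟨Or.inr (by omega), fun h => ?_⟩
    by_contra! hlt
    have hw : (M.wholes a).card = 2 := by omega
    have hv3 := val_three hn
    rw [hw] at hv3
    have hc : M.o (M.φ.symm (M.φ.symm a)) := by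
      by_contra hb
      rw [if_pos (c := _ ∧ ¬ M.o (M.φ.symm (M.φ.symm a))) ⟨h2, hb⟩] at hv3
      split_ifs at hv3 <;> norm_num at hv3 <;> omega
    set c := M.φ.symm (M.φ.symm a) with hcd
    have hφc : M.φ c = M.φ.symm a := by rw [hcd, Equiv.apply_symm_apply]
    have hco : c ∈ M.orb a := φs_orb (φs_orb self_orb)
    have hac : a ≠ c := by
      intro h'; rw [← h'] at hφc; rw [← hφc] at h2; exact h2 h1
    have hcb : M.φ a ≠ c := by
      intro h'; rw [← h', ← heb] at h; exact M.e_ne _ h.symm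
    have key := fun d => origs_three (d := d) hn ha hb
      (mem_origs.2 ⟨hco, hc⟩) hba.symm hac hcb
    obtain ⟨d, hd, hda⟩ : ∃ d ∈ M.wholes a, d ≠ a := Finset.exists_mem_ne (by omega) a
    have hd' := mem_wholes.1 hd
    have hdb : d = M.φ a := by
      rcases key _ (mem_origs.2 ⟨hd'.1, hd'.2.1⟩) with h' | h' | h'
      · exact absurd h' hda
      · exact h'
      · rw [h', hφc] at hd'; exact absurd hd'.2.2 h2
    rw [hdb] at hd'
    have hφb : M.φ (M.φ a) = c := by
      rcases key _ (mem_origs.2 ⟨φ_orb hd'.1, hd'.2.2⟩) with h' | h' | h'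
      · rw [φ_eq_symm h'] at h2; exact absurd h1 h2
      · exact absurd h' (φ_ne_self hd'.2.2)
      · exact h'
    have e2 := e_φ hd'.2.2
    have hιb : M.o (M.ι (M.φ a)) := (o_φ _).1 hd'.2.2
    have : c = M.ι (M.φ a) := by
      refine M.whole _ _ hιb (by rw [M.ι_ι]; exact h1) ?_
      rw [M.e_ι, ← hφb]
      ext
      · rw [e2, Prod.fst_swap]
      · rw [hφb, h, Prod.snd_swap, heb]
    exact φ_ne_ι hd'.2.2 (hφb.trans this)
  · have hv := val_four hn
    rw [if_neg (not_not.2 h1), if_pos h2] at hv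
    exact ⟨Or.inr (by omega), fun _ => by omega⟩

theorem sector_CU (ho : M.o a) (h1 : ¬ M.o (M.φ a)) (h2 : M.o (M.φ.symm a)) :
    ((M.val a = 9 ∧ (M.e (M.φ a)).2 = (M.e (M.ρ a)).2) ∨ 21 ≤ M.val a) ∧
    ((M.e (M.φ a)).1 = (M.e (M.ρ a)).2 → 33 ≤ M.val a) := by
  have ha := self_origs ho
  have hkp : 0 < (M.orb a).card := card_orb_pos
  have hb := mem_origs.2 ⟨φs_orb self_orb, h2⟩
  have hφb : M.φ (M.φ.symm a) = a := Equiv.apply_symm_apply _ _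
  have hba : M.φ.symm a ≠ a := by
    intro h; rw [h] at hφb; rw [hφb] at h1; exact h1 ho
  have heb : (M.e (M.φ.symm a)).1 = (M.e (M.ρ a)).2 := by rw [e_φ_symm, Prod.fst_swap]
  rw [← heb]
  have hwpos : 0 < (M.wholes a).card :=
    Finset.card_pos.2 ⟨_, mem_wholes.2 ⟨φs_orb self_orb, h2, by rwa [hφb]⟩⟩
  have hwlt := wholes_lt ho (Or.inl h1)
  rcases (by omega : (M.origs a).card = 2 ∨ (M.origs a).card = 3 ∨ 4 ≤ (M.origs a).card)
    with hn | hn | hn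
  · have hv := val_two hn
    have hw : (M.wholes a).card = 1 := by omega
    rw [hw] at hv
    rcases (by omega : (M.orb a).card = 1 ∨ (M.orb a).card = 2 ∨ (M.orb a).card = 3 ∨
      (M.orb a).card = 4 ∨ 5 ≤ (M.orb a).card) with hk | hk | hk | hk | hk
    · exact absurd (φ_eq_symm (iter1 hk)) hba
    · rw [φ_eq_symm (iter2 hk)] at h2; exact absurd h2 h1
    · have hs := φ_eq_symm (iter3 hk)
      rw [hs]
      have := e_φ (d := M.φ a) (by rwa [← hs])
      refine ⟨Or.inl ⟨by rw [hv, hk]; norm_num, this.symm⟩, fun h => ?_⟩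
      exact absurd (h.trans this) (M.e_ne _)
    · have hs := φ_eq_symm (iter4 hk)
      refine ⟨Or.inr (by rw [hv, hk]; norm_num), fun h => ?_⟩
      have hx : ¬ M.o (M.φ (M.φ a)) := by
        intro hx
        rcases origs_two hn ha hb hba.symm
          (mem_origs.2 ⟨φ_orb (φ_orb self_orb), hx⟩) with h' | h'
        · exact iter_ne (M := M) (a := a) 2 (by norm_num) (by omega) h'
        · rw [hs] at h'
          exact φ_ne_self (M := M) (d := M.φ (M.φ a)) (by rwa [← hs]) h'.symm
      have hX := X_φ hx
      have := e_φ (d := M.φ (M.φ a)) (by rwa [← hs])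
      rw [← hs, ← h] at this
      exact absurd this (X_ne12 hX)
    · exact ⟨Or.inr (by rw [hv]; omega), fun _ => by rw [hv]; omega⟩
  · have hv := val_ge_three hn
    refine ⟨Or.inr (by omega), fun h => ?_⟩
    by_contra! hlt
    have hw : (M.wholes a).card = 2 := by omega
    have hv3 := val_three hn
    rw [hw] at hv3
    have hc : M.o (M.φ (M.φ a)) := by
      by_contra hb
      rw [if_pos ⟨h1, hb⟩] at hv3
      split_ifs at hv3 <;> norm_num at hv3 <;> omega
    set c := M.φ (M.φ a) with hcd
    have hco : c ∈ M.orb a := φ_orb (φ_orb self_orb)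
    have hac : a ≠ c := by
      intro h'
      rw [hcd] at h'
      rw [φ_eq_symm h'.symm] at h2
      exact h1 h2
    have hec := e_φ hc
    have hbc : M.φ.symm a ≠ c := by
      intro h'
      rw [h', hec] at h
      exact M.e_ne _ h
    have key := fun d => origs_three (d := d) hn ha hb
      (mem_origs.2 ⟨hco, hc⟩) hba.symm hac hbc
    obtain ⟨d, hd, hdb⟩ : ∃ d ∈ M.wholes a, d ≠ M.φ.symm a := Finset.exists_mem_ne (by omega) _
    have hd' := mem_wholes.1 hd
    have hdc : d = c := by
      rcases key _ (mem_origs.2 ⟨hd'.1, hd'.2.1⟩) with h' | h' | h'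
      · rw [h'] at hd'; exact absurd hd'.2.2 h1
      · exact absurd h' hdb
      · exact h'
    rw [hdc] at hd'
    have hφc : M.φ c = M.φ.symm a := by
      rcases key _ (mem_origs.2 ⟨φ_orb hd'.1, hd'.2.2⟩) with h' | h' | h'
      · rw [← hφb] at h'
        exact absurd (M.φ.injective h').symm hbc
      · exact h'
      · exact absurd h' (φ_ne_self hd'.2.2)
    have e2 := e_φ hd'.2.2
    rw [hφc] at e2
    have hιc : M.o (M.ι c) := (o_φ _).1 hd'.2.2
    have : M.φ a = M.ι c := by
      refine M.whole _ _ hιc (by rw [M.ι_ι]; exact hc) ?_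
      rw [M.e_ι]
      ext
      · rw [h, e2, Prod.fst_swap]
      · rw [← hec, Prod.snd_swap]
    rw [this] at h1
    exact h1 hιc
  · have hv := val_four hn
    rw [if_pos h1, if_neg (not_not.2 h2)] at hv
    exact ⟨Or.inr (by omega), fun _ => by omega⟩

theorem sector_UU (ho : M.o a) (h1 : M.o (M.φ a)) (h2 : M.o (M.φ.symm a)) :
    14 ≤ M.val a ∧ (24 ≤ M.val a ∨
      ∃ d, M.o d ∧ M.o (M.ι d) ∧ M.e d = ((M.e a).2, (M.e (M.ρ a)).2)) := by
  have ha := self_origs ho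
  have hb := mem_origs.2 ⟨φ_orb self_orb, h1⟩
  have hc := mem_origs.2 ⟨φs_orb self_orb, h2⟩
  have hφc : M.φ (M.φ.symm a) = a := Equiv.apply_symm_apply _ _
  have hba : M.φ a ≠ a := φ_ne_self h1
  have hca : a ≠ M.φ.symm a := by
    intro h'; rw [← h'] at hφc; exact hba hφc
  have heb := e_φ h1
  have hec : (M.e (M.φ.symm a)).1 = (M.e (M.ρ a)).2 := by rw [e_φ_symm, Prod.fst_swap]
  have hea : (M.e a).1 = (M.e (M.φ.symm a)).2 := by
    have := e_φ (d := M.φ.symm a) (by rwa [hφc])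
    rwa [hφc] at this
  have hbc : M.φ a ≠ M.φ.symm a := by
    intro h'
    refine φ_ne_ι h1 (M.whole _ _ ((o_φ _).1 h1) (by rwa [M.ι_ι]) ?_)
    rw [M.e_ι]
    ext
    · rw [heb, Prod.fst_swap]
    · rw [h', Prod.snd_swap, hea]
  have hn3 : 3 ≤ (M.origs a).card := by
    have h3 : ({a, M.φ a, M.φ.symm a} : Finset D) ⊆ M.origs a := by
      intro x hx
      simp only [Finset.mem_insert, Finset.mem_singleton] at hx
      rcases hx with rfl | rfl | rfl <;> assumption
    have := Finset.card_le_card h3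
    rwa [Finset.card_eq_three.2 ⟨_, _, _, hba.symm, hca, hbc, rfl⟩] at this
  have hwle : (M.wholes a).card ≤ (M.origs a).card := wholes_le
  rcases (by omega : (M.origs a).card = 3 ∨ 4 ≤ (M.origs a).card) with hn | hn
  · have hv := val_ge_three hn
    refine ⟨by omega, ?_⟩
    by_contra! hlt
    have hw : (M.wholes a).card = 3 := by omega
    have hww : M.wholes a = M.origs a := by
      refine Finset.eq_of_subset_of_card_le (fun x hx => ?_) (by omega)
      rw [mem_wholes] at hx; rw [mem_origs]; exact ⟨hx.1, hx.2.1⟩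
    have hbw := hb
    rw [← hww, mem_wholes] at hbw
    have hφb : M.φ (M.φ a) = M.φ.symm a := by
      rcases origs_three hn ha hb hc hba.symm hca hbc
        (mem_origs.2 ⟨φ_orb hbw.1, hbw.2.2⟩) with h' | h' | h'
      · exact absurd (φ_eq_symm h').symm hbc
      · exact absurd h' (φ_ne_self hbw.2.2)
      · exact h'
    refine hlt.2 _ h1 ((o_φ _).1 hbw.2.2) ?_
    have := e_φ hbw.2.2
    rw [hφb] at this
    ext
    · exact heb
    · exact this.symm.trans hec
  · have hv := val_four hn
    rw [if_neg (not_not.2 h1), if_neg (not_not.2 h2)] at hv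
    exact ⟨by omega, Or.inl (by omega)⟩

theorem sector_tri (ho : M.o a) (ht : M.Tri a) :
    ¬ M.o (M.φ a) ∧ ¬ M.o (M.φ.symm a) ∧ M.e (M.φ a) = M.e (M.φ (M.ρ a)) ∧
      M.pos (M.φ a) < M.pos (M.φ (M.ρ a)) := by
  have hk := ht.2
  have hno : ∀ d ∈ M.orb a, d ≠ a → ¬ M.o d := fun d hd hda hod =>
    hda (origs_one ht.1 (self_origs ho) (mem_origs.2 ⟨hd, hod⟩))
  have hs := φ_eq_symm (iter3 hk)
  have hss := φ_eq_symm (show M.φ (M.φ a) = M.φ.symm a from hs.symm)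
  have h1 : ¬ M.o (M.φ a) := hno _ (φ_orb self_orb) (iter_ne 1 (by norm_num) (by omega))
  have h2 : ¬ M.o (M.φ.symm a) := by
    rw [hs]
    exact hno _ (φ_orb (φ_orb self_orb)) (iter_ne 2 (by norm_num) (by omega))
  have hA := e_φ_symm_symm h2
  have hB := pos_φ_symm_symm h2
  rw [hss] at hA hB
  exact ⟨h1, h2, hA, hB⟩

end CrossMap

namespace CrossMap

variable {D P : Type*} [Fintype D] (M : CrossMap D P)

/-- The corners at vertices that do not belong to a triangular face with a single vertex. -/
def Act (d : D) : Prop := M.o d ∧ ¬ M.Tri d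

/-- The next active corner around a vertex. -/
def nxt (d : D) : D := firstReturn M.ρ M.Act d

variable {M} {a b c d v : D}

theorem nxt_act (h : M.Act a) : M.Act (M.nxt a) := firstReturn_mem _ _ h

theorem nxt_inj (ha : M.Act a) (hb : M.Act b) (h : M.nxt a = M.nxt b) : a = b :=
  firstReturn_inj _ _ ha hb h

theorem nxt_vertex (h : M.Act a) : (M.e (M.nxt a)).1 = (M.e a).1 := by
  refine (firstReturn_induct M.ρ M.Act (fun d => M.o d ∧ (M.e d).1 = (M.e a).1) h
    ⟨(M.o_ρ _).2 h.1, M.e_ρ _ h.1⟩ ?_).2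
  rintro d - ⟨h1, h2⟩
  exact ⟨(M.o_ρ _).2 h1, (M.e_ρ _ h1).trans h2⟩

theorem nxt_of_o (h : M.Act a) (ho : M.o (M.φ (M.ρ a))) : M.nxt a = M.ρ a := by
  refine firstReturn_induct M.ρ M.Act (fun d => d = M.ρ a) h rfl ?_
  rintro d hd rfl
  exact absurd ⟨(M.o_ρ _).2 h.1, fun ht => (sector_tri ((M.o_ρ _).2 h.1) ht).1 ho⟩ hd

theorem nxt_of_not_o (h : M.Act a) (ho : ¬ M.o (M.φ (M.ρ a))) :
    ¬ M.o (M.φ (M.nxt a)) ∧ M.e (M.φ (M.nxt a)) = M.e (M.φ (M.ρ a)) ∧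
      M.pos (M.φ (M.ρ a)) ≤ M.pos (M.φ (M.nxt a)) := by
  refine (firstReturn_induct M.ρ M.Act (fun d => M.o d ∧ ¬ M.o (M.φ d) ∧
    M.e (M.φ d) = M.e (M.φ (M.ρ a)) ∧ M.pos (M.φ (M.ρ a)) ≤ M.pos (M.φ d)) h
    ⟨(M.o_ρ _).2 h.1, ho, rfl, le_rfl⟩ ?_).2
  rintro d hd ⟨h1, -, h3, h4⟩
  have ht : M.Tri d := by
    by_contra ht; exact hd ⟨h1, ht⟩
  obtain ⟨-, t2, t3, t4⟩ := sector_tri h1 ht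
  exact ⟨(M.o_ρ _).2 h1, (o_φ_symm d).not.1 t2, t3 ▸ h3, h4.trans t4.le⟩

theorem o_φ_symm_iff (h : M.Act a) : M.o (M.φ.symm a) ↔ M.o (M.φ (M.nxt a)) := by
  rw [o_φ_symm]
  by_cases ho : M.o (M.φ (M.ρ a))
  · rw [nxt_of_o h ho]
  · exact ⟨fun h' => absurd h' ho, fun h' => absurd h' (nxt_of_not_o h ho).1⟩

theorem nxt_CC (h : M.Act a) (h1 : ¬ M.o (M.φ a)) (h2 : ¬ M.o (M.φ (M.nxt a))) :
    ((M.val a = 12 ∧ M.X (M.e (M.φ a)) (M.e (M.φ (M.nxt a))) ∧ ¬ M.o (M.φ (M.φ a)) ∧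
        M.e (M.φ (M.φ a)) = M.e (M.φ (M.nxt a)) ∧
        M.pos (M.φ (M.φ a)) < M.pos (M.φ (M.nxt a))) ∨
      (M.val a = 24 ∧ (M.e (M.φ a)).2 = (M.e (M.φ (M.nxt a))).1) ∨ 34 ≤ M.val a) ∧
    (M.e (M.φ a) = M.e (M.φ (M.nxt a)) → 42 ≤ M.val a) := by
  have h3 := (o_φ_symm_iff h).not.2 h2
  obtain ⟨-, e2, e3⟩ := nxt_of_not_o h ((o_φ_symm _).not.1 h3)
  have := sector_CC h.1 h.2 h1 h3
  rw [e2]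
  refine ⟨?_, this.2⟩
  rcases this.1 with h4 | h4
  · exact Or.inl ⟨h4.1, h4.2.1, h4.2.2.1, h4.2.2.2.1, h4.2.2.2.2.trans_le e3⟩
  · exact Or.inr h4

theorem nxt_UC (h : M.Act a) (h1 : M.o (M.φ a)) (h2 : ¬ M.o (M.φ (M.nxt a))) :
    ((M.val a = 9 ∧ (M.e (M.φ (M.nxt a))).1 = (M.e a).2) ∨ 21 ≤ M.val a) ∧
    ((M.e (M.φ (M.nxt a))).2 = (M.e a).2 → 33 ≤ M.val a) := by
  have h3 := (o_φ_symm_iff h).not.2 h2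
  obtain ⟨-, e2, e3⟩ := nxt_of_not_o h ((o_φ_symm _).not.1 h3)
  rw [e2]
  exact sector_UC h.1 h1 h3

theorem nxt_CU (h : M.Act a) (h1 : ¬ M.o (M.φ a)) (h2 : M.o (M.φ (M.nxt a))) :
    ((M.val a = 9 ∧ (M.e (M.φ a)).2 = (M.e (M.nxt a)).2) ∨ 21 ≤ M.val a) ∧
    ((M.e (M.φ a)).1 = (M.e (M.nxt a)).2 → 33 ≤ M.val a) := by
  have h3 := (o_φ_symm_iff h).2 h2
  rw [nxt_of_o h ((o_φ_symm _).1 h3)]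
  exact sector_CU h.1 h1 h3

theorem nxt_UU (h : M.Act a) (h1 : M.o (M.φ a)) (h2 : M.o (M.φ (M.nxt a))) :
    14 ≤ M.val a ∧ (24 ≤ M.val a ∨
      ∃ d, M.o d ∧ M.o (M.ι d) ∧ M.e d = ((M.e a).2, (M.e (M.nxt a)).2)) := by
  have h3 := (o_φ_symm_iff h).2 h2
  rw [nxt_of_o h ((o_φ_symm _).1 h3)]
  exact sector_UU h.1 h1 h3

theorem nxt_eq_ρ (h : M.Act a) (h2 : M.o (M.φ (M.nxt a))) : M.nxt a = M.ρ a :=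
  nxt_of_o h ((o_φ_symm _).1 ((o_φ_symm_iff h).2 h2))

theorem val_ge (h : M.Act a) : 9 ≤ M.val a := by
  by_cases h1 : M.o (M.φ a) <;> by_cases h2 : M.o (M.φ (M.nxt a))
  · have := (nxt_UU h h1 h2).1; omega
  · rcases (nxt_UC h h1 h2).1 with h | h <;> omega
  · rcases (nxt_CU h h1 h2).1 with h | h <;> omega
  · rcases (nxt_CC h h1 h2).1 with h | h | h <;> omega

theorem val_ge_CC (h : M.Act a) (h1 : ¬ M.o (M.φ a)) (h2 : ¬ M.o (M.φ (M.nxt a))) :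
    12 ≤ M.val a := by
  rcases (nxt_CC h h1 h2).1 with h | h | h <;> omega

theorem val_nonneg (h : M.o a) : 0 ≤ M.val a := by
  by_cases ht : M.Tri a
  · rw [val, if_pos ht]
  · have := val_ge ⟨h, ht⟩; omega

theorem sum1 (ha : M.Act a) (h : M.nxt a = a) : 42 ≤ M.val a := by
  by_cases h1 : M.o (M.φ a)
  · exfalso
    have h2 := nxt_eq_ρ ha (by rwa [h])
    rw [h] at h2
    exact M.deg a ha.1 (by rw [← h2, ← h2])
  · exact (nxt_CC ha h1 (by rwa [h])).2 (by rw [h])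

theorem sum2_UC (ha : M.Act a) (hb : M.Act b) (hab : M.nxt a = b) (hba : M.nxt b = a)
    (ua : M.o (M.φ a)) (ub : ¬ M.o (M.φ b)) : 42 ≤ M.val a + M.val b := by
  have h1 := nxt_UC ha ua (by rwa [hab])
  have h2 := nxt_CU hb ub (by rwa [hba])
  rw [hab] at h1
  rw [hba] at h2
  rcases h1 with ⟨⟨h1, h1'⟩ | h1, h1''⟩
  · have := h2.2 h1'; omega
  · rcases h2 with ⟨⟨h2, h2'⟩ | h2, h2''⟩
    · have := h1'' h2'; omega
    · omega

theorem sum2 (ha : M.Act a) (hb : M.Act b) (hab : M.nxt a = b) (hba : M.nxt b = a) :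
    42 ≤ M.val a + M.val b := by
  by_cases ua : M.o (M.φ a) <;> by_cases ub : M.o (M.φ b)
  · exfalso
    have h1 := nxt_eq_ρ ha (by rwa [hab])
    have h2 := nxt_eq_ρ hb (by rwa [hba])
    rw [hab] at h1
    rw [hba, h1] at h2
    exact M.deg a ha.1 h2.symm
  · exact sum2_UC ha hb hab hba ua ub
  · rw [add_comm]; exact sum2_UC hb ha hba hab ub ua
  · have h1 := (nxt_CC ha ua (by rwa [hab])).1
    have h2 := (nxt_CC hb ub (by rwa [hba])).1
    rw [hab] at h1
    rw [hba] at h2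
    rcases h1 with ⟨h1, x1, y1, z1, w1⟩ | ⟨h1, x1⟩ | h1 <;>
    rcases h2 with ⟨h2, x2, y2, z2, w2⟩ | ⟨h2, x2⟩ | h2 <;> try omega
    · exfalso
      have r1 : M.e (M.ρ (M.φ (M.φ a))) = (M.e (M.φ a)).swap := e_ρ_φ _
      have ho : ¬ M.o (M.ι (M.φ b)) := by rwa [← o_φ]
      have key : M.φ (M.φ a) = M.ρ (M.ρ (M.ι (M.φ b))) := by
        refine M.uniq_X _ _ y1 (by rwa [M.o_ρ, M.o_ρ]) ?_ ?_
        · rw [M.e_ρρ _ ho, M.e_ι, Prod.swap_swap, z1]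
        · right
          rw [r1, ← ρ_φ, M.ρ_four _ y2, z2]
      have := M.pos_lt _ ho
      rw [← key] at this
      exact lt_asymm this w1
    · exact absurd x2.symm (X_ne12 x1)
    · exact absurd x1.symm (X_ne12 x2)

theorem sum3_U (ha : M.Act a) (hb : M.Act b) (hc : M.Act c) (hab : M.nxt a = b)
    (hbc : M.nxt b = c) (hca : M.nxt c = a) (ua : M.o (M.φ a)) (ub : ¬ M.o (M.φ b))
    (uc : ¬ M.o (M.φ c)) : 42 ≤ M.val a + M.val b + M.val c := by
  have h1 := (nxt_UC ha ua (by rwa [hab])).1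
  have h2 := (nxt_CC hb ub (by rwa [hbc])).1
  have h3 := (nxt_CU hc uc (by rwa [hca])).1
  rw [hab] at h1
  rw [hbc] at h2
  rw [hca] at h3
  rcases h1 with ⟨h1, h1'⟩ | h1 <;> rcases h2 with ⟨h2, x2, -⟩ | ⟨h2, -⟩ | h2 <;>
  rcases h3 with ⟨h3, h3'⟩ | h3 <;> try omega
  exact absurd (h1'.trans h3'.symm) (X_ne12 x2)

theorem sum3_UU (ha : M.Act a) (hb : M.Act b) (hc : M.Act c) (hab : M.nxt a = b)
    (hbc : M.nxt b = c) (hca : M.nxt c = a) (ua : M.o (M.φ a)) (ub : ¬ M.o (M.φ b))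
    (uc : M.o (M.φ c)) : 42 ≤ M.val a + M.val b + M.val c := by
  have h1 := (nxt_UC ha ua (by rwa [hab])).1
  have h2 := (nxt_CU hb ub (by rwa [hbc])).1
  have h3 := nxt_UU hc uc (by rwa [hca])
  rw [hab] at h1
  rw [hbc] at h2
  rw [hca] at h3
  rcases h1 with ⟨h1, h1'⟩ | h1 <;> rcases h2 with ⟨h2, h2'⟩ | h2 <;>
  obtain ⟨h3, h3' | ⟨d, od, oιd, ed⟩⟩ := h3 <;> try omega
  exfalso
  have : M.ι (M.φ b) = d := by
    refine M.whole _ _ od oιd ?_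
    rw [ed, M.e_ι]
    ext
    · exact h2'
    · exact h1'
  rw [← this, M.ι_ι] at oιd
  exact ub oιd

theorem sum3 (ha : M.Act a) (hb : M.Act b) (hc : M.Act c) (hab : M.nxt a = b)
    (hbc : M.nxt b = c) (hca : M.nxt c = a) : 42 ≤ M.val a + M.val b + M.val c := by
  by_cases ua : M.o (M.φ a) <;> by_cases ub : M.o (M.φ b) <;> by_cases uc : M.o (M.φ c)
  · have h1 := (nxt_UU ha ua (by rwa [hab])).1
    have h2 := (nxt_UU hb ub (by rwa [hbc])).1
    have h3 := (nxt_UU hc uc (by rwa [hca])).1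
    omega
  · have := sum3_UU hb hc ha hbc hca hab ub uc ua; omega
  · have := sum3_UU ha hb hc hab hbc hca ua ub uc; omega
  · have := sum3_U ha hb hc hab hbc hca ua ub uc; omega
  · have := sum3_UU hc ha hb hca hab hbc uc ua ub; omega
  · have := sum3_U hb hc ha hbc hca hab ub uc ua; omega
  · have := sum3_U hc ha hb hca hab hbc uc ua ub; omega
  · have h1 := (nxt_CC ha ua (by rwa [hab])).1
    have h2 := (nxt_CC hb ub (by rwa [hbc])).1
    have h3 := (nxt_CC hc uc (by rwa [hca])).1
    rw [hab] at h1
    rw [hbc] at h2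
    rw [hca] at h3
    rcases h1 with ⟨h1, x1, -⟩ | ⟨h1, -⟩ | h1 <;> rcases h2 with ⟨h2, x2, -⟩ | ⟨h2, -⟩ | h2 <;>
    rcases h3 with ⟨h3, x3, -⟩ | ⟨h3, -⟩ | h3 <;> try omega
    exact absurd (M.X_symm _ _ x3) (fun h => M.X_no3 _ _ _ x1 x2 h)

theorem sum4_alt (ha : M.Act a) (hb : M.Act b) (hc : M.Act c) (hd : M.Act d) (hab : M.nxt a = b)
    (hbc : M.nxt b = c) (hcd : M.nxt c = d) (hda : M.nxt d = a) (ua : M.o (M.φ a))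
    (ub : ¬ M.o (M.φ b)) (uc : M.o (M.φ c)) (ud : ¬ M.o (M.φ d)) :
    42 ≤ M.val a + M.val b + M.val c + M.val d := by
  have h1 := (nxt_UC ha ua (by rwa [hab])).1
  have h2 := (nxt_CU hb ub (by rwa [hbc])).1
  have h3 := (nxt_UC hc uc (by rwa [hcd])).1
  have h4 := (nxt_CU hd ud (by rwa [hda])).1
  rw [hab] at h1
  rw [hbc] at h2
  rw [hcd] at h3
  rw [hda] at h4
  rcases h1 with ⟨h1, h1'⟩ | h1 <;> rcases h2 with ⟨h2, h2'⟩ | h2 <;>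
  rcases h3 with ⟨h3, h3'⟩ | h3 <;> rcases h4 with ⟨h4, h4'⟩ | h4 <;> try omega
  exfalso
  have l1 := M.lft b hb.1 (by rwa [← o_φ])
  have l2 := M.lft d hd.1 (by rwa [← o_φ])
  rw [← φ_def] at l1 l2
  have hv : (M.e d).1 = (M.e b).1 := by
    rw [← hcd, nxt_vertex hc, ← hbc, nxt_vertex hb]
  have he : M.e (M.φ d) = (M.e (M.φ b)).swap := by
    ext
    · rw [h3', Prod.fst_swap, h2']
    · rw [h4', Prod.snd_swap, h1']
  rw [hv, he] at l2
  exact M.lft_swap _ _ l1 l2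

theorem sum4 (ha : M.Act a) (hb : M.Act b) (hc : M.Act c) (hd : M.Act d) (hab : M.nxt a = b)
    (hbc : M.nxt b = c) (hcd : M.nxt c = d) (hda : M.nxt d = a) :
    42 ≤ M.val a + M.val b + M.val c + M.val d := by
  have va := val_ge ha
  have vb := val_ge hb
  have vc := val_ge hc
  have vd := val_ge hd
  have cc : ∀ {x y}, M.Act x → M.nxt x = y → ¬ M.o (M.φ x) → ¬ M.o (M.φ y) → 12 ≤ M.val x :=
    fun hx hxy h1 h2 => val_ge_CC hx h1 (by rwa [hxy])
  have uu : ∀ {x y}, M.Act x → M.nxt x = y → M.o (M.φ x) → M.o (M.φ y) → 14 ≤ M.val x :=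
    fun hx hxy h1 h2 => (nxt_UU hx h1 (by rwa [hxy])).1
  by_cases ua : M.o (M.φ a) <;> by_cases ub : M.o (M.φ b) <;> by_cases uc : M.o (M.φ c) <;>
    by_cases ud : M.o (M.φ d)
  · have := uu ha hab ua ub; have := uu hb hbc ub uc; have := uu hc hcd uc ud; omega
  · have := uu ha hab ua ub; have := uu hb hbc ub uc; omega
  · have := uu ha hab ua ub; have := uu hd hda ud ua; omega
  · have := uu ha hab ua ub; have := cc hc hcd uc ud; omega
  · have := uu hc hcd uc ud; have := uu hd hda ud ua; omega
  · exact sum4_alt ha hb hc hd hab hbc hcd hda ua ub uc ud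
  · have := uu hd hda ud ua; have := cc hb hbc ub uc; omega
  · have := cc hb hbc ub uc; have := cc hc hcd uc ud; omega
  · have := uu hb hbc ub uc; have := uu hc hcd uc ud; omega
  · have := uu hb hbc ub uc; have := cc hd hda ud ua; omega
  · have := sum4_alt hb hc hd ha hbc hcd hda hab ub uc ud ua; omega
  · have := cc hc hcd uc ud; have := cc hd hda ud ua; omega
  · have := uu hc hcd uc ud; have := cc ha hab ua ub; omega
  · have := cc ha hab ua ub; have := cc hd hda ud ua; omega
  · have := cc ha hab ua ub; have := cc hb hbc ub uc; omega
  · have := cc ha hab ua ub; have := cc hb hbc ub uc; have := cc hc hcd uc ud; omega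

theorem exists_act (ho : M.o v) : ∃ a, M.Act a ∧ (M.e a).1 = (M.e v).1 := by
  by_contra! h
  obtain ⟨d, hd, hmax⟩ := Finset.exists_max_image
    (Finset.univ.filter fun d => M.o d ∧ (M.e d).1 = (M.e v).1) (fun d => M.pos (M.φ d))
    ⟨v, by simp [ho]⟩
  simp only [Finset.mem_filter, Finset.mem_univ, true_and] at hd hmax
  have ht : M.Tri d := by
    by_contra ht
    exact h d ⟨hd.1, ht⟩ hd.2
  have := hmax (M.ρ d) ⟨(M.o_ρ _).2 hd.1, (M.e_ρ _ hd.1).trans hd.2⟩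
  exact absurd (sector_tri hd.1 ht).2.2.2 (not_lt.2 this)

/-- Every vertex receives a charge of at least 42. -/
theorem vertex_sum (ho : M.o v) :
    42 ≤ ∑ d ∈ Finset.univ.filter (fun d => M.o d ∧ (M.e d).1 = (M.e v).1), M.val d := by
  obtain ⟨a, ha, hav⟩ := exists_act ho
  set S := Finset.univ.filter (fun d => M.o d ∧ (M.e d).1 = (M.e v).1) with hS
  have mem : ∀ {x}, M.Act x → (M.e x).1 = (M.e v).1 → x ∈ S := by
    intro x hx hxv; simp [hS, hx.1, hxv]
  have sub : ∀ T : Finset D, T ⊆ S → ∑ d ∈ T, M.val d ≤ ∑ d ∈ S, M.val d := by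
    intro T hT
    refine Finset.sum_le_sum_of_subset_of_nonneg hT fun i hi _ => ?_
    simp only [hS, Finset.mem_filter] at hi
    exact val_nonneg hi.2.1
  obtain ⟨b, hab⟩ : ∃ b, M.nxt a = b := ⟨_, rfl⟩
  have hb : M.Act b := hab ▸ nxt_act ha
  have hbv : (M.e b).1 = (M.e v).1 := by rw [← hab, nxt_vertex ha, hav]
  obtain ⟨c, hbc⟩ : ∃ b', M.nxt b = b' := ⟨_, rfl⟩
  have hc : M.Act c := hbc ▸ nxt_act hb
  have hcv : (M.e c).1 = (M.e v).1 := by rw [← hbc, nxt_vertex hb, hbv]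
  obtain ⟨d, hcd⟩ : ∃ b', M.nxt c = b' := ⟨_, rfl⟩
  have hd : M.Act d := hcd ▸ nxt_act hc
  have hdv : (M.e d).1 = (M.e v).1 := by rw [← hcd, nxt_vertex hc, hcv]
  obtain ⟨f, hdf⟩ : ∃ b', M.nxt d = b' := ⟨_, rfl⟩
  have hf : M.Act f := hdf ▸ nxt_act hd
  have hfv : (M.e f).1 = (M.e v).1 := by rw [← hdf, nxt_vertex hd, hdv]
  have ma := mem ha hav
  have mb := mem hb hbv
  have mc := mem hc hcv
  have md := mem hd hdv
  have mf := mem hf hfv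
  have inj : ∀ {x y x' y'}, M.Act x → M.Act y → M.nxt x = x' → M.nxt y = y' → x ≠ y → x' ≠ y' :=
    fun hx hy h1 h2 hne h => hne (nxt_inj hx hy (by rw [h1, h2, h]))
  by_cases nab : a = b
  · refine (sum1 ha (hab.trans nab.symm)).trans ?_
    simpa using sub {a} (by simpa using ma)
  have nbc := inj ha hb hab hbc nab
  by_cases nac : a = c
  · refine (sum2 ha hb hab (hbc.trans nac.symm)).trans ?_
    have := sub {a, b} (by
      intro x; simp only [Finset.mem_insert, Finset.mem_singleton]
      rintro (rfl | rfl) <;> assumption)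
    rwa [Finset.sum_pair nab] at this
  have ncd := inj hb hc hbc hcd nbc
  have nbd := inj ha hc hab hcd nac
  by_cases nad : a = d
  · refine (sum3 ha hb hc hab hbc (hcd.trans nad.symm)).trans ?_
    have := sub {a, b, c} (by
      intro x; simp only [Finset.mem_insert, Finset.mem_singleton]
      rintro (rfl | rfl | rfl) <;> assumption)
    rwa [Finset.sum_insert (by simp [nab, nac]), Finset.sum_pair nbc, ← add_assoc] at this
  have ndf := inj hc hd hcd hdf ncd
  have ncf := inj hb hd hbc hdf nbd
  have nbf := inj ha hd hab hdf nad
  by_cases naf : a = f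
  · refine (sum4 ha hb hc hd hab hbc hcd (hdf.trans naf.symm)).trans ?_
    have := sub {a, b, c, d} (by
      intro x; simp only [Finset.mem_insert, Finset.mem_singleton]
      rintro (rfl | rfl | rfl | rfl) <;> assumption)
    rwa [Finset.sum_insert (by simp [nab, nac, nad]), Finset.sum_insert (by simp [nbc, nbd]),
      Finset.sum_pair ncd, ← add_assoc, ← add_assoc] at this
  · have := sub {a, b, c, d, f} (by
   intro x; simp only [Finset.mem_insert, Finset.mem_singleton]
   rintro (rfl | rfl | rfl | rfl | rfl) <;> assumption)
    rw [Finset.sum_insert (by simp [nab, nac, nad, naf]),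
      Finset.sum_insert (by simp [nbc, nbd, nbf]), Finset.sum_insert (by simp [ncd, ncf]),
      Finset.sum_pair ndf] at this
    have := val_ge ha
    have := val_ge hb
    have := val_ge hc
    have := val_ge hd
    have := val_ge hf
    omega

end CrossMap

namespace CrossMap

variable {D P : Type*} [Fintype D] {M : CrossMap D P} {a b c d v : D}

theorem orb_eq (h : d ∈ M.orb a) : M.orb d = M.orb a := permOrbit_eq h

theorem origs_eq (h : d ∈ M.orb a) : M.origs d = M.origs a := by rw [origs, origs, orb_eq h]

theorem wholes_eq (h : d ∈ M.orb a) : M.wholes d = M.wholes a := by rw [wholes, wholes, orb_eq h]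

theorem tri_iff (h : d ∈ M.orb a) : M.Tri d ↔ M.Tri a := by rw [Tri, Tri, orb_eq h, origs_eq h]

theorem card_shift (p q : D → Prop) :
    ((M.orb a).filter fun d => p d ∧ q (M.φ d)).card =
      ((M.orb a).filter fun d => p (M.φ.symm d) ∧ q d).card := by
  refine Finset.card_bij' (fun d _ => M.φ d) (fun d _ => M.φ.symm d) ?_ ?_ ?_ ?_
  · intro d hd
    rw [Finset.mem_filter] at *
    exact ⟨φ_orb hd.1, by simpa using hd.2⟩
  · intro d hd
    rw [Finset.mem_filter] at *
    exact ⟨φs_orb hd.1, by simpa using hd.2⟩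
  · intro d _; simp
  · intro d _; simp

theorem card_outs : ((M.origs a).filter fun d => ¬ M.o (M.φ d)).card + (M.wholes a).card =
    (M.origs a).card := by
  have := Finset.card_filter_add_card_filter_not (s := M.origs a) (fun d => M.o (M.φ d))
  rw [wholes, ← Finset.filter_filter]
  rw [← origs]
  omega

theorem card_ins : ((M.origs a).filter fun d => ¬ M.o (M.φ.symm d)).card + (M.wholes a).card =
    (M.origs a).card := by
  have := Finset.card_filter_add_card_filter_not (s := M.origs a) (fun d => M.o (M.φ.symm d))
  have h2 := card_shift (M := M) (a := a) M.o M.o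
  rw [wholes, h2]
  have h3 : ((M.origs a).filter fun d => M.o (M.φ.symm d)) =
      (M.orb a).filter fun d => M.o (M.φ.symm d) ∧ M.o d := by
    ext x; simp only [origs, Finset.mem_filter]; tauto
  rw [h3] at this
  omega

theorem card_outs_outs2 : ((M.origs a).filter fun d => ¬ M.o (M.φ d)).card +
    ((M.origs a).filter fun d => ¬ M.o (M.φ d) ∧ ¬ M.o (M.φ (M.φ d))).card +
    (M.origs a).card ≤ (M.orb a).card := by
  rw [← Finset.card_image_of_injective _ M.φ.injective,
    ← Finset.card_image_of_injective (Finset.filter _ _)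
      (f := fun d => M.φ (M.φ d)) (M.φ.injective.comp M.φ.injective),
      ← Finset.card_union_of_disjoint,
    ← Finset.card_union_of_disjoint]
  · refine Finset.card_le_card fun x hx => ?_
    simp only [Finset.mem_union, Finset.mem_image, Finset.mem_filter, mem_origs] at hx
    rcases hx with (⟨y, hy, rfl⟩ | ⟨y, hy, rfl⟩) | hx
    · exact φ_orb hy.1.1
    · exact φ_orb (φ_orb hy.1.1)
    · exact hx.1
  · rw [Finset.disjoint_left]
    intro x hx hx'
    simp only [Finset.mem_union, Finset.mem_image, Finset.mem_filter, mem_origs] at hx hx'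
    rcases hx with ⟨y, hy, rfl⟩ | ⟨y, hy, rfl⟩
    · exact hy.2 hx'.2
    · exact hy.2.2 hx'.2
  · rw [Finset.disjoint_left]
    intro x hx hx'
    simp only [Finset.mem_image, Finset.mem_filter, mem_origs] at hx hx'
    obtain ⟨y, hy, rfl⟩ := hx
    obtain ⟨z, hz, hzy⟩ := hx'
    rw [← M.φ.injective hzy] at hy
    exact hz.2.1 hy.1.2

theorem card_ins_ins2 : ((M.origs a).filter fun d => ¬ M.o (M.φ.symm d)).card +
    ((M.origs a).filter fun d => ¬ M.o (M.φ.symm d) ∧ ¬ M.o (M.φ.symm (M.φ.symm d))).card +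
    (M.origs a).card ≤ (M.orb a).card := by
  rw [← Finset.card_image_of_injective _ M.φ.symm.injective,
    ← Finset.card_image_of_injective (Finset.filter _ _)
      (f := fun d => M.φ.symm (M.φ.symm d)) (M.φ.symm.injective.comp M.φ.symm.injective),
    ← Finset.card_union_of_disjoint, ← Finset.card_union_of_disjoint]
  · refine Finset.card_le_card fun x hx => ?_
    simp only [Finset.mem_union, Finset.mem_image, Finset.mem_filter, mem_origs] at hx
    rcases hx with (⟨y, hy, rfl⟩ | ⟨y, hy, rfl⟩) | hx
    · exact φs_orb hy.1.1
    · exact φs_orb (φs_orb hy.1.1)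
    · exact hx.1
  · rw [Finset.disjoint_left]
    intro x hx hx'
    simp only [Finset.mem_union, Finset.mem_image, Finset.mem_filter, mem_origs] at hx hx'
    rcases hx with ⟨y, hy, rfl⟩ | ⟨y, hy, rfl⟩
    · exact hy.2 hx'.2
    · exact hy.2.2 hx'.2
  · rw [Finset.disjoint_left]
    intro x hx hx'
    simp only [Finset.mem_image, Finset.mem_filter, mem_origs] at hx hx'
    obtain ⟨y, hy, rfl⟩ := hx
    obtain ⟨z, hz, hzy⟩ := hx'
    rw [← M.φ.symm.injective hzy] at hy
    exact hz.2.1 hy.1.2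

theorem card_inner : ((M.orb a).filter fun d => ¬ M.o d ∧ ¬ M.o (M.φ d)).card
    + 2 * (M.origs a).card = (M.orb a).card + (M.wholes a).card := by
  have h1 := Finset.card_filter_add_card_filter_not (s := M.orb a) M.o
  have h2 := Finset.card_filter_add_card_filter_not
    (s := (M.orb a).filter fun d => ¬ M.o d) (fun d => ¬ M.o (M.φ d))
  rw [Finset.filter_filter, Finset.filter_filter] at h2
  have h3 : ((M.orb a).filter fun d => ¬ M.o d ∧ M.o (M.φ d)).card =
      ((M.orb a).filter fun d => ¬ M.o (M.φ.symm d) ∧ M.o d).card := by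
    convert card_shift (M := M) (a := a) (fun d => ¬ M.o d) M.o
  have h4 := card_ins (M := M) (a := a)
  have h5 : ((M.origs a).filter fun d => ¬ M.o (M.φ.symm d)) =
      (M.orb a).filter fun d => ¬ M.o (M.φ.symm d) ∧ M.o d := by
    ext x; simp only [origs, Finset.mem_filter]; tauto
  rw [h5, ← h3] at h4
  simp only [not_not] at h2
  rw [← origs] at h1
  omega

variable (M) in
/-- A dart inside a face all four of whose corners are crossings. -/
def Quad (d : D) : Prop := (M.origs d).card = 0 ∧ (M.orb d).card = 4

variable (M) in
/-- A dart between crossings that can support a triangular face. -/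
def Free (d : D) : Prop := ¬ M.o d ∧ ¬ M.o (M.φ d) ∧ ¬ M.Quad d ∧ ¬ M.Tri d

theorem quad_iff (h : d ∈ M.orb a) : M.Quad d ↔ M.Quad a := by
  rw [Quad, Quad, orb_eq h, origs_eq h]

theorem not_o_of_origs (h : (M.origs a).card = 0) (hd : d ∈ M.orb a) : ¬ M.o d := fun ho => by
  have := Finset.card_pos.2 ⟨d, mem_origs.2 ⟨hd, ho⟩⟩
  omega

theorem four_le_of_origs_zero (h : (M.origs a).card = 0) : 4 ≤ (M.orb a).card := by
  have hkp : 0 < (M.orb a).card := card_orb_pos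
  have h0 : ¬ M.o a := not_o_of_origs h self_orb
  have h1 : ¬ M.o (M.φ a) := not_o_of_origs h (φ_orb self_orb)
  have h2 : ¬ M.o (M.φ (M.φ a)) := not_o_of_origs h (φ_orb (φ_orb self_orb))
  have h3 : ¬ M.o (M.φ (M.φ (M.φ a))) := not_o_of_origs h (φ_orb (φ_orb (φ_orb self_orb)))
  by_contra! hlt
  rcases (by omega : (M.orb a).card = 1 ∨ (M.orb a).card = 2 ∨ (M.orb a).card = 3) with hk | hk | hk
  · have := X_φ h1
    rw [iter1 hk] at this
    exact X_irrefl _ this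
  · exact e_φ_φ_φ_ne h2 h3 (by rw [iter2 hk])
  · have x1 := X_φ h1
    have x2 := X_φ h2
    have x3 := X_φ h3
    rw [iter3 hk] at x3
    exact M.X_no3 _ _ _ x1 x2 (M.X_symm _ _ x3)

theorem face_sum (a : D) : ∑ d ∈ M.origs a, M.val d ≤
    6 * (5 * (((M.orb a).card : ℤ) + (M.origs a).card - 4) - ((M.orb a).filter M.Free).card
      - ((M.origs a).filter fun d => ¬ M.Tri d).card) := by
  by_cases ht : M.Tri a
  · have h1 : ((M.orb a).filter M.Free).card = 0 := by
      rw [Finset.card_eq_zero, Finset.filter_eq_empty_iff]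
      exact fun d hd hf => hf.2.2.2 ((tri_iff hd).2 ht)
    have h2 : ((M.origs a).filter fun d => ¬ M.Tri d).card = 0 := by
      rw [Finset.card_eq_zero, Finset.filter_eq_empty_iff]
      exact fun d hd hf => hf ((tri_iff (mem_origs.1 hd).1).2 ht)
    rw [h1, h2, ht.1, ht.2, Finset.sum_eq_zero]
    · norm_num
    · intro d hd
      rw [val, if_pos ((tri_iff (mem_origs.1 hd).1).2 ht)]
  have h2 : ((M.origs a).filter fun d => ¬ M.Tri d) = M.origs a := by
    rw [Finset.filter_eq_self]
    exact fun d hd h => ht ((tri_iff (mem_origs.1 hd).1).1 h)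
  rw [h2]
  have hle : (M.wholes a).card ≤ (M.origs a).card := wholes_le
  have hfree : ((M.orb a).filter M.Free).card + 2 * (M.origs a).card ≤
      (M.orb a).card + (M.wholes a).card := by
    rw [← card_inner]
    refine Nat.add_le_add_right (Finset.card_le_card fun x hx => ?_) _
    rw [Finset.mem_filter] at *
    exact ⟨hx.1, hx.2.1, hx.2.2.1⟩
  have ho := card_outs (M := M) (a := a)
  have hi := card_ins (M := M) (a := a)
  have ho2 := card_outs_outs2 (M := M) (a := a)
  have hi2 := card_ins_ins2 (M := M) (a := a)
  rcases (by omega : (M.origs a).card = 0 ∨ (M.origs a).card = 1 ∨ (M.origs a).card = 2 ∨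
    (M.origs a).card = 3 ∨ 4 ≤ (M.origs a).card) with hn | hn | hn | hn | hn
  · have h4 := four_le_of_origs_zero hn
    rw [Finset.card_eq_zero.1 hn, Finset.sum_empty]
    rcases eq_or_lt_of_le h4 with hk | hk
    · have h1 : ((M.orb a).filter M.Free).card = 0 := by
        rw [Finset.card_eq_zero, Finset.filter_eq_empty_iff]
        exact fun d hd hf => hf.2.2.1 ((quad_iff hd).2 ⟨hn, hk.symm⟩)
      rw [h1, ← hk]; norm_num
    · simp only [Finset.card_empty]; omega
  · obtain ⟨b, hb⟩ := Finset.card_eq_one.1 hn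
    have hbm : b ∈ M.origs a := hb ▸ Finset.mem_singleton_self b
    have hbo := (mem_origs.1 hbm).1
    have hw : (M.wholes a).card = 0 := by
      rw [Finset.card_eq_zero, Finset.eq_empty_iff_forall_notMem]
      intro d hd
      have hd' := mem_wholes.1 hd
      exact φ_ne_self hd'.2.2 (origs_one hn (mem_origs.2 ⟨hd'.1, hd'.2.1⟩)
        (mem_origs.2 ⟨φ_orb hd'.1, hd'.2.2⟩))
    have hv := val_one (M := M) (a := b) (by rw [origs_eq hbo, hn]) (by rwa [tri_iff hbo])
    rw [hn, hb, Finset.sum_singleton, hv, orb_eq hbo]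
    omega
  · have : ∀ d ∈ M.origs a, M.val d = 12 * (M.orb a).card - 24 - 3 * (M.wholes a).card := by
      intro d hd
      have hdo := (mem_origs.1 hd).1
      rw [val_two (by rw [origs_eq hdo, hn]), orb_eq hdo, wholes_eq hdo]
    rw [Finset.sum_congr rfl this, Finset.sum_const, hn, nsmul_eq_mul]
    omega
  · have : ∀ d ∈ M.origs a, M.val d = 44 - 10 * ((M.wholes a).card : ℤ)
      + 12 * ((if ¬ M.o (M.φ d) ∧ ¬ M.o (M.φ (M.φ d)) then 1 else 0)
        + (if ¬ M.o (M.φ.symm d) ∧ ¬ M.o (M.φ.symm (M.φ.symm d)) then 1 else 0)) := by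
      intro d hd
      have hdo := (mem_origs.1 hd).1
      rw [val_three (by rw [origs_eq hdo, hn]), wholes_eq hdo]
    rw [Finset.sum_congr rfl this, Finset.sum_add_distrib, Finset.sum_const, ← Finset.mul_sum,
      Finset.sum_add_distrib, ← Finset.natCast_card_filter, ← Finset.natCast_card_filter, hn,
      nsmul_eq_mul]
    omega
  · have : ∀ d ∈ M.origs a, M.val d = 24 + 15 * ((if ¬ M.o (M.φ d) then 1 else 0)
      + (if ¬ M.o (M.φ.symm d) then 1 else 0)) := by
      intro d hd
      have hdo := (mem_origs.1 hd).1
      rw [val_four (by rwa [origs_eq hdo])]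
    rw [Finset.sum_congr rfl this, Finset.sum_add_distrib, Finset.sum_const, ← Finset.mul_sum,
      Finset.sum_add_distrib, ← Finset.natCast_card_filter, ← Finset.natCast_card_filter,
      nsmul_eq_mul]
    omega

variable (M) in
/-- Step from a face to the opposite face across a quadrilateral. -/
def across : Equiv.Perm D := (M.φ.trans M.φ).trans M.ι

variable (M) in
/-- The free dart that supports the triangular face of a corner. -/
def support (d : D) : D := firstReturn M.across (fun d => ¬ M.Quad d) (M.φ.symm d)

theorem not_quad_of_tri (h : M.Tri d) : ¬ M.Quad d := fun h' => by
  have := h.1; have := h'.1; omega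

theorem support_free (ho : M.o d) (ht : M.Tri d) : M.Free (M.support d) := by
  have hq : ¬ M.Quad (M.φ.symm d) := fun h =>
    not_quad_of_tri ht ((quad_iff (φs_orb self_orb)).1 h)
  obtain ⟨t1, t2, -, -⟩ := sector_tri ho ht
  have h3 := iter3 ht.2
  have hs := φ_eq_symm h3
  have hr := firstReturn_mem M.across (fun d => ¬ M.Quad d) hq
  have hI := firstReturn_induct M.across (fun d => ¬ M.Quad d)
    (fun x => ¬ M.o x ∧ ¬ M.o (M.φ x) ∧ (M.e (M.φ x)).1 = (M.e d).1 ∧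
      (M.e (M.φ.symm x)).2 = (M.e d).1) hq ?_ ?_
  · change ¬ M.Quad (M.support d) at hr
    change _ ∧ _ at hI
    rw [← support] at hI
    set r := M.support d
    refine ⟨hI.1, hI.2.1, hr, fun htr => ?_⟩
    have h3 := iter3 htr.2
    have hs := φ_eq_symm h3
    have how : M.o (M.φ (M.φ r)) := by
      obtain ⟨w, hw⟩ := Finset.card_pos.1 (by rw [htr.1]; norm_num : 0 < (M.origs r).card)
      have hw' := mem_origs.1 hw
      rcases orb_cases3 htr.2 hw'.1 with rfl | rfl | rfl
      · exact absurd hw'.2 hI.1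
      · exact absurd hw'.2 hI.2.1
      · exact hw'.2
    have hi := (o_φ _).1 how
    rw [hs] at hI
    refine φ_ne_ι how (M.uniq_o _ _ how hi ?_)
    rw [M.e_ι]
    ext
    · rw [e_φ how, Prod.fst_swap]
    · rw [Prod.snd_swap, hI.2.2.1, hI.2.2.2]
  · have e1 : M.across (M.φ.symm d) = M.ι (M.φ d) := by simp [across]
    rw [e1]
    have hy : ¬ M.o (M.φ (M.φ d)) := by rwa [← hs]
    obtain ⟨r1, r2, r3, r4⟩ := reverse_inner t1 hy
    refine ⟨r1, r2, ?_, ?_⟩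
    · rw [r3, Equiv.symm_apply_apply]
    · rw [r4, ← e_φ (by rwa [h3]), h3]
  · rintro x hx ⟨i1, i2, i3, i4⟩
    have hx : M.Quad x := not_not.1 hx
    have e1 : M.across x = M.ι (M.φ (M.φ x)) := by simp [across]
    have hs := φ_eq_symm (iter4 hx.2)
    obtain ⟨r1, r2, r3, r4⟩ := reverse_inner
      (not_o_of_origs hx.1 (φ_orb (φ_orb self_orb)))
      (not_o_of_origs hx.1 (φ_orb (φ_orb (φ_orb self_orb))))
    rw [e1]
    refine ⟨r1, r2, ?_, ?_⟩
    · rw [r3, Equiv.symm_apply_apply, i3]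
    · rw [r4, ← hs, i4]

theorem card_tri_le_free : (Finset.univ.filter fun d => M.o d ∧ M.Tri d).card ≤
    (Finset.univ.filter M.Free).card := by
  refine Finset.card_le_card_of_injOn M.support ?_ ?_
  · intro d hd
    simp only [Finset.coe_filter, Finset.mem_univ, true_and, Set.mem_ofPred_eq] at *
    exact support_free hd.1 hd.2
  · intro d hd d' hd' h
    simp only [Finset.coe_filter, Finset.mem_univ, true_and, Set.mem_ofPred_eq] at hd hd'
    refine M.φ.symm.injective (firstReturn_inj _ _ ?_ ?_ h)
    · exact fun h => not_quad_of_tri hd.2 ((quad_iff (φs_orb self_orb)).1 h)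
    · exact fun h => not_quad_of_tri hd'.2 ((quad_iff (φs_orb self_orb)).1 h)

theorem sum_orbits (f : D → ℤ) :
    ∑ q : Quotient (Equiv.Perm.SameCycle.setoid M.φ), ∑ d ∈ M.orb q.out, f d = ∑ d, f d := by
  rw [← Finset.sum_fiberwise Finset.univ
    (fun d => (Quotient.mk (Equiv.Perm.SameCycle.setoid M.φ) d)) f]
  refine Finset.sum_congr rfl fun q _ => Finset.sum_congr ?_ fun _ _ => rfl
  ext d
  rw [orb, mem_permOrbit]
  simp only [Finset.mem_filter, Finset.mem_univ, true_and]
  constructor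
  · intro h
    rw [← Quotient.out_eq q]
    exact (Quotient.sound (s := Equiv.Perm.SameCycle.setoid M.φ) h).symm
  · rintro rfl
    exact Quotient.exact (s := Equiv.Perm.SameCycle.setoid M.φ) (Quotient.out_eq _)

/-- A cross map satisfying Euler's inequality has average vertex degree
at most 13. -/
theorem card_origs_le (V : Finset P) (hV : ∀ v ∈ V, ∃ d, M.o d ∧ (M.e d).1 = v)
    (hV' : ∀ d, M.o d → (M.e d).1 ∈ V)
    (hE : Fintype.card D + (Finset.univ.filter M.o).card ≤
      4 * V.card + 4 * Fintype.card (Quotient (Equiv.Perm.SameCycle.setoid M.φ))) :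
    (Finset.univ.filter M.o).card ≤ 13 * V.card := by
  have hf := Finset.sum_le_sum fun (q : Quotient (Equiv.Perm.SameCycle.setoid M.φ))
    (_ : q ∈ Finset.univ) => face_sum (M := M) q.out
  have e0 : ∀ a, ∑ d ∈ M.origs a, M.val d = ∑ d ∈ M.orb a, if M.o d then M.val d else 0 := by
    intro a; rw [origs, Finset.sum_filter]
  have e1 : ∀ a, ((M.orb a).card : ℤ) = ∑ d ∈ M.orb a, 1 := by
    intro a; simp
  have e2 : ∀ a, ((M.origs a).card : ℤ) = ∑ d ∈ M.orb a, if M.o d then 1 else 0 := by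
    intro a; rw [origs, Finset.natCast_card_filter]
  have e3 : ∀ a, (((M.orb a).filter M.Free).card : ℤ) =
      ∑ d ∈ M.orb a, if M.Free d then 1 else 0 := by
    intro a; rw [Finset.natCast_card_filter]
  have e4 : ∀ a, (((M.origs a).filter fun d => ¬ M.Tri d).card : ℤ) =
      ∑ d ∈ M.orb a, if M.o d ∧ ¬ M.Tri d then 1 else 0 := by
    intro a; rw [origs, Finset.filter_filter, Finset.natCast_card_filter]
  simp only [e0, e1, e2, e3, e4] at hf
  rw [sum_orbits, ← Finset.mul_sum, Finset.sum_sub_distrib, Finset.sum_sub_distrib,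
    ← Finset.mul_sum, Finset.sum_sub_distrib, Finset.sum_add_distrib, sum_orbits, sum_orbits,
    sum_orbits, sum_orbits, ← Finset.natCast_card_filter, ← Finset.natCast_card_filter,
    ← Finset.natCast_card_filter, ← Finset.sum_filter] at hf
  simp only [Finset.sum_const, nsmul_eq_mul, Finset.card_univ, mul_one] at hf
  have ht := card_tri_le_free (M := M)
  have hs := Finset.card_filter_add_card_filter_not (s := Finset.univ.filter M.o) M.Tri
  rw [Finset.filter_filter, Finset.filter_filter] at hs
  have hv : ∑ v ∈ V, (42 : ℤ) ≤ ∑ d ∈ Finset.univ.filter M.o, M.val d := by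
    rw [← Finset.sum_fiberwise_of_maps_to (s := Finset.univ.filter M.o) (t := V)
      (g := fun d => (M.e d).1) (fun d hd => hV' d (Finset.mem_filter.1 hd).2)]
    refine Finset.sum_le_sum fun v hv => ?_
    obtain ⟨d, hd, rfl⟩ := hV v hv
    rw [Finset.filter_filter]
    exact vertex_sum hd
  rw [Finset.sum_const, nsmul_eq_mul] at hv
  zify at hE ht hs ⊢
  linarith

end CrossMap

section CyclicSucc

variable {D V K : Type*} [LinearOrder K]

/-- `d'` follows `d` in the cyclic order, by `key`, of the darts with the same origin. -/
def IsCyclicSucc (org : D → V) (key : D → K) (d d' : D) : Prop :=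
  org d' = org d ∧
    ((key d < key d' ∧ ∀ c, org c = org d → key d < key c → key d' ≤ key c) ∨
      (∀ c, org c = org d → key c ≤ key d ∧ key d' ≤ key c))

theorem exists_isCyclicSucc [Fintype D] (org : D → V) (key : D → K) (d : D) :
    ∃ d', IsCyclicSucc org key d d' := by
  by_cases h : ∃ c, org c = org d ∧ key d < key c
  · obtain ⟨d', h1, h2⟩ := Finset.exists_min_image
      (Finset.univ.filter fun c => org c = org d ∧ key d < key c) key
      (by obtain ⟨c, hc⟩ := h; exact ⟨c, by simpa using hc⟩)
    simp only [Finset.mem_filter, Finset.mem_univ, true_and] at h1 h2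
    exact ⟨d', h1.1, Or.inl ⟨h1.2, fun c hc hk => h2 c ⟨hc, hk⟩⟩⟩
  · push Not at h
    obtain ⟨d', h1, h2⟩ := Finset.exists_min_image
      (Finset.univ.filter fun c => org c = org d) key ⟨d, by simp⟩
    simp only [Finset.mem_filter, Finset.mem_univ, true_and] at h1 h2
    exact ⟨d', h1, Or.inr fun c hc => ⟨h c hc, h2 c hc⟩⟩

theorem IsCyclicSucc.inj {org : D → V} {key : D → K}
    (hk : ∀ c d, org c = org d → key c = key d → c = d) {c d d' : D}
    (hc : IsCyclicSucc org key c d') (hd : IsCyclicSucc org key d d') : c = d := by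
  obtain ⟨hc1, hc2⟩ := hc
  obtain ⟨hd1, hd2⟩ := hd
  have hcd : org c = org d := hc1.symm.trans hd1
  apply hk c d hcd
  apply le_antisymm
  · by_contra! hlt
    rcases hc2 with ⟨h1, h2⟩ | h2
    · rcases hd2 with ⟨h3, h4⟩ | h4
      · exact absurd (h4 c hcd hlt) (not_le.2 h1)
      · exact absurd ((h4 c hcd).1) (not_le.2 hlt)
    · rcases hd2 with ⟨h3, h4⟩ | h4
      · exact absurd h3 (not_lt.2 (h2 d hcd.symm).2)
      · exact absurd ((h4 c hcd).1) (not_le.2 hlt)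
  · by_contra! hlt
    rcases hd2 with ⟨h1, h2⟩ | h2
    · rcases hc2 with ⟨h3, h4⟩ | h4
      · exact absurd (h4 d hcd.symm hlt) (not_le.2 h1)
      · exact absurd ((h4 d hcd.symm).1) (not_le.2 hlt)
    · rcases hc2 with ⟨h3, h4⟩ | h4
      · exact absurd h3 (not_lt.2 (h2 c hcd).2)
      · exact absurd ((h4 d hcd.symm).1) (not_le.2 hlt)

theorem IsCyclicSucc.unique {org : D → V} {key : D → K}
    (hk : ∀ c d, org c = org d → key c = key d → c = d) {d c c' : D}
    (hc : IsCyclicSucc org key d c) (hc' : IsCyclicSucc org key d c') : c = c' := by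
  obtain ⟨h1, h2⟩ := hc
  obtain ⟨h3, h4⟩ := hc'
  apply hk c c' (h1.trans h3.symm)
  rcases h2 with ⟨h5, h6⟩ | h6
  · rcases h4 with ⟨h7, h8⟩ | h8
    · exact le_antisymm (h6 _ h3 h7) (h8 _ h1 h5)
    · exact absurd (h8 c h1).1 (not_le.2 h5)
  · rcases h4 with ⟨h7, h8⟩ | h8
    · exact absurd (h6 c' h3).1 (not_le.2 h7)
    · exact le_antisymm (h6 _ h3).2 (h8 _ h1).2

/-- The permutation turning each dart to its cyclic successor around its origin. -/
def cyclicSucc [Fintype D] (org : D → V) (key : D → K)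
    (hk : ∀ c d, org c = org d → key c = key d → c = d) : Equiv.Perm D :=
  Equiv.ofBijective (fun d => (exists_isCyclicSucc org key d).choose)
    (Finite.injective_iff_bijective.1 fun c d h => by
      have h1 := (exists_isCyclicSucc org key c).choose_spec
      have h2 := (exists_isCyclicSucc org key d).choose_spec
      rw [← show (exists_isCyclicSucc org key c).choose =
        (exists_isCyclicSucc org key d).choose from h] at h2
      exact h1.inj hk h2)

theorem cyclicSucc_spec [Fintype D] (org : D → V) (key : D → K)
    (hk : ∀ c d, org c = org d → key c = key d → c = d) (d : D) :
    IsCyclicSucc org key d (cyclicSucc org key hk d) :=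
  (exists_isCyclicSucc org key d).choose_spec

end CyclicSucc

/-- A plane straight-line drawing on a finite vertex set, with distinct abscissae. -/
structure PlaneDrawing (V : Type*) where
  x : V → ℝ
  y : V → ℝ
  R : V → V → Prop
  x_inj : Function.Injective x
  symm : ∀ a b, R a b → R b a
  irrefl : ∀ a, ¬ R a a
  noncross : ∀ a b c d t, R a b → R c d → (a, b) ≠ (c, d) → x a < t → t < x b → x c < t → t < x d →
    y a + (y b - y a) / (x b - x a) * (t - x a) ≠ y c + (y d - y c) / (x d - x c) * (t - x c)
  avoid : ∀ a b u, R a b → x a < x u → x u < x b →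
    y a + (y b - y a) / (x b - x a) * (x u - x a) ≠ y u

namespace PlaneDrawing

variable {V : Type*} (Q : PlaneDrawing V)

/-- The darts of a drawing. -/
abbrev Dart : Type _ := {d : V × V // Q.R d.1 d.2}

/-- The edges of a drawing, directed from left to right. -/
abbrev Seg : Type _ := {d : V × V // Q.R d.1 d.2 ∧ Q.x d.1 < Q.x d.2}

/-- The slope of the line through two vertices. -/
def slope (d : V × V) : ℝ := (Q.y d.2 - Q.y d.1) / (Q.x d.2 - Q.x d.1)

/-- The ordinate at abscissa `t` on the line through two vertices. -/
def ht (d : V × V) (t : ℝ) : ℝ := Q.y d.1 + Q.slope d * (t - Q.x d.1)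

variable {Q}

theorem slope_swap (d : V × V) : Q.slope d.swap = Q.slope d := by
  simp only [slope, Prod.fst_swap, Prod.snd_swap]
  rw [← neg_sub, ← neg_sub (Q.x d.2), neg_div_neg_eq]

theorem ht_fst (d : V × V) : Q.ht d (Q.x d.1) = Q.y d.1 := by simp [ht]

theorem ht_snd (d : V × V) : Q.ht d (Q.x d.2) = Q.y d.2 := by
  by_cases h : d.1 = d.2
  · rw [← h, ht_fst]
  · have : Q.x d.2 - Q.x d.1 ≠ 0 := sub_ne_zero.2 fun e => h (Q.x_inj e).symm
    simp only [ht, slope]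
    field_simp
    ring

theorem ht_eq_ht_add (d : V × V) (t t' : ℝ) : Q.ht d t' = Q.ht d t + Q.slope d * (t' - t) := by
  simp only [ht]; ring

theorem ht_ne {s d : Q.Seg} (h : s ≠ d) {t : ℝ} (h1 : Q.x s.1.1 < t) (h2 : t < Q.x s.1.2)
    (h3 : Q.x d.1.1 < t) (h4 : t < Q.x d.1.2) : Q.ht s.1 t ≠ Q.ht d.1 t :=
  Q.noncross _ _ _ _ t s.2.1 d.2.1 (fun e => h (Subtype.ext e)) h1 h2 h3 h4

theorem ht_ne_y {d : Q.Seg} {u : V} (h1 : Q.x d.1.1 < Q.x u) (h2 : Q.x u < Q.x d.1.2) :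
    Q.ht d.1 (Q.x u) ≠ Q.y u := Q.avoid _ _ _ d.2.1 h1 h2

variable (Q) in
/-- The segment `s` lies above the segment `d`. -/
def Above (s d : Q.Seg) : Prop :=
  max (Q.x s.1.1) (Q.x d.1.1) < min (Q.x s.1.2) (Q.x d.1.2) ∧
    ∀ t, max (Q.x s.1.1) (Q.x d.1.1) < t → t < min (Q.x s.1.2) (Q.x d.1.2) →
      Q.ht d.1 t < Q.ht s.1 t

theorem above_of_lt {s d : Q.Seg}
    (h : max (Q.x s.1.1) (Q.x d.1.1) < min (Q.x s.1.2) (Q.x d.1.2)) {t₀ : ℝ}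
    (h1 : max (Q.x s.1.1) (Q.x d.1.1) ≤ t₀) (h2 : t₀ ≤ min (Q.x s.1.2) (Q.x d.1.2))
    (h0 : Q.ht d.1 t₀ < Q.ht s.1 t₀) : Q.Above s d := by
  refine ⟨h, fun t ht1 ht2 => ?_⟩
  by_contra! hle
  have hne : s ≠ d := by rintro rfl; exact lt_irrefl _ h0
  have hs := ht_eq_ht_add (Q := Q) s.1 t₀
  have hd := ht_eq_ht_add (Q := Q) d.1 t₀
  have hp : 0 < Q.ht s.1 t₀ - Q.ht d.1 t₀ := by linarith
  have hq : 0 ≤ Q.ht d.1 t - Q.ht s.1 t := by linarith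
  obtain ⟨w, hw⟩ : ∃ w, w = (Q.ht s.1 t₀ - Q.ht d.1 t₀) /
      ((Q.ht s.1 t₀ - Q.ht d.1 t₀) + (Q.ht d.1 t - Q.ht s.1 t)) := ⟨_, rfl⟩
  have hw0 : 0 < w := by rw [hw]; positivity
  have hw1 : w ≤ 1 := by rw [hw, div_le_one (by positivity)]; linarith
  have heq : w * ((Q.ht s.1 t₀ - Q.ht d.1 t₀) + (Q.ht d.1 t - Q.ht s.1 t)) =
      Q.ht s.1 t₀ - Q.ht d.1 t₀ := by rw [hw]; field_simp
  have hlo : max (Q.x s.1.1) (Q.x d.1.1) < t₀ + w * (t - t₀) := by nlinarith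
  have hhi : t₀ + w * (t - t₀) < min (Q.x s.1.2) (Q.x d.1.2) := by nlinarith
  rw [max_lt_iff] at hlo
  rw [lt_min_iff] at hhi
  refine ht_ne hne hlo.1 hhi.1 hlo.2 hhi.2 ?_
  rw [hs (t₀ + _), hd (t₀ + _)]
  rw [hs t, hd t] at heq
  linarith

theorem Above.le {s d : Q.Seg} (h : Q.Above s d) {t₀ : ℝ}
    (h1 : max (Q.x s.1.1) (Q.x d.1.1) ≤ t₀) (h2 : t₀ ≤ min (Q.x s.1.2) (Q.x d.1.2)) :
    Q.ht d.1 t₀ ≤ Q.ht s.1 t₀ := by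
  by_contra! hlt
  have hsym : Q.Above d s := by
    refine above_of_lt (t₀ := t₀) ?_ ?_ ?_ hlt
    · rw [max_comm, min_comm]; exact h.1
    · rw [max_comm]; exact h1
    · rw [min_comm]; exact h2
  obtain ⟨t, ht1, ht2⟩ := exists_between h.1
  exact lt_asymm (h.2 t ht1 ht2) (hsym.2 t (by rwa [max_comm]) (by rwa [min_comm]))

theorem above_iff_of_fst_eq {s d : Q.Seg} (h : s.1.1 = d.1.1) :
    Q.Above s d ↔ Q.slope d.1 < Q.slope s.1 := by
  have hs := s.2.2
  have hd := d.2.2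
  have hov : max (Q.x s.1.1) (Q.x d.1.1) < min (Q.x s.1.2) (Q.x d.1.2) := by
    rw [h] at hs ⊢; simp [hs, hd]
  have e (t : ℝ) : Q.ht s.1 t - Q.ht d.1 t =
      (Q.slope s.1 - Q.slope d.1) * (t - Q.x d.1.1) := by simp only [ht, h]; ring
  obtain ⟨t, ht1, ht2⟩ := exists_between hov
  have h1 : Q.x d.1.1 < t := (le_max_right _ _).trans_lt ht1
  constructor
  · intro ha
    have h2 : 0 < (Q.slope s.1 - Q.slope d.1) * (t - Q.x d.1.1) := by
      rw [← e]; linarith [ha.2 t ht1 ht2]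
    linarith [(pos_iff_pos_of_mul_pos h2).2 (by linarith)]
  · intro ha
    refine above_of_lt hov ht1.le ht2.le ?_
    have := mul_pos (sub_pos.2 ha) (sub_pos.2 h1)
    linarith [e t]

theorem above_iff_of_snd_eq {s d : Q.Seg} (h : s.1.2 = d.1.2) :
    Q.Above s d ↔ Q.slope s.1 < Q.slope d.1 := by
  have hs := s.2.2
  have hd := d.2.2
  have hov : max (Q.x s.1.1) (Q.x d.1.1) < min (Q.x s.1.2) (Q.x d.1.2) := by
    rw [h] at hs ⊢; simp [hs, hd]
  have e (t : ℝ) : Q.ht s.1 t - Q.ht d.1 t =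
      (Q.slope d.1 - Q.slope s.1) * (Q.x d.1.2 - t) := by
    have h1 := ht_eq_ht_add (Q := Q) s.1 (Q.x s.1.2) t
    have h2 := ht_eq_ht_add (Q := Q) d.1 (Q.x d.1.2) t
    rw [ht_snd] at h1 h2
    rw [h1, h2, h]; ring
  obtain ⟨t, ht1, ht2⟩ := exists_between hov
  have h1 : t < Q.x d.1.2 := ht2.trans_le (min_le_right _ _)
  constructor
  · intro ha
    have h2 : 0 < (Q.slope d.1 - Q.slope s.1) * (Q.x d.1.2 - t) := by
      rw [← e]; linarith [ha.2 t ht1 ht2]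
    linarith [(pos_iff_pos_of_mul_pos h2).2 (by linarith)]
  · intro ha
    refine above_of_lt hov ht1.le ht2.le ?_
    have := mul_pos (sub_pos.2 ha) (sub_pos.2 h1)
    linarith [e t]

/-- Segments issuing to the right from the same vertex are distinguished by their slopes. -/
theorem seg_ext_fst {s d : Q.Seg} (h : s.1.1 = d.1.1) (hs : Q.slope s.1 = Q.slope d.1) : s = d := by
  by_contra hne
  obtain ⟨t, ht1, ht2⟩ := exists_between (lt_min s.2.2 (h ▸ d.2.2))
  rw [lt_min_iff] at ht2
  refine ht_ne hne ht1 ht2.1 (h ▸ ht1) ht2.2 ?_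
  simp only [ht, h, hs]

theorem seg_ext_snd {s d : Q.Seg} (h : s.1.2 = d.1.2) (hs : Q.slope s.1 = Q.slope d.1) : s = d := by
  by_contra hne
  obtain ⟨t, ht1, ht2⟩ := exists_between (max_lt s.2.2 (h ▸ d.2.2))
  rw [max_lt_iff] at ht1
  refine ht_ne hne ht1.1 ht2 ht1.2 (h ▸ ht2) ?_
  have h1 := ht_eq_ht_add (Q := Q) s.1 (Q.x s.1.2) t
  have h2 := ht_eq_ht_add (Q := Q) d.1 (Q.x d.1.2) t
  rw [ht_snd] at h1 h2
  rw [h1, h2, h, hs]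

end PlaneDrawing

namespace PlaneDrawing

variable {V : Type*} {Q : PlaneDrawing V}

variable (Q) in
/-- Reversal of darts. -/
def rev : Equiv.Perm Q.Dart where
  toFun d := ⟨d.1.swap, Q.symm _ _ d.2⟩
  invFun d := ⟨d.1.swap, Q.symm _ _ d.2⟩
  left_inv d := by simp
  right_inv d := by simp

theorem rev_val (d : Q.Dart) : (Q.rev d).1 = d.1.swap := rfl

theorem rev_rev (d : Q.Dart) : Q.rev (Q.rev d) = d := Subtype.ext (by simp [rev_val])

theorem x_ne (d : Q.Dart) : Q.x d.1.1 ≠ Q.x d.1.2 := fun h =>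
  Q.irrefl d.1.1 (by have := d.2; rwa [← Q.x_inj h] at this)

/-- A segment as a dart to the right. -/
def Seg.dart (s : Q.Seg) : Q.Dart := ⟨s.1, s.2.1⟩

/-- The segment underlying a dart. -/
def toSeg (d : Q.Dart) : Q.Seg :=
  if h : Q.x d.1.1 < Q.x d.1.2 then ⟨d.1, d.2, h⟩
  else ⟨d.1.swap, Q.symm _ _ d.2, lt_of_le_of_ne (not_lt.1 h) (x_ne d).symm⟩

theorem toSeg_dart (s : Q.Seg) : toSeg s.dart = s := by
  have : Q.x s.dart.1.1 < Q.x s.dart.1.2 := s.2.2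
  rw [toSeg, dif_pos this]
  rfl

theorem toSeg_rev_dart (s : Q.Seg) : toSeg (Q.rev s.dart) = s := by
  have : ¬ Q.x (Q.rev s.dart).1.1 < Q.x (Q.rev s.dart).1.2 := not_lt.2 s.2.2.le
  rw [toSeg, dif_neg this]
  exact Subtype.ext (by simp [rev_val, Seg.dart])

theorem eq_dart_or (d : Q.Dart) : d = (toSeg d).dart ∨ d = Q.rev (toSeg d).dart := by
  by_cases h : Q.x d.1.1 < Q.x d.1.2
  · left; rw [toSeg, dif_pos h]; rfl
  · right; rw [toSeg, dif_neg h]; exact Subtype.ext (by simp [rev_val, Seg.dart])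

theorem dart_ind {p : Q.Dart → Prop} (h1 : ∀ s : Q.Seg, p s.dart)
    (h2 : ∀ s : Q.Seg, p (Q.rev s.dart)) (d : Q.Dart) : p d := by
  rcases eq_dart_or d with h | h
  · rw [h]; exact h1 _
  · rw [h]; exact h2 _

variable (Q) in
/-- The key sorting the darts around a vertex counterclockwise. -/
def key (d : Q.Dart) : Bool ×ₗ ℝ := toLex (decide (Q.x d.1.1 < Q.x d.1.2), Q.slope d.1)

theorem key_dart (s : Q.Seg) : Q.key s.dart = toLex (true, Q.slope s.1) := by
  have : Q.x s.dart.1.1 < Q.x s.dart.1.2 := s.2.2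
  simp only [key, this, decide_true]; rfl

theorem key_rev_dart (s : Q.Seg) : Q.key (Q.rev s.dart) = toLex (false, Q.slope s.1) := by
  have : ¬ Q.x (Q.rev s.dart).1.1 < Q.x (Q.rev s.dart).1.2 := not_lt.2 s.2.2.le
  rw [key, decide_eq_false this, rev_val, slope_swap]; rfl

variable (Q) in
/-- The origin of a dart. -/
def org (d : Q.Dart) : V := d.1.1

theorem org_dart (s : Q.Seg) : Q.org s.dart = s.1.1 := rfl

theorem org_rev_dart (s : Q.Seg) : Q.org (Q.rev s.dart) = s.1.2 := rfl

theorem toLex_le_iff (a b : Bool) (x y : ℝ) :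
    (toLex (a, x) ≤ toLex (b, y)) ↔ a < b ∨ a = b ∧ x ≤ y := Prod.Lex.le_iff

theorem key_inj (c d : Q.Dart) (h : Q.org c = Q.org d) (hk : Q.key c = Q.key d) : c = d := by
  induction c using dart_ind with
  | h1 s =>
    induction d using dart_ind with
    | h1 t =>
      rw [key_dart, key_dart] at hk
      rw [seg_ext_fst (s := s) (d := t) h (by simpa using hk)]
    | h2 t =>
      rw [key_dart, key_rev_dart] at hk
      simp at hk
  | h2 s =>
    induction d using dart_ind with
    | h1 t =>
      rw [key_dart, key_rev_dart] at hk
      simp at hk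
    | h2 t =>
      rw [key_rev_dart, key_rev_dart] at hk
      rw [seg_ext_snd (s := s) (d := t) h (by simpa using hk)]

theorem above_and_lt_left_iff (s d : Q.Seg) :
    (Q.Above s d ∧ Q.x d.1.1 < Q.x s.1.1) ↔ (Q.x d.1.1 < Q.x s.1.1 ∧ Q.x s.1.1 < Q.x d.1.2) ∧
      Q.ht d.1 (Q.x s.1.1) < Q.y s.1.1 := by
  constructor
  · rintro ⟨h1, h2⟩
    have h4 : Q.x s.1.1 < Q.x d.1.2 :=
      (le_max_left _ _).trans_lt (h1.1.trans_le (min_le_right _ _))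
    have := h1.le (t₀ := Q.x s.1.1) (by simp [h2.le]) (le_min s.2.2.le h4.le)
    rw [ht_fst] at this
    exact ⟨⟨h2, h4⟩, lt_of_le_of_ne this (ht_ne_y h2 h4)⟩
  · rintro ⟨⟨h3, h4⟩, h5⟩
    refine ⟨above_of_lt (t₀ := Q.x s.1.1) ?_ (by simp [h3.le]) (le_min s.2.2.le h4.le)
      (by rwa [ht_fst]), h3⟩
    rw [max_eq_left h3.le]
    exact lt_min s.2.2 h4

theorem above_and_lt_right_iff (s d : Q.Seg) :
    (Q.Above s d ∧ Q.x s.1.2 < Q.x d.1.2) ↔ (Q.x d.1.1 < Q.x s.1.2 ∧ Q.x s.1.2 < Q.x d.1.2) ∧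
      Q.ht d.1 (Q.x s.1.2) < Q.y s.1.2 := by
  constructor
  · rintro ⟨h1, h2⟩
    have h4 : Q.x d.1.1 < Q.x s.1.2 :=
      (le_max_right _ _).trans_lt (h1.1.trans_le (min_le_left _ _))
    have := h1.le (t₀ := Q.x s.1.2) (max_le s.2.2.le h4.le) (by simp [h2.le])
    rw [ht_snd] at this
    exact ⟨⟨h4, h2⟩, lt_of_le_of_ne this (ht_ne_y h4 h2)⟩
  · rintro ⟨⟨h3, h4⟩, h5⟩
    refine ⟨above_of_lt (t₀ := Q.x s.1.2) ?_ (max_le s.2.2.le h3.le) (by simp [h4.le])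
      (by rwa [ht_snd]), h4⟩
    rw [min_eq_left h4.le]
    exact max_lt s.2.2 h3

variable [Fintype V]

variable (Q) in
/-- Rotation of darts about their origins. -/
def rot : Equiv.Perm Q.Dart := cyclicSucc Q.org Q.key key_inj

theorem rot_spec (d : Q.Dart) : IsCyclicSucc Q.org Q.key d (Q.rot d) := cyclicSucc_spec _ _ _ _

theorem sum_dart {A : Type*} [AddCommMonoid A] (f : Q.Dart → A) :
    ∑ d, f d = ∑ s : Q.Seg, (f s.dart + f (Q.rev s.dart)) := by
  rw [Finset.sum_add_distrib, ← Finset.sum_filter_add_sum_filter_not Finset.univ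
    (fun d : Q.Dart => Q.x d.1.1 < Q.x d.1.2)]
  congr 1
  · symm
    refine Finset.sum_bij (fun s _ => s.dart) ?_ ?_ ?_ ?_
    · intro s _; exact Finset.mem_filter.2 ⟨Finset.mem_univ _, s.2.2⟩
    · intro s _ t _ h; rw [← toSeg_dart s, h, toSeg_dart]
    · intro d hd
      have hd' : Q.x d.1.1 < Q.x d.1.2 := by simpa using hd
      exact ⟨⟨d.1, d.2, hd'⟩, Finset.mem_univ _, rfl⟩
    · intros; rfl
  · symm
    refine Finset.sum_bij (fun s _ => Q.rev s.dart) ?_ ?_ ?_ ?_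
    · intro s _; exact Finset.mem_filter.2 ⟨Finset.mem_univ _, not_lt.2 s.2.2.le⟩
    · intro s _ t _ h; rw [← toSeg_rev_dart s, h, toSeg_rev_dart]
    · intro d hd
      have hd' : ¬ Q.x d.1.1 < Q.x d.1.2 := by simpa using hd
      refine ⟨toSeg d, Finset.mem_univ _, ?_⟩
      rcases eq_dart_or d with h | h
      · rw [h] at hd'; exact absurd (toSeg d).2.2 hd'
      · exact h.symm
    · intros; rfl

/-- `ζ` sums to zero over the segments at each vertex. -/
def Kirchhoff (ζ : Q.Seg → ZMod 2) : Prop :=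
  ∀ z, (∑ s, if s.1.1 = z then ζ s else 0) + (∑ s, if s.1.2 = z then ζ s else 0) = 0

/-- Sum of `ζ` over the segments directly above the left end of `d`. -/
def leftSum (ζ : Q.Seg → ZMod 2) (d : Q.Seg) : ZMod 2 :=
  ∑ s, if Q.Above s d ∧ Q.x s.1.1 ≤ Q.x d.1.1 then ζ s else 0

/-- Sum of `ζ` over the segments directly above the right end of `d`. -/
def rightSum (ζ : Q.Seg → ZMod 2) (d : Q.Seg) : ZMod 2 :=
  ∑ s, if Q.Above s d ∧ Q.x d.1.2 ≤ Q.x s.1.2 then ζ s else 0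

/-- Sum of `ζ` over the segments passing above the vertex `z`. -/
def aboveSum (ζ : Q.Seg → ZMod 2) (z : V) : ZMod 2 :=
  ∑ s, if (Q.x s.1.1 < Q.x z ∧ Q.x z < Q.x s.1.2) ∧ Q.y z < Q.ht s.1 (Q.x z) then ζ s else 0

theorem leftSum_eq (ζ : Q.Seg → ZMod 2) (d : Q.Seg) :
    leftSum ζ d = aboveSum ζ d.1.1 +
      ∑ s, if s.1.1 = d.1.1 ∧ Q.slope d.1 < Q.slope s.1 then ζ s else 0 := by
  rw [leftSum, aboveSum, ← Finset.sum_add_distrib]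
  refine Finset.sum_congr rfl fun s _ => ?_
  by_cases h : s.1.1 = d.1.1
  · rw [above_iff_of_fst_eq h]; simp [h]
  · have hx : Q.x s.1.1 ≠ Q.x d.1.1 := fun e => h (Q.x_inj e)
    simp only [h, false_and, if_false, add_zero]
    refine if_congr ?_ rfl rfl
    constructor
    · rintro ⟨h1, h2⟩
      have h3 := lt_of_le_of_ne h2 hx
      have h4 : Q.x d.1.1 < Q.x s.1.2 :=
        (le_max_right _ _).trans_lt (h1.1.trans_le (min_le_left _ _))
      refine ⟨⟨h3, h4⟩, ?_⟩
      have := h1.le (t₀ := Q.x d.1.1) (by simp [h2]) (le_min h4.le d.2.2.le)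
      rw [ht_fst] at this
      exact lt_of_le_of_ne this (ht_ne_y h3 h4).symm
    · rintro ⟨⟨h3, h4⟩, h5⟩
      refine ⟨above_of_lt (t₀ := Q.x d.1.1) ?_ (by simp [h3.le]) (le_min h4.le d.2.2.le)
        (by rwa [ht_fst]), h3.le⟩
      rw [max_eq_right h3.le]
      exact lt_min h4 d.2.2

theorem rightSum_eq (ζ : Q.Seg → ZMod 2) (d : Q.Seg) :
    rightSum ζ d = aboveSum ζ d.1.2 +
      ∑ s, if s.1.2 = d.1.2 ∧ Q.slope s.1 < Q.slope d.1 then ζ s else 0 := by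
  rw [rightSum, aboveSum, ← Finset.sum_add_distrib]
  refine Finset.sum_congr rfl fun s _ => ?_
  by_cases h : s.1.2 = d.1.2
  · rw [above_iff_of_snd_eq h]; simp [h]
  · have hx : Q.x d.1.2 ≠ Q.x s.1.2 := fun e => h (Q.x_inj e).symm
    simp only [h, false_and, if_false, add_zero]
    refine if_congr ?_ rfl rfl
    constructor
    · rintro ⟨h1, h2⟩
      have h3 := lt_of_le_of_ne h2 hx
      have h4 : Q.x s.1.1 < Q.x d.1.2 :=
        (le_max_left _ _).trans_lt (h1.1.trans_le (min_le_right _ _))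
      refine ⟨⟨h4, h3⟩, ?_⟩
      have := h1.le (t₀ := Q.x d.1.2) (max_le h4.le d.2.2.le) (by simp [h2])
      rw [ht_snd] at this
      exact lt_of_le_of_ne this (ht_ne_y h4 h3).symm
    · rintro ⟨⟨h3, h4⟩, h5⟩
      refine ⟨above_of_lt (t₀ := Q.x d.1.2) ?_ (max_le h3.le d.2.2.le) (by simp [h4.le])
        (by rwa [ht_snd]), h4.le⟩
      rw [min_eq_right h4.le]
      exact max_lt h3 d.2.2

/-- The vertex `u` lies above the segment `d`. -/
def VAbove (d : Q.Seg) (u : V) : Prop :=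
  (Q.x d.1.1 < Q.x u ∧ Q.x u < Q.x d.1.2) ∧ Q.ht d.1 (Q.x u) < Q.y u

theorem Kirchhoff.leftSum_eq_rightSum {ζ : Q.Seg → ZMod 2} (hζ : Kirchhoff ζ) (d : Q.Seg) :
    leftSum ζ d = rightSum ζ d := by
  have h1 : (∑ s, if Q.Above s d then ζ s else 0) =
      leftSum ζ d + ∑ s, if VAbove d s.1.1 then ζ s else 0 := by
    rw [leftSum, ← Finset.sum_add_distrib]
    refine Finset.sum_congr rfl fun s _ => ?_
    rw [VAbove, ← above_and_lt_left_iff, ← not_le]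
    by_cases ha : Q.Above s d <;> by_cases hb : Q.x s.1.1 ≤ Q.x d.1.1 <;> simp [ha, hb]
  have h2 : (∑ s, if Q.Above s d then ζ s else 0) =
      rightSum ζ d + ∑ s, if VAbove d s.1.2 then ζ s else 0 := by
    rw [rightSum, ← Finset.sum_add_distrib]
    refine Finset.sum_congr rfl fun s _ => ?_
    rw [VAbove, ← above_and_lt_right_iff, ← not_le]
    by_cases ha : Q.Above s d <;> by_cases hb : Q.x d.1.2 ≤ Q.x s.1.2 <;> simp [ha, hb]
  have h3 : (∑ s, if VAbove d s.1.1 then ζ s else 0) + (∑ s, if VAbove d s.1.2 then ζ s else 0)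
      = 0 := by
    have e (f : Q.Seg → V) : (∑ s, if VAbove d (f s) then ζ s else 0) =
        ∑ u, if VAbove d u then (∑ s, if f s = u then ζ s else 0) else 0 := by
      simp only [← Finset.sum_filter]
      rw [Finset.sum_comm' (t' := Finset.univ.filter fun s => VAbove d (f s))
        (s' := fun s => {f s})]
      · simp
      · intro u s; simp only [Finset.mem_filter, Finset.mem_univ, true_and, Finset.mem_singleton]
        constructor
        · rintro ⟨h, rfl⟩; exact ⟨rfl, h⟩
        · rintro ⟨rfl, h⟩; exact ⟨h, rfl⟩
    rw [e fun s => s.1.1, e fun s => s.1.2, ← Finset.sum_add_distrib]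
    refine Finset.sum_eq_zero fun u _ => ?_
    split_ifs
    · exact hζ u
    · simp
  have h4 := CharTwo.add_eq_zero.1 h3
  rw [h4] at h1
  exact add_right_cancel (h1.symm.trans h2)

/-- The label of the face to the left of a dart. -/
def label (ζ : Q.Seg → ZMod 2) (d : Q.Dart) : ZMod 2 :=
  leftSum ζ (toSeg d) + if Q.x d.1.1 < Q.x d.1.2 then 0 else ζ (toSeg d)

theorem label_dart (ζ : Q.Seg → ZMod 2) (s : Q.Seg) : label ζ s.dart = leftSum ζ s := by
  have : Q.x s.dart.1.1 < Q.x s.dart.1.2 := s.2.2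
  rw [label, if_pos this, toSeg_dart, add_zero]

theorem label_rev_dart (ζ : Q.Seg → ZMod 2) (s : Q.Seg) :
    label ζ (Q.rev s.dart) = leftSum ζ s + ζ s := by
  have : ¬ Q.x (Q.rev s.dart).1.1 < Q.x (Q.rev s.dart).1.2 := not_lt.2 s.2.2.le
  rw [label, if_neg this, toSeg_rev_dart]

theorem label_rev (ζ : Q.Seg → ZMod 2) (d : Q.Dart) :
    label ζ (Q.rev d) = label ζ d + ζ (toSeg d) := by
  induction d using dart_ind with
  | h1 s => rw [label_rev_dart, label_dart, toSeg_dart]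
  | h2 s => rw [rev_rev, label_rev_dart, label_dart, toSeg_rev_dart, add_assoc,
      CharTwo.add_self_eq_zero, add_zero]

theorem Kirchhoff.sum_org {ζ : Q.Seg → ZMod 2} (hζ : Kirchhoff ζ) (z : V) :
    (∑ c, if Q.org c = z then ζ (toSeg c) else 0) = 0 := by
  rw [sum_dart, Finset.sum_add_distrib]
  simpa only [org_dart, org_rev_dart, toSeg_dart, toSeg_rev_dart] using hζ z

theorem Kirchhoff.label_eq {ζ : Q.Seg → ZMod 2} (hζ : Kirchhoff ζ) (d : Q.Dart) :
    label ζ d = aboveSum ζ (Q.org d) +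
      ∑ c, if Q.org c = Q.org d ∧ Q.key c ≤ Q.key d then ζ (toSeg c) else 0 := by
  rw [sum_dart]
  induction d using dart_ind with
  | h1 s =>
    rw [label_dart, leftSum_eq, Finset.sum_add_distrib]
    simp only [org_dart, org_rev_dart, toSeg_dart, toSeg_rev_dart, key_dart, key_rev_dart,
      toLex_le_iff]
    congr 1
    have h := hζ s.1.1
    rw [← CharTwo.add_eq_zero]
    refine Eq.trans ?_ h
    rw [← add_assoc, ← Finset.sum_add_distrib]
    congr 1
    · refine Finset.sum_congr rfl fun t _ => ?_
      rcases le_or_gt (Q.slope t.1) (Q.slope s.1) with h | h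
      · simp [h, h.not_gt]
      · simp [h, h.not_ge]
    · simp
  | h2 s =>
    rw [label_rev_dart, hζ.leftSum_eq_rightSum, rightSum_eq, Finset.sum_add_distrib, add_assoc]
    simp only [org_dart, org_rev_dart, toSeg_dart, toSeg_rev_dart, key_dart, key_rev_dart,
      toLex_le_iff]
    congr 1
    have e : ζ s = ∑ t, if t = s then ζ t else 0 := by simp
    rw [e, ← Finset.sum_add_distrib]
    simp only [reduceCtorEq, false_and, or_false, lt_self_iff_false, true_and,
      false_or, Bool.lt_iff, and_false, if_false, Finset.sum_const_zero, zero_add]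
    refine Finset.sum_congr rfl fun t _ => ?_
    by_cases hts : t = s
    · subst hts; simp
    · by_cases h1 : t.1.2 = s.1.2
      · have h2 : Q.slope t.1 ≠ Q.slope s.1 := fun e => hts (seg_ext_snd h1 e)
        simp [hts, h1, le_iff_lt_or_eq, h2]
      · simp [hts, h1]

theorem Kirchhoff.label_rev_rot {ζ : Q.Seg → ZMod 2} (hζ : Kirchhoff ζ) (d : Q.Dart) :
    label ζ (Q.rev (Q.rot d)) = label ζ d := by
  obtain ⟨h1, h2⟩ := rot_spec d
  have h3 : label ζ (Q.rev (Q.rot d)) = aboveSum ζ (Q.org d) +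
      ∑ c, if Q.org c = Q.org d ∧ Q.key c < Q.key (Q.rot d) then ζ (toSeg c) else 0 := by
    rw [label_rev, hζ.label_eq, h1, add_assoc]
    congr 1
    have e : ζ (toSeg (Q.rot d)) = ∑ t, if t = Q.rot d then ζ (toSeg t) else 0 := by simp
    rw [e, ← CharTwo.add_eq_zero, ← Finset.sum_add_distrib, ← Finset.sum_add_distrib]
    refine Finset.sum_eq_zero fun t _ => ?_
    by_cases hts : t = Q.rot d
    · subst hts; simp [h1, CharTwo.add_self_eq_zero]
    · by_cases h4 : Q.org t = Q.org d
      · have h5 : Q.key t ≠ Q.key (Q.rot d) := fun e => hts (key_inj _ _ (h4.trans h1.symm) e)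
        simp [hts, h4, le_iff_lt_or_eq, h5, CharTwo.add_self_eq_zero]
      · simp [hts, h4]
  rw [h3, hζ.label_eq]
  congr 1
  rcases h2 with ⟨h4, h5⟩ | h5
  · refine Finset.sum_congr rfl fun c _ => if_congr (and_congr_right fun hc => ?_) rfl rfl
    exact ⟨fun h => not_lt.1 fun h' => absurd (h5 c hc h') (not_le.2 h), fun h => h.trans_lt h4⟩
  · rw [← sub_eq_zero, Finset.sum_eq_zero, zero_sub, neg_eq_zero]
    · refine Eq.trans ?_ (hζ.sum_org (Q.org d))
      refine Finset.sum_congr rfl fun c _ => if_congr ?_ rfl rfl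
      exact ⟨fun h => h.1, fun h => ⟨h, (h5 c h).1⟩⟩
    · intro c _
      rw [if_neg]
      rintro ⟨h, h'⟩
      exact absurd (h5 c h).2 (not_le.2 h')

variable (Q) in
/-- The face permutation. -/
def face : Equiv.Perm Q.Dart := Q.rev.trans Q.rot.symm

theorem Kirchhoff.label_face {ζ : Q.Seg → ZMod 2} (hζ : Kirchhoff ζ) (d : Q.Dart) :
    label ζ (Q.face d) = label ζ d := by
  rw [← hζ.label_rev_rot (Q.face d)]
  simp [face, rev_rev]

theorem Kirchhoff.label_sameCycle {ζ : Q.Seg → ZMod 2} (hζ : Kirchhoff ζ) {c d : Q.Dart}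
    (h : Q.face.SameCycle c d) : label ζ d = label ζ c :=
  permOrbit_closed (φ := Q.face) (P := fun d => label ζ d = label ζ c)
    (fun d hd => (hζ.label_face d).trans hd) rfl (mem_permOrbit.2 h)

variable (Q) in
/-- The boundary map from segments to vertices. -/
def boundary : (Q.Seg → ZMod 2) →ₗ[ZMod 2] (V → ZMod 2) where
  toFun ζ z := (∑ s, if s.1.1 = z then ζ s else 0) + (∑ s, if s.1.2 = z then ζ s else 0)
  map_add' ζ ξ := by
    ext z
    simp only [← Finset.sum_filter, Pi.add_apply, Finset.sum_add_distrib]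
    ring
  map_smul' a ζ := by
    ext z
    simp only [← Finset.sum_filter, Pi.smul_apply, smul_eq_mul, ← Finset.mul_sum, mul_add,
      RingHom.id_apply]

theorem mem_ker_boundary (ζ : Q.Seg → ZMod 2) : ζ ∈ LinearMap.ker Q.boundary ↔ Kirchhoff ζ := by
  rw [LinearMap.mem_ker, funext_iff]; rfl

variable (Q) in
/-- Labels of the faces. -/
def labels : (Q.Seg → ZMod 2) →ₗ[ZMod 2]
    (Quotient (Equiv.Perm.SameCycle.setoid Q.face) → ZMod 2) where
  toFun ζ q := label ζ q.out
  map_add' ζ ξ := by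
    ext q
    simp only [label, leftSum, ← Finset.sum_filter, Pi.add_apply, Finset.sum_add_distrib]
    split_ifs <;> ring
  map_smul' a ζ := by
    ext q
    simp only [label, leftSum, ← Finset.sum_filter, Pi.smul_apply, smul_eq_mul, ← Finset.mul_sum,
      RingHom.id_apply]
    split_ifs <;> ring

variable (Q) in
/-- The inequality half of Euler's formula. -/
theorem card_dart_le : Fintype.card Q.Dart ≤ 2 * Fintype.card V +
    2 * Fintype.card (Quotient (Equiv.Perm.SameCycle.setoid Q.face)) := by
  have h1 : Fintype.card Q.Dart = 2 * Fintype.card Q.Seg := by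
    have := sum_dart (Q := Q) fun _ => 1
    simp at this
    omega
  have h2 := LinearMap.finrank_range_add_finrank_ker Q.boundary
  have h3 : Module.finrank (ZMod 2) (LinearMap.range Q.boundary) ≤ Fintype.card V := by
    simpa using Submodule.finrank_le (LinearMap.range Q.boundary)
  have h4 : Module.finrank (ZMod 2) (LinearMap.ker Q.boundary) ≤
      Fintype.card (Quotient (Equiv.Perm.SameCycle.setoid Q.face)) := by
    have hinj : Function.Injective (Q.labels.comp (LinearMap.ker Q.boundary).subtype) := by
      rw [← LinearMap.ker_eq_bot, LinearMap.ker_eq_bot']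
      rintro ⟨ζ, hζ⟩ h
      rw [mem_ker_boundary] at hζ
      have h0 (d : Q.Dart) : label ζ d = 0 := by
        have := congrFun h (Quotient.mk _ d)
        rw [hζ.label_sameCycle (Quotient.mk_out (s := Equiv.Perm.SameCycle.setoid Q.face) d)]
        exact this
      ext s
      have := label_rev ζ s.dart
      rw [h0, h0, toSeg_dart, zero_add] at this
      exact this.symm
    simpa using LinearMap.finrank_le_finrank_of_injective hinj
  simp only [Module.finrank_fintype_fun_eq_card] at h2
  omega

end PlaneDrawing

/-- The determinant of two plane vectors. -/
def det2 (u v : Pt) : ℝ := u.1 * v.2 - u.2 * v.1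

theorem mem_segment_iff_coord {p q z : Pt} : z ∈ segment ℝ p q ↔ ∃ α : ℝ, 0 ≤ α ∧ α ≤ 1 ∧
    z.1 = p.1 + α * (q.1 - p.1) ∧ z.2 = p.2 + α * (q.2 - p.2) := by
  rw [segment_eq_image']
  constructor
  · rintro ⟨α, ⟨h0, h1⟩, rfl⟩
    exact ⟨α, h0, h1, by simp, by simp⟩
  · rintro ⟨α, h0, h1, h2, h3⟩
    exact ⟨α, ⟨h0, h1⟩, Prod.ext (by simp [h2]) (by simp [h3])⟩

theorem mem_openSegment_iff_coord {p q z : Pt} : z ∈ openSegment ℝ p q ↔ ∃ α : ℝ, 0 < α ∧ α < 1 ∧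
    z.1 = p.1 + α * (q.1 - p.1) ∧ z.2 = p.2 + α * (q.2 - p.2) := by
  rw [openSegment_eq_image']
  constructor
  · rintro ⟨α, ⟨h0, h1⟩, rfl⟩
    exact ⟨α, h0, h1, by simp, by simp⟩
  · rintro ⟨α, h0, h1, h2, h3⟩
    exact ⟨α, ⟨h0, h1⟩, Prod.ext (by simp [h2]) (by simp [h3])⟩

theorem collinear_of_det2_eq_zero {p q r : Pt} (h : det2 (q - p) (r - p) = 0) :
    Collinear ℝ ({p, q, r} : Set Pt) := by
  rw [collinear_iff_of_mem (p₀ := p) (by simp)]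
  by_cases hpq : q = p
  · refine ⟨r - p, ?_⟩
    intro z hz
    simp only [Set.mem_insert_iff, Set.mem_singleton_iff] at hz
    rcases hz with rfl | rfl | rfl
    · exact ⟨0, by simp⟩
    · exact ⟨0, by simp [hpq]⟩
    · exact ⟨1, by simp⟩
  · refine ⟨q - p, ?_⟩
    intro z hz
    simp only [Set.mem_insert_iff, Set.mem_singleton_iff] at hz
    rcases hz with rfl | rfl | rfl
    · exact ⟨0, by simp⟩
    · exact ⟨1, by simp⟩
    · simp only [det2, Prod.fst_sub, Prod.snd_sub] at h
      by_cases h1 : q.1 = p.1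
      · have h2 : q.2 - p.2 ≠ 0 := fun e => hpq (Prod.ext h1 (by linarith))
        refine ⟨(z.2 - p.2) / (q.2 - p.2), Prod.ext ?_ ?_⟩
        · simp only [vadd_eq_add, Prod.fst_add, Prod.smul_fst, Prod.fst_sub, smul_eq_mul, h1,
            sub_self, mul_zero, zero_add]
          rw [h1, sub_self, zero_mul, zero_sub, neg_eq_zero] at h
          have := (mul_eq_zero.1 h).resolve_left h2
          linarith
        · simp only [vadd_eq_add, Prod.snd_add, Prod.smul_snd, Prod.snd_sub, smul_eq_mul]
          field_simp
          ring
      · have h2 : q.1 - p.1 ≠ 0 := sub_ne_zero.2 h1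
        refine ⟨(z.1 - p.1) / (q.1 - p.1), Prod.ext ?_ ?_⟩
        · simp only [vadd_eq_add, Prod.fst_add, Prod.smul_fst, Prod.fst_sub, smul_eq_mul]
          field_simp
          ring
        · simp only [vadd_eq_add, Prod.snd_add, Prod.smul_snd, Prod.snd_sub, smul_eq_mul]
          field_simp
          linarith

/-- Two directed edges of `G` cross properly. -/
def EdgeX (G : Finset (Sym2 Pt)) (ε δ : Pt × Pt) : Prop :=
  s(ε.1, ε.2) ∈ G ∧ s(δ.1, δ.2) ∈ G ∧ s(ε.1, ε.2) ≠ s(δ.1, δ.2) ∧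
    (openSegment ℝ ε.1 ε.2 ∩ openSegment ℝ δ.1 δ.2).Nonempty

theorem EdgesCross.mk {a b c d : Pt} (h : (openSegment ℝ a b ∩ openSegment ℝ c d).Nonempty) :
    EdgesCross s(a, b) s(c, d) := ⟨a, b, c, d, rfl, rfl, h⟩

theorem edgesCross_mk_iff {a b c d : Pt} : EdgesCross s(a, b) s(c, d) ↔
    (openSegment ℝ a b ∩ openSegment ℝ c d).Nonempty := by
  refine ⟨?_, EdgesCross.mk⟩
  rintro ⟨a', b', c', d', h1, h2, h⟩
  have e1 : openSegment ℝ a b = openSegment ℝ a' b' := by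
    rcases Sym2.eq_iff.1 h1 with ⟨rfl, rfl⟩ | ⟨rfl, rfl⟩
    · rfl
    · rw [openSegment_symm]
  have e2 : openSegment ℝ c d = openSegment ℝ c' d' := by
    rcases Sym2.eq_iff.1 h2 with ⟨rfl, rfl⟩ | ⟨rfl, rfl⟩
    · rfl
    · rw [openSegment_symm]
  rwa [e1, e2]

theorem EdgesCross.symm {e f : Sym2 Pt} (h : EdgesCross e f) : EdgesCross f e := by
  obtain ⟨a, b, c, d, h1, h2, h3⟩ := h
  exact ⟨c, d, a, b, h2, h1, by rwa [Set.inter_comm]⟩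

/-- A drawing on points in general position without three pairwise crossing edges. -/
structure Draw3 (S : Finset Pt) (G : Finset (Sym2 Pt)) : Prop where
  gp : ∀ p ∈ S, ∀ q ∈ S, ∀ r ∈ S, p ≠ q → p ≠ r → q ≠ r → det2 (q - p) (r - p) ≠ 0
  ne : ∀ ε : Pt × Pt, s(ε.1, ε.2) ∈ G → ε.1 ≠ ε.2
  mem₁ : ∀ ε : Pt × Pt, s(ε.1, ε.2) ∈ G → ε.1 ∈ S
  mem₂ : ∀ ε : Pt × Pt, s(ε.1, ε.2) ∈ G → ε.2 ∈ S
  no3 : ∀ x y z, EdgeX G x y → EdgeX G y z → EdgeX G x z → False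

theorem IsQuasiPlane.draw3 {S : Finset Pt} {G : Finset (Sym2 Pt)} (hS : GenPos S)
    (h : IsQuasiPlane 3 S G) : Draw3 S G where
  gp p hp q hq r hr h1 h2 h3 h0 := hS p hp q hq r hr h1 h2 h3 (collinear_of_det2_eq_zero h0)
  ne ε hε e := (h.1 _ hε).1 (by simpa using e)
  mem₁ ε hε := (h.1 _ hε).2 _ (by simp)
  mem₂ ε hε := (h.1 _ hε).2 _ (by simp)
  no3 x y z h1 h2 h3 := by
    refine h.2 ⟨{s(x.1, x.2), s(y.1, y.2), s(z.1, z.2)}, ?_, ?_, ?_⟩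
    · intro e he
      simp only [Finset.mem_insert, Finset.mem_singleton] at he
      rcases he with rfl | rfl | rfl
      exacts [h1.1, h1.2.1, h2.2.1]
    · exact Finset.card_eq_three.2 ⟨_, _, _, h1.2.2.1, h3.2.2.1, h2.2.2.1, rfl⟩
    · have c1 := EdgesCross.mk h1.2.2.2
      have c2 := EdgesCross.mk h2.2.2.2
      have c3 := EdgesCross.mk h3.2.2.2
      intro e he f hf hne
      simp only [Finset.mem_insert, Finset.mem_singleton] at he hf
      rcases he with rfl | rfl | rfl <;> rcases hf with rfl | rfl | rfl
      exacts [absurd rfl hne, c1, c3, c1.symm, absurd rfl hne, c2, c3.symm, c2.symm, absurd rfl hne]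

theorem swap_mem_edges {G : Finset (Sym2 Pt)} {ε : Pt × Pt} (hε : s(ε.1, ε.2) ∈ G) :
    s(ε.swap.1, ε.swap.2) ∈ G := by
  rw [Sym2.eq_swap]; exact hε

namespace Draw3

variable {S : Finset Pt} {G : Finset (Sym2 Pt)} {ε δ : Pt × Pt} {z w : Pt}

theorem endpoint_of_mem (H : Draw3 S G) (hε : s(ε.1, ε.2) ∈ G) (hz : z ∈ S)
    (h : z ∈ segment ℝ ε.1 ε.2) :
    z = ε.1 ∨ z = ε.2 := by
  by_contra! hne
  refine H.gp _ (H.mem₁ _ hε) _ (H.mem₂ _ hε) _ hz (H.ne _ hε) hne.1.symm hne.2.symm ?_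
  obtain ⟨α, -, -, h1, h2⟩ := mem_segment_iff_coord.1 h
  simp only [det2, Prod.fst_sub, Prod.snd_sub, h1, h2]
  ring

theorem mem_openSegment (H : Draw3 S G) (hε : s(ε.1, ε.2) ∈ G) (hz : z ∉ S)
    (h : z ∈ segment ℝ ε.1 ε.2) :
    z ∈ openSegment ℝ ε.1 ε.2 := by
  refine mem_openSegment_of_ne_left_right ?_ ?_ h
  · rintro rfl; exact hz (H.mem₁ _ hε)
  · rintro rfl; exact hz (H.mem₂ _ hε)

theorem det_ne_zero (H : Draw3 S G) (hε : s(ε.1, ε.2) ∈ G) (hδ : s(δ.1, δ.2) ∈ G)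
    (hne : s(ε.1, ε.2) ≠ s(δ.1, δ.2)) (h1 : z ∈ segment ℝ ε.1 ε.2) (h2 : z ∈ segment ℝ δ.1 δ.2) :
    det2 (ε.2 - ε.1) (δ.2 - δ.1) ≠ 0 := by
  intro h0
  obtain ⟨α, -, -, a1, a2⟩ := mem_segment_iff_coord.1 h1
  obtain ⟨β, -, -, b1, b2⟩ := mem_segment_iff_coord.1 h2
  simp only [det2, Prod.fst_sub, Prod.snd_sub] at h0
  have d1 : det2 (ε.2 - ε.1) (δ.1 - ε.1) = 0 := by
    simp only [det2, Prod.fst_sub, Prod.snd_sub]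
    linear_combination (ε.2.1 - ε.1.1) * (a2 - b2) - (ε.2.2 - ε.1.2) * (a1 - b1) - β * h0
  have d2 : det2 (ε.2 - ε.1) (δ.2 - ε.1) = 0 := by
    simp only [det2, Prod.fst_sub, Prod.snd_sub] at d1 ⊢
    linear_combination d1 + h0
  have e1 : δ.1 = ε.1 ∨ δ.1 = ε.2 := by
    by_contra! h
    exact H.gp _ (H.mem₁ _ hε) _ (H.mem₂ _ hε) _ (H.mem₁ _ hδ) (H.ne _ hε) h.1.symm h.2.symm d1
  have e2 : δ.2 = ε.1 ∨ δ.2 = ε.2 := by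
    by_contra! h
    exact H.gp _ (H.mem₁ _ hε) _ (H.mem₂ _ hε) _ (H.mem₂ _ hδ) (H.ne _ hε) h.1.symm h.2.symm d2
  have e3 := H.ne _ hδ
  rcases e1 with e1 | e1 <;> rcases e2 with e2 | e2
  · exact e3 (e1.trans e2.symm)
  · exact hne (by rw [e1, e2])
  · exact hne (by rw [e1, e2, Sym2.eq_swap])
  · exact e3 (e1.trans e2.symm)

theorem eq_of_mem_of_mem (H : Draw3 S G) (hε : s(ε.1, ε.2) ∈ G) (hδ : s(δ.1, δ.2) ∈ G)
    (hne : s(ε.1, ε.2) ≠ s(δ.1, δ.2)) (h1 : z ∈ segment ℝ ε.1 ε.2) (h2 : z ∈ segment ℝ δ.1 δ.2)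
    (h3 : w ∈ segment ℝ ε.1 ε.2) (h4 : w ∈ segment ℝ δ.1 δ.2) : z = w := by
  have hd := H.det_ne_zero hε hδ hne h1 h2
  obtain ⟨α, -, -, a1, a2⟩ := mem_segment_iff_coord.1 h1
  obtain ⟨β, -, -, b1, b2⟩ := mem_segment_iff_coord.1 h2
  obtain ⟨γ, -, -, c1, c2⟩ := mem_segment_iff_coord.1 h3
  obtain ⟨η, -, -, d1, d2⟩ := mem_segment_iff_coord.1 h4
  have : (α - γ) * det2 (ε.2 - ε.1) (δ.2 - δ.1) = 0 := by
    simp only [det2, Prod.fst_sub, Prod.snd_sub]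
    linear_combination -(δ.2.2 - δ.1.2) * ((a1 - c1) - (b1 - d1)) +
      (δ.2.1 - δ.1.1) * ((a2 - c2) - (b2 - d2))
  have hαγ : α = γ := sub_eq_zero.1 ((mul_eq_zero.1 this).resolve_right hd)
  subst hαγ
  exact Prod.ext (a1.trans c1.symm) (a2.trans c2.symm)

end Draw3

/-- The vertices of the planarisation: the points of `S` and the crossing points. -/
def IsVert (S : Finset Pt) (G : Finset (Sym2 Pt)) (z : Pt) : Prop :=
  z ∈ S ∨ ∃ ε δ, EdgeX G ε δ ∧ z ∈ openSegment ℝ ε.1 ε.2 ∧ z ∈ openSegment ℝ δ.1 δ.2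

theorem Draw3.finite_isVert {S : Finset Pt} {G : Finset (Sym2 Pt)} (H : Draw3 S G) :
    {z | IsVert S G z}.Finite := by
  have : {z | IsVert S G z} ⊆ (S : Set Pt) ∪
      ⋃ ε ∈ ((S ×ˢ S : Finset (Pt × Pt)) : Set (Pt × Pt)),
      ⋃ δ ∈ ((S ×ˢ S : Finset (Pt × Pt)) : Set (Pt × Pt)),
        {z | EdgeX G ε δ ∧ z ∈ openSegment ℝ ε.1 ε.2 ∧ z ∈ openSegment ℝ δ.1 δ.2} := by
    rintro z (hz | ⟨ε, δ, h⟩)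
    · exact Or.inl hz
    · refine Or.inr ?_
      simp only [Set.mem_iUnion]
      exact ⟨ε, by simp [H.mem₁ _ h.1.1, H.mem₂ _ h.1.1], δ,
        by simp [H.mem₁ _ h.1.2.1, H.mem₂ _ h.1.2.1], h⟩
  refine Set.Finite.subset (S.finite_toSet.union ?_) this
  refine Set.Finite.biUnion (Finset.finite_toSet _) fun ε _ =>
    Set.Finite.biUnion (Finset.finite_toSet _) fun δ _ => Set.Subsingleton.finite ?_
  rintro z ⟨h, h1, h2⟩ w ⟨-, h3, h4⟩
  exact H.eq_of_mem_of_mem h.1 h.2.1 h.2.2.1 (openSegment_subset_segment _ _ _ h1)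
    (openSegment_subset_segment _ _ _ h2) (openSegment_subset_segment _ _ _ h3)
    (openSegment_subset_segment _ _ _ h4)

/-- The affine parameter of the projection of `z` to the line through `ε`. -/
def par (ε : Pt × Pt) (z : Pt) : ℝ :=
  ((z.1 - ε.1.1) * (ε.2.1 - ε.1.1) + (z.2 - ε.1.2) * (ε.2.2 - ε.1.2)) /
    ((ε.2.1 - ε.1.1) ^ 2 + (ε.2.2 - ε.1.2) ^ 2)

section Par

variable {ε : Pt × Pt} {u z w : Pt}

theorem normSq_pos (hε : ε.1 ≠ ε.2) : 0 < (ε.2.1 - ε.1.1) ^ 2 + (ε.2.2 - ε.1.2) ^ 2 := by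
  by_contra! h
  have h1 : (ε.2.1 - ε.1.1) ^ 2 = 0 := by
    nlinarith [sq_nonneg (ε.2.1 - ε.1.1), sq_nonneg (ε.2.2 - ε.1.2)]
  have h2 : (ε.2.2 - ε.1.2) ^ 2 = 0 := by
    nlinarith [sq_nonneg (ε.2.1 - ε.1.1), sq_nonneg (ε.2.2 - ε.1.2)]
  rw [sq_eq_zero_iff, sub_eq_zero] at h1 h2
  exact hε (Prod.ext h1.symm h2.symm)

theorem par_eq (hε : ε.1 ≠ ε.2) {α : ℝ} (h1 : z.1 = ε.1.1 + α * (ε.2.1 - ε.1.1))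
    (h2 : z.2 = ε.1.2 + α * (ε.2.2 - ε.1.2)) : par ε z = α := by
  rw [par, div_eq_iff (normSq_pos hε).ne', h1, h2]
  ring

theorem par_snd (hε : ε.1 ≠ ε.2) : par ε ε.2 = 1 := par_eq hε (by ring) (by ring)

theorem par_swap (hε : ε.1 ≠ ε.2) (z : Pt) : par ε.swap z = 1 - par ε z := by
  have h := normSq_pos hε
  have h' := normSq_pos (ε := ε.swap) hε.symm
  rw [par, par, eq_sub_iff_add_eq, div_add_div _ _ h'.ne' h.ne', div_eq_one_iff_eq (by positivity)]
  simp only [Prod.fst_swap, Prod.snd_swap]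
  ring

theorem par_of_mem (hε : ε.1 ≠ ε.2) (hz : z ∈ segment ℝ ε.1 ε.2) :
    0 ≤ par ε z ∧ par ε z ≤ 1 ∧ z.1 = ε.1.1 + par ε z * (ε.2.1 - ε.1.1) ∧
      z.2 = ε.1.2 + par ε z * (ε.2.2 - ε.1.2) := by
  obtain ⟨α, h0, h1, h2, h3⟩ := mem_segment_iff_coord.1 hz
  rw [par_eq hε h2 h3]
  exact ⟨h0, h1, h2, h3⟩

theorem par_inj (hε : ε.1 ≠ ε.2) (hz : z ∈ segment ℝ ε.1 ε.2) (hw : w ∈ segment ℝ ε.1 ε.2)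
    (h : par ε z = par ε w) : z = w := by
  obtain ⟨-, -, h1, h2⟩ := par_of_mem hε hz
  obtain ⟨-, -, h3, h4⟩ := par_of_mem hε hw
  exact Prod.ext (by rw [h1, h3, h]) (by rw [h2, h4, h])

theorem mem_of_mem_openSegment (hz : z ∈ segment ℝ ε.1 ε.2) (hw : w ∈ segment ℝ ε.1 ε.2)
    (hu : u ∈ openSegment ℝ z w) : u ∈ segment ℝ ε.1 ε.2 :=
  (convex_segment ε.1 ε.2).openSegment_subset hz hw hu

theorem par_between (hε : ε.1 ≠ ε.2) (hz : z ∈ segment ℝ ε.1 ε.2) (hw : w ∈ segment ℝ ε.1 ε.2)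
    (hzw : par ε z < par ε w) (hu : u ∈ openSegment ℝ z w) :
    par ε z < par ε u ∧ par ε u < par ε w := by
  obtain ⟨-, -, h1, h2⟩ := par_of_mem hε hz
  obtain ⟨-, -, h3, h4⟩ := par_of_mem hε hw
  obtain ⟨α, h5, h6, h7, h8⟩ := mem_openSegment_iff_coord.1 hu
  have : par ε u = par ε z + α * (par ε w - par ε z) := by
    apply par_eq hε
    · rw [h7]; linear_combination (1 - α) * h1 + α * h3
    · rw [h8]; linear_combination (1 - α) * h2 + α * h4
  rw [this]
  constructor <;> nlinarith

theorem mem_openSegment_of_par (hε : ε.1 ≠ ε.2) (hz : z ∈ segment ℝ ε.1 ε.2)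
    (hw : w ∈ segment ℝ ε.1 ε.2) (hu : u ∈ segment ℝ ε.1 ε.2) (h1 : par ε z < par ε u)
    (h2 : par ε u < par ε w) : u ∈ openSegment ℝ z w := by
  obtain ⟨-, -, a1, a2⟩ := par_of_mem hε hz
  obtain ⟨-, -, b1, b2⟩ := par_of_mem hε hw
  obtain ⟨-, -, c1, c2⟩ := par_of_mem hε hu
  have h : 0 < par ε w - par ε z := by linarith
  have e : (par ε u - par ε z) / (par ε w - par ε z) * (par ε w - par ε z) =
    par ε u - par ε z := div_mul_cancel₀ _ h.ne'
  refine mem_openSegment_iff_coord.2 ⟨(par ε u - par ε z) / (par ε w - par ε z), ?_, ?_, ?_, ?_⟩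
  · apply div_pos <;> linarith
  · rw [div_lt_one h]; linarith
  · rw [c1]; nth_rw 2 [a1]; rw [b1, a1]
    linear_combination -(ε.2.1 - ε.1.1) * e
  · rw [c2]; nth_rw 2 [a2]; rw [b2, a2]
    linear_combination -(ε.2.2 - ε.1.2) * e

end Par

/-- The directed edge `ε` passes first through `z` and then through `w`. -/
def Carries (G : Finset (Sym2 Pt)) (ε : Pt × Pt) (z w : Pt) : Prop :=
  s(ε.1, ε.2) ∈ G ∧ z ∈ segment ℝ ε.1 ε.2 ∧ w ∈ segment ℝ ε.1 ε.2 ∧ par ε z < par ε w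

/-- The points `z` and `w` are consecutive vertices of the planarisation on some edge. -/
def IsDart (S : Finset Pt) (G : Finset (Sym2 Pt)) (z w : Pt) : Prop :=
  (∃ ε, Carries G ε z w) ∧ ∀ u, IsVert S G u → u ∉ openSegment ℝ z w

namespace Draw3

variable {S : Finset Pt} {G : Finset (Sym2 Pt)} {ε δ : Pt × Pt} {u z w : Pt}

theorem carries_swap (H : Draw3 S G) (h : Carries G ε z w) : Carries G ε.swap w z := by
  obtain ⟨h1, h2, h3, h4⟩ := h
  refine ⟨swap_mem_edges h1, ?_, ?_, ?_⟩
  · rw [segment_symm]; exact h3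
  · rw [segment_symm]; exact h2
  · rw [par_swap (H.ne _ h1), par_swap (H.ne _ h1)]; linarith

theorem carries_unique (H : Draw3 S G) (h : Carries G ε z w) (h' : Carries G δ z w) : ε = δ := by
  obtain ⟨h1, h2, h3, h4⟩ := h
  obtain ⟨h1', h2', h3', h4'⟩ := h'
  by_cases hs : s(ε.1, ε.2) = s(δ.1, δ.2)
  · rw [Sym2.mk_eq_mk_iff] at hs
    rcases hs with hs | hs
    · exact hs
    · rw [hs] at h4
      change par δ.swap z < par δ.swap w at h4
      rw [par_swap (H.ne _ h1'), par_swap (H.ne _ h1')] at h4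
      linarith
  · rw [H.eq_of_mem_of_mem h1 h1' hs h2 h2' h3 h3'] at h4
    exact absurd h4 (lt_irrefl _)

theorem isDart_symm (H : Draw3 S G) (h : IsDart S G z w) : IsDart S G w z := by
  obtain ⟨⟨ε, hε⟩, h2⟩ := h
  exact ⟨⟨_, H.carries_swap hε⟩, fun u hu => by rw [openSegment_symm]; exact h2 u hu⟩

theorem carries_coord (H : Draw3 S G) (h : Carries G ε z w) :
    w.1 - z.1 = (par ε w - par ε z) * (ε.2.1 - ε.1.1) ∧
      w.2 - z.2 = (par ε w - par ε z) * (ε.2.2 - ε.1.2) := by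
  obtain ⟨h1, h2, h3, h4⟩ := h
  obtain ⟨-, -, a1, a2⟩ := par_of_mem (H.ne _ h1) h2
  obtain ⟨-, -, b1, b2⟩ := par_of_mem (H.ne _ h1) h3
  constructor
  · linear_combination b1 - a1
  · linear_combination b2 - a2

theorem exists_isDart (H : Draw3 S G) (hε : s(ε.1, ε.2) ∈ G) (hz : z ∈ segment ℝ ε.1 ε.2)
    (hne : z ≠ ε.2) : ∃ w, IsVert S G w ∧ IsDart S G z w ∧ Carries G ε z w := by
  have hε' := H.ne _ hε
  have hfin : {w | IsVert S G w ∧ w ∈ segment ℝ ε.1 ε.2 ∧ par ε z < par ε w}.Finite :=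
    H.finite_isVert.subset fun w hw => hw.1
  have hz1 : par ε z < par ε ε.2 := by
    refine lt_of_le_of_ne ?_ fun e => hne (par_inj hε' hz (right_mem_segment _ _ _) e)
    rw [par_snd hε']
    exact (par_of_mem hε' hz).2.1
  obtain ⟨w, ⟨h1, h2, h3⟩, hmin⟩ := Set.exists_min_image _ (par ε) hfin
    ⟨ε.2, Or.inl (H.mem₂ _ hε), right_mem_segment _ _ _, hz1⟩
  refine ⟨w, h1, ⟨⟨ε, hε, hz, h2, h3⟩, fun u hu hu' => ?_⟩, hε, hz, h2, h3⟩
  obtain ⟨h4, h5⟩ := par_between hε' hz h2 h3 hu'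
  exact absurd (hmin u ⟨hu, mem_of_mem_openSegment hz h2 hu', h4⟩) (not_le.2 h5)

end Draw3

/-- The point at abscissa `τ` on a non-vertical segment, in sheared coordinates. -/
theorem mem_openSegment_shear {t τ : ℝ} {a b : Pt} (h1 : a.1 + t * a.2 < τ)
    (h2 : τ < b.1 + t * b.2) {u : Pt} (hu : u.1 + t * u.2 = τ)
    (hy : a.2 + (b.2 - a.2) / ((b.1 + t * b.2) - (a.1 + t * a.2)) * (τ - (a.1 + t * a.2)) = u.2) :
    u ∈ openSegment ℝ a b := by
  have h : 0 < (b.1 + t * b.2) - (a.1 + t * a.2) := by linarith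
  obtain ⟨θ, hθ⟩ : ∃ θ, θ = (τ - (a.1 + t * a.2)) / ((b.1 + t * b.2) - (a.1 + t * a.2)) := ⟨_, rfl⟩
  have e : θ * ((b.1 + t * b.2) - (a.1 + t * a.2)) = τ - (a.1 + t * a.2) := by
    rw [hθ]; exact div_mul_cancel₀ _ h.ne'
  have e2 : u.2 = a.2 + θ * (b.2 - a.2) := by
    rw [← hy, hθ]; ring
  refine mem_openSegment_iff_coord.2 ⟨θ, ?_, ?_, ?_, e2⟩
  · rw [hθ]; apply div_pos <;> linarith
  · rw [hθ, div_lt_one h]; linarith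
  · linear_combination hu - e - t * e2

/-- A shear giving distinct abscissae to finitely many points. -/
theorem exists_shear {A : Set Pt} (hA : A.Finite) :
    ∃ t : ℝ, ∀ z ∈ A, ∀ w ∈ A, z.1 + t * z.2 = w.1 + t * w.2 → z = w := by
  have hfin : ((fun p : Pt × Pt => -(p.1.1 - p.2.1) / (p.1.2 - p.2.2)) '' (A ×ˢ A)).Finite :=
    (hA.prod hA).image _
  obtain ⟨t, ht⟩ := hfin.exists_notMem
  refine ⟨t, fun z hz w hw h => ?_⟩
  by_cases h2 : z.2 = w.2
  · exact Prod.ext (by rw [h2] at h; linarith) h2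
  · refine absurd ?_ ht
    refine ⟨(z, w), ⟨hz, hw⟩, ?_⟩
    have : z.2 - w.2 ≠ 0 := sub_ne_zero.2 h2
    simp only
    rw [div_eq_iff this]
    linarith

/-- The planarisation of a drawing, in sheared coordinates. -/
def planarization {S : Finset Pt} {G : Finset (Sym2 Pt)} (H : Draw3 S G) (t : ℝ)
    (ht : ∀ z, IsVert S G z → ∀ w, IsVert S G w → z.1 + t * z.2 = w.1 + t * w.2 → z = w) :
    PlaneDrawing {z // IsVert S G z} where
  x z := z.1.1 + t * z.1.2
  y z := z.1.2
  R z w := IsDart S G z.1 w.1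
  x_inj z w h := Subtype.ext (ht _ z.2 _ w.2 h)
  symm z w h := H.isDart_symm h
  irrefl z h := by
    obtain ⟨⟨ε, hε⟩, -⟩ := h
    exact absurd hε.2.2.2 (lt_irrefl _)
  noncross a b c d τ hab hcd hne h1 h2 h3 h4 heq := by
    obtain ⟨⟨ε, hε⟩, hab⟩ := hab
    obtain ⟨⟨δ, hδ⟩, hcd⟩ := hcd
    obtain ⟨u, hu1, hu2⟩ : ∃ u : Pt, u.1 + t * u.2 = τ ∧ a.1.2 + (b.1.2 - a.1.2) /
        ((b.1.1 + t * b.1.2) - (a.1.1 + t * a.1.2)) * (τ - (a.1.1 + t * a.1.2)) = u.2 :=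
      ⟨(τ - t * _, _), sub_add_cancel _ _, rfl⟩
    have hu3 := mem_openSegment_shear h1 h2 hu1 hu2
    have hu4 := mem_openSegment_shear h3 h4 hu1 (heq.symm.trans hu2)
    have hv : ¬ IsVert S G u := fun hv => hab u hv hu3
    have huS : u ∉ S := fun h => hv (Or.inl h)
    have hue := mem_of_mem_openSegment hε.2.1 hε.2.2.1 hu3
    have hud := mem_of_mem_openSegment hδ.2.1 hδ.2.2.1 hu4
    have hue' := H.mem_openSegment hε.1 huS hue
    have hud' := H.mem_openSegment hδ.1 huS hud
    by_cases hs : s(ε.1, ε.2) = s(δ.1, δ.2)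
    swap
    · exact hv (Or.inr ⟨ε, δ, ⟨hε.1, hδ.1, hs, ⟨u, hue', hud'⟩⟩, hue', hud'⟩)
    have hεδ : ε = δ := by
      rw [Sym2.mk_eq_mk_iff] at hs
      rcases hs with hs | hs
      · exact hs
      · exfalso
        obtain ⟨e1, e2⟩ := H.carries_coord hε
        obtain ⟨e3, e4⟩ := H.carries_coord hδ
        have f1 : 0 < (par ε b - par ε a) * ((ε.2.1 - ε.1.1) + t * (ε.2.2 - ε.1.2)) := by
          have : (par ε b - par ε a) * ((ε.2.1 - ε.1.1) + t * (ε.2.2 - ε.1.2)) =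
            (b.1.1 + t * b.1.2) - (a.1.1 + t * a.1.2) := by linear_combination -e1 - t * e2
          rw [this]; linarith
        have f2 : 0 < (par δ d - par δ c) * ((δ.2.1 - δ.1.1) + t * (δ.2.2 - δ.1.2)) := by
          have : (par δ d - par δ c) * ((δ.2.1 - δ.1.1) + t * (δ.2.2 - δ.1.2)) =
            (d.1.1 + t * d.1.2) - (c.1.1 + t * c.1.2) := by linear_combination -e3 - t * e4
          rw [this]; linarith
        have g1 := (pos_iff_pos_of_mul_pos f1).1 (sub_pos.2 hε.2.2.2)
        have g2 := (pos_iff_pos_of_mul_pos f2).1 (sub_pos.2 hδ.2.2.2)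
        have hs1 : ε.1 = δ.2 := congrArg Prod.fst hs
        have hs2 : ε.2 = δ.1 := congrArg Prod.snd hs
        rw [hs1, hs2] at g1
        linarith
    subst hεδ
    have hne' := H.ne _ hε.1
    obtain ⟨p1, p2⟩ := par_between hne' hε.2.1 hε.2.2.1 hε.2.2.2 hu3
    obtain ⟨p3, p4⟩ := par_between hne' hδ.2.1 hδ.2.2.1 hδ.2.2.2 hu4
    apply hne
    have hac : a.1 = c.1 := by
      refine par_inj hne' hε.2.1 hδ.2.1 (le_antisymm ?_ ?_)
      · by_contra! h
        exact hcd a a.2 (mem_openSegment_of_par hne' hδ.2.1 hδ.2.2.1 hε.2.1 h (p1.trans p4))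
      · by_contra! h
        exact hab c c.2 (mem_openSegment_of_par hne' hε.2.1 hε.2.2.1 hδ.2.1 h (p3.trans p2))
    have hbd : b.1 = d.1 := by
      refine par_inj hne' hε.2.2.1 hδ.2.2.1 (le_antisymm ?_ ?_)
      · by_contra! h
        exact hab d d.2 (mem_openSegment_of_par hne' hε.2.1 hε.2.2.1 hδ.2.2.1 (p1.trans p4) h)
      · by_contra! h
        exact hcd b b.2 (mem_openSegment_of_par hne' hδ.2.1 hδ.2.2.1 hε.2.2.1 (p3.trans p2) h)
    exact Prod.ext (Subtype.ext hac) (Subtype.ext hbd)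
  avoid a b u hab h1 h2 h3 := hab.2 u u.2 (mem_openSegment_shear h1 h2 rfl h3)

section EdgeX

variable {G : Finset (Sym2 Pt)} {ε δ : Pt × Pt}

theorem EdgeX.symm (h : EdgeX G ε δ) : EdgeX G δ ε :=
  ⟨h.2.1, h.1, h.2.2.1.symm, by rw [Set.inter_comm]; exact h.2.2.2⟩

theorem EdgeX.swap_right (h : EdgeX G ε δ) : EdgeX G ε δ.swap :=
  ⟨h.1, swap_mem_edges h.2.1, by rw [Sym2.eq_swap (a := δ.swap.1)]; exact h.2.2.1,
    by rw [openSegment_symm ℝ δ.swap.1]; exact h.2.2.2⟩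

theorem EdgeX.swap_left (h : EdgeX G ε δ) : EdgeX G ε.swap δ := h.symm.swap_right.symm

theorem mem_openSegment_swap {z : Pt} (h : z ∈ openSegment ℝ ε.1 ε.2) :
    z ∈ openSegment ℝ ε.swap.1 ε.swap.2 := by
  rw [openSegment_symm]; exact h

end EdgeX

theorem det2_swap_left (ε δ : Pt × Pt) :
    det2 (ε.swap.2 - ε.swap.1) (δ.2 - δ.1) = - det2 (ε.2 - ε.1) (δ.2 - δ.1) := by
  simp only [det2, Prod.fst_sub, Prod.snd_sub, Prod.fst_swap, Prod.snd_swap]; ring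

theorem det2_swap_right (ε δ : Pt × Pt) :
    det2 (ε.2 - ε.1) (δ.swap.2 - δ.swap.1) = - det2 (ε.2 - ε.1) (δ.2 - δ.1) := by
  simp only [det2, Prod.fst_sub, Prod.snd_sub, Prod.fst_swap, Prod.snd_swap]; ring

theorem det2_comm (u v : Pt) : det2 u v = - det2 v u := by
  simp only [det2]; ring

/-- The key of a directed edge in the counterclockwise order of directions. -/
def edgeKey (t : ℝ) (ε : Pt × Pt) : Bool ×ₗ ℝ :=
  toLex (decide (ε.1.1 + t * ε.1.2 < ε.2.1 + t * ε.2.2),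
    (ε.2.2 - ε.1.2) / ((ε.2.1 + t * ε.2.2) - (ε.1.1 + t * ε.1.2)))

section DartEdge

open PlaneDrawing

variable {S : Finset Pt} {G : Finset (Sym2 Pt)} {H : Draw3 S G} {t : ℝ}
  {ht : ∀ z, IsVert S G z → ∀ w, IsVert S G w → z.1 + t * z.2 = w.1 + t * w.2 → z = w}

/-- The directed edge carrying a dart. -/
def dartEdge (d : (planarization H t ht).Dart) : Pt × Pt := d.2.1.choose

theorem dartEdge_carries (d : (planarization H t ht).Dart) :
    Carries G (dartEdge d) d.1.1 d.1.2 := d.2.1.choose_spec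

theorem dartEdge_eq {d : (planarization H t ht).Dart} {ε : Pt × Pt}
    (h : Carries G ε d.1.1 d.1.2) : dartEdge d = ε :=
  H.carries_unique (dartEdge_carries d) h

theorem dartEdge_mem (d : (planarization H t ht).Dart) : s((dartEdge d).1, (dartEdge d).2) ∈ G :=
  (dartEdge_carries d).1

theorem dartEdge_rev (d : (planarization H t ht).Dart) :
    dartEdge ((planarization H t ht).rev d) = (dartEdge d).swap :=
  dartEdge_eq (H.carries_swap (dartEdge_carries d))

theorem key_eq_edgeKey (d : (planarization H t ht).Dart) :
    (planarization H t ht).key d = edgeKey t (dartEdge d) := by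
  have hc := dartEdge_carries d
  obtain ⟨h1, h2⟩ := H.carries_coord hc
  have hpos := sub_pos.2 hc.2.2.2
  set ε := dartEdge d
  have h3 : (d.1.2.1.1 + t * d.1.2.1.2) - (d.1.1.1.1 + t * d.1.1.1.2) =
      (par ε d.1.2 - par ε d.1.1) * ((ε.2.1 + t * ε.2.2) - (ε.1.1 + t * ε.1.2)) := by
    linear_combination h1 + t * h2
  have h4 : (d.1.1.1.1 + t * d.1.1.1.2 < d.1.2.1.1 + t * d.1.2.1.2) ↔
      (ε.1.1 + t * ε.1.2 < ε.2.1 + t * ε.2.2) := by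
    rw [← sub_pos, h3, mul_pos_iff_of_pos_left hpos, sub_pos]
  change toLex (decide (d.1.1.1.1 + t * d.1.1.1.2 < d.1.2.1.1 + t * d.1.2.1.2),
    (d.1.2.1.2 - d.1.1.1.2) / ((d.1.2.1.1 + t * d.1.2.1.2) - (d.1.1.1.1 + t * d.1.1.1.2))) =
      edgeKey t ε
  rw [h3, h2, mul_div_mul_left _ _ hpos.ne', edgeKey]
  congr 2
  exact decide_eq_decide.2 h4

theorem dart_ext {d d' : (planarization H t ht).Dart} (h : d.1.1 = d'.1.1)
    (he : dartEdge d = dartEdge d') : d = d' :=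
  key_inj d d' h (by rw [key_eq_edgeKey, key_eq_edgeKey, he])

theorem dartEdge_fst {d : (planarization H t ht).Dart} (h : d.1.1.1 ∈ S) :
    (dartEdge d).1 = d.1.1.1 := by
  have hc := dartEdge_carries d
  rcases H.endpoint_of_mem hc.1 h hc.2.1 with h1 | h1
  · exact h1.symm
  · exfalso
    have h2 := hc.2.2.2
    rw [h1, par_snd (H.ne _ hc.1)] at h2
    exact absurd (par_of_mem (H.ne _ hc.1) hc.2.2.1).2.1 (not_le.2 h2)

theorem exists_dart {ε : Pt × Pt} (hε : s(ε.1, ε.2) ∈ G) {z : {z // IsVert S G z}}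
    (hz : z.1 ∈ segment ℝ ε.1 ε.2) (hne : z.1 ≠ ε.2) :
    ∃ d : (planarization H t ht).Dart, d.1.1 = z ∧ dartEdge d = ε := by
  obtain ⟨w, h1, h2, h3⟩ := H.exists_isDart hε hz hne
  exact ⟨⟨(z, ⟨w, h1⟩), h2⟩, rfl, dartEdge_eq h3⟩

theorem exists_dart_of_open {ε : Pt × Pt} (hε : s(ε.1, ε.2) ∈ G) {z : {z // IsVert S G z}}
    (hzS : z.1 ∉ S) (hz : z.1 ∈ openSegment ℝ ε.1 ε.2) :
    ∃ d : (planarization H t ht).Dart, d.1.1 = z ∧ dartEdge d = ε :=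
  exists_dart hε (openSegment_subset_segment _ _ _ hz) fun h => hzS (h ▸ H.mem₂ _ hε)

/-- At a crossing there are two edges; we direct them to the right and sort them by slope. -/
theorem exists_crossing_pair (H : Draw3 S G)
    (ht : ∀ z, IsVert S G z → ∀ w, IsVert S G w → z.1 + t * z.2 = w.1 + t * w.2 → z = w)
    {z : Pt} (hz : IsVert S G z) (hzS : z ∉ S) :
    ∃ ε δ, EdgeX G ε δ ∧ z ∈ openSegment ℝ ε.1 ε.2 ∧ z ∈ openSegment ℝ δ.1 δ.2 ∧
      ε.1.1 + t * ε.1.2 < ε.2.1 + t * ε.2.2 ∧ δ.1.1 + t * δ.1.2 < δ.2.1 + t * δ.2.2 ∧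
      0 < det2 (ε.2 - ε.1) (δ.2 - δ.1) := by
  have orient (ε : Pt × Pt) (hε : s(ε.1, ε.2) ∈ G) : ε.1.1 + t * ε.1.2 < ε.2.1 + t * ε.2.2 ∨
      ε.swap.1.1 + t * ε.swap.1.2 < ε.swap.2.1 + t * ε.swap.2.2 :=
    lt_or_gt_of_ne fun h => H.ne _ hε (ht _ (Or.inl (H.mem₁ _ hε)) _ (Or.inl (H.mem₂ _ hε)) h)
  obtain ⟨ε₀, δ₀, hX, h1, h2⟩ := hz.resolve_left hzS
  obtain ⟨ε, hX, h1, h3⟩ : ∃ ε, EdgeX G ε δ₀ ∧ z ∈ openSegment ℝ ε.1 ε.2 ∧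
      ε.1.1 + t * ε.1.2 < ε.2.1 + t * ε.2.2 := by
    rcases orient ε₀ hX.1 with h | h
    · exact ⟨ε₀, hX, h1, h⟩
    · exact ⟨ε₀.swap, hX.swap_left, mem_openSegment_swap h1, h⟩
  obtain ⟨δ, hX, h2, h4⟩ : ∃ δ, EdgeX G ε δ ∧ z ∈ openSegment ℝ δ.1 δ.2 ∧
      δ.1.1 + t * δ.1.2 < δ.2.1 + t * δ.2.2 := by
    rcases orient δ₀ hX.2.1 with h | h
    · exact ⟨δ₀, hX, h2, h⟩
    · exact ⟨δ₀.swap, hX.swap_right, mem_openSegment_swap h2, h⟩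
  rcases lt_or_gt_of_ne (H.det_ne_zero hX.1 hX.2.1 hX.2.2.1 (openSegment_subset_segment _ _ _ h1)
    (openSegment_subset_segment _ _ _ h2)) with h | h
  · exact ⟨δ, ε, hX.symm, h2, h1, h4, h3, by rw [det2_comm]; linarith⟩
  · exact ⟨ε, δ, hX, h1, h2, h3, h4, h⟩

theorem edge_of_mem_crossing (H : Draw3 S G) {ε δ η : Pt × Pt} {z : Pt} (hX : EdgeX G ε δ)
    (h1 : z ∈ openSegment ℝ ε.1 ε.2) (h2 : z ∈ openSegment ℝ δ.1 δ.2) (hη : s(η.1, η.2) ∈ G)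
    (h3 : z ∈ openSegment ℝ η.1 η.2) : η = ε ∨ η = δ ∨ η = ε.swap ∨ η = δ.swap := by
  by_cases e1 : s(η.1, η.2) = s(ε.1, ε.2)
  · rw [Sym2.mk_eq_mk_iff] at e1
    rcases e1 with h | h
    · exact Or.inl h
    · exact Or.inr (Or.inr (Or.inl h))
  by_cases e2 : s(η.1, η.2) = s(δ.1, δ.2)
  · rw [Sym2.mk_eq_mk_iff] at e2
    rcases e2 with h | h
    · exact Or.inr (Or.inl h)
    · exact Or.inr (Or.inr (Or.inr h))
  exact (H.no3 η ε δ ⟨hη, hX.1, e1, ⟨z, h3, h1⟩⟩ hX ⟨hη, hX.2.1, e2, ⟨z, h3, h2⟩⟩).elim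

theorem edgeKey_of_lt {ε : Pt × Pt} (h : ε.1.1 + t * ε.1.2 < ε.2.1 + t * ε.2.2) :
    edgeKey t ε = toLex (true, (ε.2.2 - ε.1.2) / ((ε.2.1 + t * ε.2.2) - (ε.1.1 + t * ε.1.2))) := by
  rw [edgeKey, decide_eq_true h]

theorem edgeKey_swap_of_lt {ε : Pt × Pt} (h : ε.1.1 + t * ε.1.2 < ε.2.1 + t * ε.2.2) :
    edgeKey t ε.swap =
      toLex (false, (ε.2.2 - ε.1.2) / ((ε.2.1 + t * ε.2.2) - (ε.1.1 + t * ε.1.2))) := by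
  rw [edgeKey, Prod.fst_swap, Prod.snd_swap, decide_eq_false (not_lt.2 h.le), ← neg_sub,
    ← neg_sub (ε.2.1 + t * ε.2.2), neg_div_neg_eq]

theorem slope_lt_slope {ε δ : Pt × Pt} (h1 : ε.1.1 + t * ε.1.2 < ε.2.1 + t * ε.2.2)
    (h2 : δ.1.1 + t * δ.1.2 < δ.2.1 + t * δ.2.2) (h : 0 < det2 (ε.2 - ε.1) (δ.2 - δ.1)) :
    (ε.2.2 - ε.1.2) / ((ε.2.1 + t * ε.2.2) - (ε.1.1 + t * ε.1.2)) <
      (δ.2.2 - δ.1.2) / ((δ.2.1 + t * δ.2.2) - (δ.1.1 + t * δ.1.2)) := by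
  rw [div_lt_div_iff₀ (sub_pos.2 h1) (sub_pos.2 h2)]
  simp only [det2, Prod.fst_sub, Prod.snd_sub] at h
  linarith

variable [Fintype {z // IsVert S G z}]

/-- The darts around a crossing. -/
theorem crossing_darts {z : {z // IsVert S G z}} (hzS : z.1 ∉ S) :
    ∃ ε δ, ∃ r₁ r₂ l₁ l₂ : (planarization H t ht).Dart, EdgeX G ε δ ∧
      0 < det2 (ε.2 - ε.1) (δ.2 - δ.1) ∧
      (dartEdge r₁ = ε ∧ dartEdge r₂ = δ ∧ dartEdge l₁ = ε.swap ∧ dartEdge l₂ = δ.swap) ∧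
      (r₁.1.1 = z ∧ r₂.1.1 = z ∧ l₁.1.1 = z ∧ l₂.1.1 = z) ∧
      ((planarization H t ht).rot r₁ = r₂ ∧ (planarization H t ht).rot r₂ = l₁ ∧
        (planarization H t ht).rot l₁ = l₂ ∧ (planarization H t ht).rot l₂ = r₁) ∧
      ∀ c : (planarization H t ht).Dart, c.1.1 = z → c = r₁ ∨ c = r₂ ∨ c = l₁ ∨ c = l₂ := by
  obtain ⟨ε, δ, hX, h1, h2, h3, h4, h5⟩ := exists_crossing_pair H ht z.2 hzS
  obtain ⟨r₁, or₁, er₁⟩ := exists_dart_of_open (H := H) (ht := ht) hX.1 hzS h1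
  obtain ⟨r₂, or₂, er₂⟩ := exists_dart_of_open (H := H) (ht := ht) hX.2.1 hzS h2
  obtain ⟨l₁, ol₁, el₁⟩ := exists_dart_of_open (H := H) (ht := ht) (swap_mem_edges hX.1) hzS
    (mem_openSegment_swap h1)
  obtain ⟨l₂, ol₂, el₂⟩ := exists_dart_of_open (H := H) (ht := ht) (swap_mem_edges hX.2.1) hzS
    (mem_openSegment_swap h2)
  have hall (c : (planarization H t ht).Dart) (hc : c.1.1 = z) :
      c = r₁ ∨ c = r₂ ∨ c = l₁ ∨ c = l₂ := by
    have hcc := dartEdge_carries c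
    rw [hc] at hcc
    rcases edge_of_mem_crossing H hX h1 h2 hcc.1 (H.mem_openSegment hcc.1 hzS hcc.2.1)
      with h | h | h | h
    · exact Or.inl (dart_ext (hc.trans or₁.symm) (h.trans er₁.symm))
    · exact Or.inr (Or.inl (dart_ext (hc.trans or₂.symm) (h.trans er₂.symm)))
    · exact Or.inr (Or.inr (Or.inl (dart_ext (hc.trans ol₁.symm) (h.trans el₁.symm))))
    · exact Or.inr (Or.inr (Or.inr (dart_ext (hc.trans ol₂.symm) (h.trans el₂.symm))))
  have k1 := (key_eq_edgeKey r₁).trans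
    ((congrArg (edgeKey t) er₁).trans (edgeKey_of_lt h3))
  have k2 := (key_eq_edgeKey r₂).trans
    ((congrArg (edgeKey t) er₂).trans (edgeKey_of_lt h4))
  have k3 := (key_eq_edgeKey l₁).trans
    ((congrArg (edgeKey t) el₁).trans (edgeKey_swap_of_lt h3))
  have k4 := (key_eq_edgeKey l₂).trans
    ((congrArg (edgeKey t) el₂).trans (edgeKey_swap_of_lt h4))
  have hs := slope_lt_slope h3 h4 h5
  generalize (ε.2.2 - ε.1.2) / ((ε.2.1 + t * ε.2.2) - (ε.1.1 + t * ε.1.2)) = m₁ at *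
  generalize (δ.2.2 - δ.1.2) / ((δ.2.1 + t * δ.2.2) - (δ.1.1 + t * δ.1.2)) = m₂ at *
  have hrot {a b : (planarization H t ht).Dart}
      (h : IsCyclicSucc (planarization H t ht).org (planarization H t ht).key a b) :
      (planarization H t ht).rot a = b := (rot_spec a).unique key_inj h
  refine ⟨ε, δ, r₁, r₂, l₁, l₂, hX, h5, ⟨er₁, er₂, el₁, el₂⟩, ⟨or₁, or₂, ol₁, ol₂⟩,
    ⟨hrot ⟨or₂.trans or₁.symm, Or.inl ⟨?_, fun c hc => ?_⟩⟩,
      hrot ⟨ol₁.trans or₂.symm, Or.inr fun c hc => ?_⟩,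
      hrot ⟨ol₂.trans ol₁.symm, Or.inl ⟨?_, fun c hc => ?_⟩⟩,
      hrot ⟨or₁.trans ol₂.symm, Or.inl ⟨?_, fun c hc => ?_⟩⟩⟩, hall⟩
  · rw [k1, k2, Prod.Lex.toLex_lt_toLex]; exact Or.inr ⟨rfl, hs⟩
  · rcases hall c (hc.trans or₁) with rfl | rfl | rfl | rfl <;>
      simp [k1, k2, k3, k4, Prod.Lex.toLex_lt_toLex, Prod.Lex.toLex_le_toLex, hs]
  · rcases hall c (hc.trans or₂) with rfl | rfl | rfl | rfl <;>
      simp [k1, k2, k3, k4, Prod.Lex.toLex_le_toLex, hs.le]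
  · rw [k3, k4, Prod.Lex.toLex_lt_toLex]; exact Or.inr ⟨rfl, hs⟩
  · rcases hall c (hc.trans ol₁) with rfl | rfl | rfl | rfl <;>
      simp [k1, k2, k3, k4, Prod.Lex.toLex_lt_toLex, Prod.Lex.toLex_le_toLex, hs]
  · rw [k1, k4, Prod.Lex.toLex_lt_toLex]; exact Or.inl Bool.false_lt_true
  · rcases hall c (hc.trans ol₂) with rfl | rfl | rfl | rfl <;>
      simp [k1, k2, k3, k4, Prod.Lex.toLex_le_toLex, hs.le]

theorem rot_crossing {d : (planarization H t ht).Dart} (hd : d.1.1.1 ∉ S) :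
    dartEdge ((planarization H t ht).rot ((planarization H t ht).rot d)) = (dartEdge d).swap ∧
    (planarization H t ht).rot ((planarization H t ht).rot
      ((planarization H t ht).rot ((planarization H t ht).rot d))) = d ∧
    EdgeX G (dartEdge d) (dartEdge ((planarization H t ht).rot d)) ∧
    0 < det2 ((dartEdge d).2 - (dartEdge d).1)
      ((dartEdge ((planarization H t ht).rot d)).2 -
        (dartEdge ((planarization H t ht).rot d)).1) := by
  obtain ⟨ε, δ, r₁, r₂, l₁, l₂, hX, hdet, ⟨e1, e2, e3, e4⟩, -, ⟨t1, t2, t3, t4⟩, hall⟩ :=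
    crossing_darts (H := H) (ht := ht) hd
  rcases hall d rfl with rfl | rfl | rfl | rfl
  · rw [t1, t2, t3, t4, e1, e2, e3]
    exact ⟨rfl, rfl, hX, hdet⟩
  · rw [t2, t3, t4, t1, e2, e3, e4]
    refine ⟨rfl, rfl, hX.symm.swap_right, ?_⟩
    rwa [det2_swap_right, ← det2_comm]
  · rw [t3, t4, t1, t2, e1, e3, e4]
    refine ⟨rfl, rfl, hX.swap_left.swap_right, ?_⟩
    rwa [det2_swap_right, det2_swap_left, neg_neg]
  · rw [t4, t1, t2, t3, e4, e1, e2]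
    refine ⟨rfl, rfl, hX.symm.swap_left, ?_⟩
    rwa [det2_swap_left, ← det2_comm]

theorem four_le_card_crossing {z : {z // IsVert S G z}} (hzS : z.1 ∉ S) :
    4 ≤ (Finset.univ.filter fun d : (planarization H t ht).Dart => d.1.1 = z).card := by
  obtain ⟨ε, δ, r₁, r₂, l₁, l₂, hX, -, ⟨e1, e2, e3, e4⟩, ⟨o1, o2, o3, o4⟩, -, -⟩ :=
    crossing_darts (H := H) (ht := ht) hzS
  have h1 := H.ne _ hX.1
  have h2 := H.ne _ hX.2.1
  have h3 := hX.2.2.1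
  have n1 : r₁ ≠ r₂ := fun h => h3 (by rw [← e1, ← e2, h])
  have n2 : r₁ ≠ l₁ := fun h =>
    h1 (congrArg Prod.fst (e1.symm.trans ((congrArg dartEdge h).trans e3)))
  have n3 : r₁ ≠ l₂ := fun h => h3 (by
    rw [e1.symm.trans ((congrArg dartEdge h).trans e4), Sym2.eq_swap]; rfl)
  have n4 : r₂ ≠ l₁ := fun h => h3 (by
    rw [e2.symm.trans ((congrArg dartEdge h).trans e3), Sym2.eq_swap]; rfl)
  have n5 : r₂ ≠ l₂ := fun h =>
    h2 (congrArg Prod.fst (e2.symm.trans ((congrArg dartEdge h).trans e4)))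
  have n6 : l₁ ≠ l₂ := fun h => h3 (by
    have : ε = δ := Prod.swap_injective (e3.symm.trans ((congrArg dartEdge h).trans e4))
    rw [this])
  have hc : ({r₁, r₂, l₁, l₂} : Finset (planarization H t ht).Dart).card = 4 := by
    rw [Finset.card_insert_of_notMem (by simp [n1, n2, n3]),
      Finset.card_insert_of_notMem (by simp [n4, n5]),
      Finset.card_insert_of_notMem (by simp [n6]), Finset.card_singleton]
  rw [← hc]
  refine Finset.card_le_card fun d hd => ?_
  simp only [Finset.mem_insert, Finset.mem_singleton] at hd
  rcases hd with rfl | rfl | rfl | rfl <;> simpa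

end DartEdge

/-- A cyclic order with a two-element orbit has just two elements. -/
theorem IsCyclicSucc.eq_or_eq {D V K : Type*} [LinearOrder K] {org : D → V} {key : D → K}
    (hk : ∀ c d, org c = org d → key c = key d → c = d) {a b c : D}
    (h1 : IsCyclicSucc org key a b) (h2 : IsCyclicSucc org key b a) (hc : org c = org a) :
    c = a ∨ c = b := by
  obtain ⟨o1, h1⟩ := h1
  obtain ⟨-, h2⟩ := h2
  have hb : org c = org b := hc.trans o1.symm
  suffices h : key c = key a ∨ key c = key b from h.imp (hk _ _ hc) (hk _ _ hb)
  rcases h1 with ⟨h1, h1'⟩ | h1 <;> rcases h2 with ⟨h2, h2'⟩ | h2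
  · exact absurd h1 h2.not_gt
  · rcases (h2 c hb).2.lt_or_eq with h | h
    · exact Or.inr ((h2 c hb).1.antisymm (h1' c hc h))
    · exact Or.inl h.symm
  · rcases (h1 c hc).2.lt_or_eq with h | h
    · exact Or.inl ((h1 c hc).1.antisymm (h2' c hb h))
    · exact Or.inr h.symm
  · exact Or.inr ((h2 c hb).1.antisymm (h1 c hc).2)

section CrossMapOfDrawing

open PlaneDrawing

variable {S : Finset Pt} {G : Finset (Sym2 Pt)} {H : Draw3 S G} {t : ℝ}
  {ht : ∀ z, IsVert S G z → ∀ w, IsVert S G w → z.1 + t * z.2 = w.1 + t * w.2 → z = w}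

theorem exists_dart_of_mem {ε : Pt × Pt} (hε : s(ε.1, ε.2) ∈ G) :
    ∃ d : (planarization H t ht).Dart, d.1.1.1 = ε.1 ∧ dartEdge d = ε := by
  obtain ⟨d, h1, h2⟩ := exists_dart (H := H) (ht := ht) (z := ⟨ε.1, Or.inl (H.mem₁ _ hε)⟩) hε
    (left_mem_segment _ _ _) (H.ne _ hε)
  exact ⟨d, by rw [h1], h2⟩

theorem EdgeX.fst_ne (H : Draw3 S G) {ε δ : Pt × Pt} (h : EdgeX G ε δ) : ε.1 ≠ δ.1 := by
  intro he
  obtain ⟨h1, h2, h3, z, h4, h5⟩ := h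
  have hz := H.eq_of_mem_of_mem h1 h2 h3 (openSegment_subset_segment _ _ _ h4)
    (openSegment_subset_segment _ _ _ h5) (left_mem_segment _ _ _)
    (he ▸ left_mem_segment ℝ δ.1 δ.2)
  subst hz
  exact H.ne _ h1 (left_mem_openSegment_iff.1 h4)

theorem dart_of_whole {d d' : (planarization H t ht).Dart} (hd : d.1.1.1 ∈ S) (hd' : d.1.2.1 ∈ S)
    (h : dartEdge d' = dartEdge d) : d' = d := by
  refine dart_ext ?_ h
  have hc := dartEdge_carries d
  have hc' := dartEdge_carries d'
  rw [h] at hc'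
  have hne := H.ne _ hc.1
  have h1 := dartEdge_fst hd
  have h2 : (dartEdge d).2 = d.1.2.1 := by
    have := dartEdge_fst (d := (planarization H t ht).rev d) hd'
    rwa [dartEdge_rev] at this
  refine Subtype.ext ?_
  by_contra hcon
  refine d.2.2 _ d'.1.1.2 ?_
  rw [← h1, ← h2]
  refine mem_openSegment_of_ne_left_right (by rw [h1]; exact Ne.symm hcon) ?_ hc'.2.1
  intro h3
  have h4 := hc'.2.2.2
  rw [← h3, par_snd hne] at h4
  exact absurd (par_of_mem hne hc'.2.2.1).2.1 (not_le.2 h4)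

theorem det2_swap_pos {v : Pt} {ε : Pt × Pt} (h : 0 < det2 (ε.2 - ε.1) (v - ε.1)) :
    ¬ 0 < det2 (ε.swap.2 - ε.swap.1) (v - ε.swap.1) := by
  simp only [det2, Prod.fst_sub, Prod.snd_sub, Prod.fst_swap, Prod.snd_swap] at h ⊢
  linarith

theorem det2_pos_of_crossing {ε δ : Pt × Pt} (h : 0 < det2 (ε.2 - ε.1) (δ.swap.2 - δ.swap.1))
    (hX : EdgeX G ε δ) : 0 < det2 (ε.2 - ε.1) (δ.1 - ε.1) := by
  obtain ⟨-, -, -, z, h1, h2⟩ := hX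
  obtain ⟨α, -, -, a1, a2⟩ := mem_openSegment_iff_coord.1 h1
  obtain ⟨β, hβ, -, b1, b2⟩ := mem_openSegment_iff_coord.1 h2
  have : det2 (ε.2 - ε.1) (δ.1 - ε.1) = β * det2 (ε.2 - ε.1) (δ.swap.2 - δ.swap.1) := by
    simp only [det2, Prod.fst_sub, Prod.snd_sub, Prod.fst_swap, Prod.snd_swap]
    linear_combination (ε.2.2 - ε.1.2) * (b1 - a1) - (ε.2.1 - ε.1.1) * (b2 - a2)
  rw [this]
  exact mul_pos hβ h

variable [Fintype {z // IsVert S G z}]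

theorem rot_fst (d : (planarization H t ht).Dart) :
    ((planarization H t ht).rot d).1.1 = d.1.1 := (rot_spec d).1

theorem rot_rot_ne {d : (planarization H t ht).Dart}
    (h3 : 3 ≤ vingDeg G d.1.1.1) :
    (planarization H t ht).rot ((planarization H t ht).rot d) ≠ d := by
  intro h
  have h1 := rot_spec d
  have h2 := rot_spec ((planarization H t ht).rot d)
  rw [h] at h2
  have hsub : G.filter (fun e => d.1.1.1 ∈ e) ⊆
      ({d, (planarization H t ht).rot d} : Finset (planarization H t ht).Dart).image
        fun c => s((dartEdge c).1, (dartEdge c).2) := by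
    intro e he
    obtain ⟨he, w, rfl⟩ := Finset.mem_filter.1 he
    obtain ⟨c, h4, h5⟩ := exists_dart_of_mem (H := H) (ht := ht) (ε := (d.1.1.1, w)) he
    refine Finset.mem_image.2 ⟨c, ?_, by rw [h5]⟩
    simpa using h1.eq_or_eq key_inj h2 (Subtype.ext h4 : c.1.1 = d.1.1)
  have := (Finset.card_le_card hsub).trans (Finset.card_image_le.trans Finset.card_le_two)
  exact absurd h3 (not_le.2 (Nat.lt_succ_of_le this))

/-- The combinatorial map of the planarisation of a drawing. -/
def Draw3.crossMap (H : Draw3 S G) (t : ℝ)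
    (ht : ∀ z, IsVert S G z → ∀ w, IsVert S G w → z.1 + t * z.2 = w.1 + t * w.2 → z = w)
    (hdeg : ∀ p ∈ S, 3 ≤ vingDeg G p) : CrossMap (planarization H t ht).Dart Pt where
  ι := (planarization H t ht).rev
  ρ := (planarization H t ht).rot
  o d := d.1.1.1 ∈ S
  e := dartEdge
  X := EdgeX G
  pos d := par (dartEdge d) d.1.1
  Lft v ε := 0 < det2 (ε.2 - ε.1) (v - ε.1)
  ι_ι d := rev_rev d
  e_ι d := dartEdge_rev d
  e_ne d := H.ne _ (dartEdge_mem d)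
  o_ρ d := by rw [rot_fst]
  e_ρ d hd := by
    rw [dartEdge_fst hd, dartEdge_fst (by rwa [rot_fst]), rot_fst]
  e_ρρ d hd := (rot_crossing hd).1
  ρ_four d hd := (rot_crossing hd).2.1
  X_ρ d hd := (rot_crossing hd).2.2.1
  X_symm x y h := h.symm
  X_swap x y h := h.swap_right
  X_ne x y h := h.fst_ne H
  X_no3 := H.no3
  uniq_o d d' hd hd' h := by
    refine dart_ext (Subtype.ext ?_) h
    rw [← dartEdge_fst hd, ← dartEdge_fst hd', h]
  uniq_X d d' hd hd' h h' := by
    refine dart_ext (Subtype.ext ?_) h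
    obtain ⟨h1, h2, h3, -⟩ := (rot_crossing hd).2.2.1
    have c1 := dartEdge_carries d'
    have c2 := dartEdge_carries ((planarization H t ht).rot d)
    have c3 := dartEdge_carries ((planarization H t ht).rot d')
    rw [rot_fst] at c2 c3
    rw [← h] at c1
    refine H.eq_of_mem_of_mem h1 h2 h3 (dartEdge_carries d).2.1 c2.2.1 c1.2.1 ?_
    rcases h' with h' | h'
    · rw [h']; exact c3.2.1
    · rw [h', Prod.fst_swap, Prod.snd_swap, segment_symm]; exact c3.2.1
  pos_lt d hd := by
    rw [(rot_crossing hd).1, rot_fst, rot_fst, dartEdge_rev, Prod.swap_swap]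
    exact (dartEdge_carries d).2.2.2
  whole d d' hd hd' h := dart_of_whole hd hd' h
  lft d _ hd := by
    have hr := (planarization H t ht).rot.apply_symm_apply ((planarization H t ht).rev d)
    have hc : ((planarization H t ht).rot.symm ((planarization H t ht).rev d)).1.1.1 ∉ S := by
      rw [← rot_fst, hr]; exact hd
    obtain ⟨-, -, h1, h2⟩ := rot_crossing hc
    rw [hr, dartEdge_rev] at h1 h2
    exact det2_pos_of_crossing h2 h1.swap_right
  lft_swap v ε h := det2_swap_pos h
  deg d hd := rot_rot_ne (hdeg _ hd)

theorem card_vert_eq :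
    Fintype.card {z // IsVert S G z} =
      S.card + (Finset.univ.filter fun z : {z // IsVert S G z} => z.1 ∉ S).card := by
  rw [← Finset.card_univ, ← Finset.card_filter_add_card_filter_not
    (fun z : {z // IsVert S G z} => z.1 ∈ S)]
  congr 1
  refine Finset.card_nbij (fun z => z.1) (fun z hz => (Finset.mem_filter.1 hz).2)
    Subtype.val_injective.injOn fun z hz => ?_
  exact ⟨⟨z, Or.inl hz⟩, by simpa using hz, rfl⟩

theorem card_origs_add_le :
    (Finset.univ.filter fun d : (planarization H t ht).Dart => d.1.1.1 ∈ S).card +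
      4 * (Finset.univ.filter fun z : {z // IsVert S G z} => z.1 ∉ S).card ≤
        Fintype.card (planarization H t ht).Dart := by
  have h := Finset.card_filter_add_card_filter_not (s := Finset.univ)
    (fun d : (planarization H t ht).Dart => d.1.1.1 ∈ S)
  rw [Finset.card_univ] at h
  rw [← h]
  refine Nat.add_le_add_left ?_ _
  rw [Finset.card_eq_sum_card_fiberwise (f := fun d : (planarization H t ht).Dart => d.1.1)
    (t := Finset.univ.filter fun z : {z // IsVert S G z} => z.1 ∉ S)
    (fun d hd => by simpa using hd), mul_comm, ← smul_eq_mul]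
  refine Finset.card_nsmul_le_sum _ _ _ fun z hz => ?_
  have hzS := (Finset.mem_filter.1 hz).2
  refine (four_le_card_crossing (H := H) (ht := ht) hzS).trans (Finset.card_le_card fun d hd => ?_)
  have hd := (Finset.mem_filter.1 hd).2
  simp [hd, hzS]

theorem two_mul_card_le_origs : 2 * G.card ≤
    (Finset.univ.filter fun d : (planarization H t ht).Dart => d.1.1.1 ∈ S).card := by
  rw [Finset.card_eq_sum_card_fiberwise
    (f := fun d : (planarization H t ht).Dart => s((dartEdge d).1, (dartEdge d).2)) (t := G)
    (fun d _ => dartEdge_mem d), mul_comm, ← smul_eq_mul]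
  refine Finset.card_nsmul_le_sum _ _ _ fun e he => ?_
  induction e using Sym2.ind with
  | _ a b =>
    obtain ⟨d, h1, h2⟩ := exists_dart_of_mem (H := H) (ht := ht) (ε := (a, b)) he
    obtain ⟨d', h3, h4⟩ := exists_dart_of_mem (H := H) (ht := ht) (ε := (b, a))
      (swap_mem_edges (ε := (a, b)) he)
    refine Finset.one_lt_card.2 ⟨d, ?_, d', ?_, fun h => ?_⟩
    · simp [h1, h2, H.mem₁ (a, b) he]
    · simp [h3, h4, H.mem₂ (a, b) he]
    · rw [h, h4] at h2
      exact H.ne (a, b) he (congrArg Prod.snd h2)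

end CrossMapOfDrawing

theorem Draw3.two_mul_card_le {S : Finset Pt} {G : Finset (Sym2 Pt)} (H : Draw3 S G)
    (hdeg : ∀ p ∈ S, 3 ≤ vingDeg G p) : 2 * G.card ≤ 13 * S.card := by
  obtain ⟨t, ht⟩ := exists_shear H.finite_isVert
  have : Fintype {z // IsVert S G z} := H.finite_isVert.fintype
  refine (two_mul_card_le_origs (H := H) (ht := ht)).trans ?_
  have ho : (Finset.univ.filter fun d : (planarization H t ht).Dart => d.1.1.1 ∈ S).card =
      (Finset.univ.filter (H.crossMap t ht hdeg).o).card :=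
    congrArg Finset.card (Finset.ext fun d => by simp only [Finset.mem_filter]; rfl)
  have hf : Fintype.card (Quotient (Equiv.Perm.SameCycle.setoid (planarization H t ht).face)) =
      Fintype.card (Quotient (Equiv.Perm.SameCycle.setoid (H.crossMap t ht hdeg).φ)) :=
    Fintype.card_congr (Equiv.refl _)
  rw [ho]
  refine (H.crossMap t ht hdeg).card_origs_le S (fun v hv => ?_) (fun d hd => ?_) ?_
  · obtain ⟨e, he⟩ := Finset.card_pos.1 (lt_of_lt_of_le (by norm_num) (hdeg v hv))
    obtain ⟨he, w, rfl⟩ := Finset.mem_filter.1 he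
    obtain ⟨d, h1, h2⟩ := exists_dart_of_mem (H := H) (ht := ht) (ε := (v, w)) he
    exact ⟨d, by change d.1.1.1 ∈ S; rw [h1]; exact hv, congrArg Prod.fst h2⟩
  · exact H.mem₁ _ (dartEdge_mem d)
  · have h1 := (planarization H t ht).card_dart_le
    have h2 := card_vert_eq (S := S) (G := G)
    have h3 := card_origs_add_le (H := H) (ht := ht)
    rw [← ho, ← hf]
    omega

section QuasiPlane

variable {S : Finset Pt} {G G' : Finset (Sym2 Pt)} {p q : Pt}

theorem IsQuasiPlane.mono {k : ℕ} (h : IsQuasiPlane k S G) (hG : G' ⊆ G) : IsQuasiPlane k S G' :=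
  ⟨fun e he => h.1 e (hG he), fun ⟨T, hT, h'⟩ => h.2 ⟨T, hT.trans hG, h'⟩⟩

theorem mem_qpGraphs {k : ℕ} : G ∈ qpGraphs k S ↔ IsQuasiPlane k S G := by
  rw [qpGraphs, Finset.mem_filter, Finset.mem_powerset, and_iff_right_iff_imp]
  exact fun h e he => Finset.mem_sym2_iff.2 (h.1 e he).2

theorem card_filter_notMem_add_vingDeg (G : Finset (Sym2 Pt)) (p : Pt) :
    (G.filter fun e => p ∉ e).card + vingDeg G p = G.card := by
  rw [add_comm, vingDeg, Finset.card_filter_add_card_filter_not]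

theorem IsQuasiPlane.delete {k : ℕ} (h : IsQuasiPlane k S G) (p : Pt) :
    IsQuasiPlane k (S.erase p) (G.filter fun e => p ∉ e) := by
  refine ⟨fun e he => ?_, (h.mono (Finset.filter_subset _ _)).2⟩
  obtain ⟨he, hp⟩ := Finset.mem_filter.1 he
  exact ⟨(h.1 e he).1, fun q hq =>
    Finset.mem_erase.2 ⟨fun hqp => hp (hqp ▸ hq), (h.1 e he).2 q hq⟩⟩

/-- Without three pairwise crossing edges, a straight-edge graph has at most `13 n / 2` edges. -/
theorem IsQuasiPlane.two_mul_card_le (hS : GenPos S) (h : IsQuasiPlane 3 S G) :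
    2 * G.card ≤ 13 * S.card := by
  induction S using Finset.strongInduction generalizing G with
  | H S ih =>
    by_cases hdeg : ∀ p ∈ S, 3 ≤ vingDeg G p
    · exact (h.draw3 hS).two_mul_card_le hdeg
    · push Not at hdeg
      obtain ⟨p, hp, hlt⟩ := hdeg
      have h1 := ih _ (Finset.erase_ssubset hp) (fun a ha b hb c hc =>
        hS a (Finset.mem_of_mem_erase ha) b (Finset.mem_of_mem_erase hb) c
          (Finset.mem_of_mem_erase hc)) (h.delete p)
      have h2 := card_filter_notMem_add_vingDeg G p
      have h3 := Finset.card_erase_add_one hp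
      omega

theorem sum_vingDeg_le (S : Finset Pt) (G : Finset (Sym2 Pt)) :
    ∑ p ∈ S, vingDeg G p ≤ 2 * G.card := by
  have h1 := Finset.sum_card_bipartiteAbove_eq_sum_card_bipartiteBelow
    (s := S) (t := G) (fun p e => p ∈ e)
  simp only [Finset.bipartiteAbove, Finset.bipartiteBelow] at h1
  simp only [vingDeg]
  rw [h1, mul_comm, ← smul_eq_mul]
  refine Finset.sum_le_card_nsmul _ _ _ fun e he => ?_
  induction e using Sym2.ind with
  | _ a b =>
    refine le_trans (Finset.card_le_card fun q hq => ?_) (Finset.card_le_two (a := a) (b := b))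
    simpa using (Finset.mem_filter.1 hq).2

theorem not_edgesCross_of_common {q' : Pt} (hS : GenPos S) (hp : p ∈ S) (hq : q ∈ S) (hq' : q' ∈ S)
    (h1 : p ≠ q) (h2 : p ≠ q') (h3 : q ≠ q') : ¬ EdgesCross s(p, q) s(p, q') := by
  rw [edgesCross_mk_iff]
  rintro ⟨z, hz, hz'⟩
  refine hS p hp q hq q' hq' h1 h2 h3 (collinear_of_det2_eq_zero ?_)
  obtain ⟨α, -, -, a1, a2⟩ := mem_openSegment_iff_coord.1 hz
  obtain ⟨β, hβ, -, b1, b2⟩ := mem_openSegment_iff_coord.1 hz'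
  refine (mul_eq_zero_iff_left hβ.ne').1 ?_
  simp only [det2, Prod.fst_sub, Prod.snd_sub]
  linear_combination (q.2 - p.2) * (b1 - a1) - (q.1 - p.1) * (b2 - a2)

/-- The edges joining `p` to the points of `B`. -/
def spokes (p : Pt) (B : Finset Pt) : Finset (Sym2 Pt) := B.image fun q => s(p, q)

theorem mem_spokes {B : Finset Pt} : s(p, q) ∈ spokes p B ↔ q ∈ B := by
  simp only [spokes, Finset.mem_image]
  exact ⟨fun ⟨r, hr, h⟩ => Sym2.congr_right.1 h ▸ hr, fun h => ⟨q, h, rfl⟩⟩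

theorem exists_of_mem_spokes {B : Finset Pt} {e : Sym2 Pt} (he : e ∈ spokes p B) :
    ∃ q ∈ B, e = s(p, q) := by
  obtain ⟨q, hq, rfl⟩ := Finset.mem_image.1 he
  exact ⟨q, hq, rfl⟩

theorem mem_of_mem_spokes {B : Finset Pt} {e : Sym2 Pt} (he : e ∈ spokes p B) : p ∈ e := by
  obtain ⟨q, -, rfl⟩ := exists_of_mem_spokes he
  exact Sym2.mem_mk_left _ _

theorem card_spokes (p : Pt) (B : Finset Pt) : (spokes p B).card = B.card :=
  Finset.card_image_of_injective _ fun _ _ h => Sym2.congr_right.1 h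

theorem IsQuasiPlane.union_spokes (hS : GenPos S) (hp : p ∈ S) (h : IsQuasiPlane 3 S G)
    {B : Finset Pt} (hB : ∀ q ∈ B, q ∈ S ∧ q ≠ p ∧ IsQuasiPlane 3 S (insert s(p, q) G)) :
    IsQuasiPlane 3 S (G ∪ spokes p B) := by
  refine ⟨fun e he => ?_, ?_⟩
  · rcases Finset.mem_union.1 he with he | he
    · exact h.1 e he
    · obtain ⟨q, hq, rfl⟩ := exists_of_mem_spokes he
      exact (hB q hq).2.2.1 _ (Finset.mem_insert_self _ _)
  · rintro ⟨T, hT, hcard, hX⟩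
    by_cases hTs : ∃ e ∈ T, e ∈ spokes p B
    · obtain ⟨e, heT, he⟩ := hTs
      obtain ⟨q, hq, rfl⟩ := exists_of_mem_spokes he
      refine (hB q hq).2.2.2 ⟨T, fun f hf => ?_, hcard, hX⟩
      rcases Finset.mem_union.1 (hT hf) with hfG | hfs
      · exact Finset.mem_insert_of_mem hfG
      · obtain ⟨q', hq', rfl⟩ := exists_of_mem_spokes hfs
        by_cases hqq : q = q'
        · rw [hqq]; exact Finset.mem_insert_self _ _
        · exact absurd (hX _ heT _ hf fun h => hqq (Sym2.congr_right.1 h))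
            (not_edgesCross_of_common hS hp (hB q hq).1 (hB q' hq').1 (hB q hq).2.1.symm
              (hB q' hq').2.1.symm hqq)
    · push Not at hTs
      exact h.2 ⟨T, fun e he => (Finset.mem_union.1 (hT he)).resolve_right (hTs e he), hcard, hX⟩

/-- The neighbours which `p` may get. -/
def candidates (S : Finset Pt) (G : Finset (Sym2 Pt)) (p : Pt) : Finset Pt :=
  S.filter fun q => q ≠ p ∧ IsQuasiPlane 3 S (insert s(p, q) G)

theorem mem_candidates : q ∈ candidates S G p ↔
    q ∈ S ∧ q ≠ p ∧ IsQuasiPlane 3 S (insert s(p, q) G) := Finset.mem_filter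

theorem filter_notMem_union_spokes (hG : ∀ e ∈ G, p ∉ e) (B : Finset Pt) :
    (G ∪ spokes p B).filter (fun e => p ∉ e) = G := by
  rw [Finset.filter_union, Finset.filter_true_of_mem hG,
    Finset.filter_false_of_mem fun e he => not_not.2 (mem_of_mem_spokes he), Finset.union_empty]

theorem vingDeg_union_spokes (hG : ∀ e ∈ G, p ∉ e) (B : Finset Pt) :
    vingDeg (G ∪ spokes p B) p = B.card := by
  rw [vingDeg, Finset.filter_union, Finset.filter_false_of_mem hG,
    Finset.filter_true_of_mem fun e he => mem_of_mem_spokes he, Finset.empty_union, card_spokes]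

theorem isXVingQP_union_spokes_candidates :
    IsXVingQP 3 S (G ∪ spokes p (candidates S G p)) p := by
  intro q hq hqp hnot h
  refine hnot (Finset.mem_union_right _ (mem_spokes.2 (mem_candidates.2 ⟨hq, hqp, h.mono ?_⟩)))
  exact Finset.insert_subset_insert _ Finset.subset_union_left

/-- The quasi-plane graphs which differ only at `p` arise by joining `p` to arbitrary candidates. -/
theorem filter_qpGraphs_eq (hS : GenPos S) (hp : p ∈ S) (hG : ∀ e ∈ G, p ∉ e)
    (h : IsQuasiPlane 3 S G) : ((qpGraphs 3 S).filter fun G' => G'.filter (fun e => p ∉ e) = G) =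
      (candidates S G p).powerset.image fun B => G ∪ spokes p B := by
  ext G'
  simp only [Finset.mem_filter, Finset.mem_image, Finset.mem_powerset, mem_qpGraphs]
  constructor
  · rintro ⟨h', rfl⟩
    refine ⟨S.filter fun q => s(p, q) ∈ G', fun q hq => ?_, ?_⟩
    · obtain ⟨hqS, hqG⟩ := Finset.mem_filter.1 hq
      refine mem_candidates.2 ⟨hqS, ?_, h'.mono ?_⟩
      · rintro rfl
        exact (h'.1 _ hqG).1 rfl
      · exact Finset.insert_subset hqG (Finset.filter_subset _ _)
    · ext e
      rw [Finset.mem_union, Finset.mem_filter]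
      constructor
      · rintro (he | he)
        · exact he.1
        · obtain ⟨q, hq, rfl⟩ := exists_of_mem_spokes he
          exact (Finset.mem_filter.1 hq).2
      · intro he
        by_cases hpe : p ∈ e
        · obtain ⟨q, rfl⟩ := hpe
          exact Or.inr (mem_spokes.2 (Finset.mem_filter.2
            ⟨(h'.1 _ he).2 q (Sym2.mem_mk_right _ _), he⟩))
        · exact Or.inl ⟨he, hpe⟩
  · rintro ⟨B, hB, rfl⟩
    exact ⟨h.union_spokes hS hp fun q hq => mem_candidates.1 (hB hq),
      filter_notMem_union_spokes hG B⟩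

theorem union_spokes_injective (hG : ∀ e ∈ G, p ∉ e) :
    Function.Injective fun B => G ∪ spokes p B := by
  intro B C h
  ext q
  have key (D : Finset Pt) : q ∈ D ↔ s(p, q) ∈ G ∪ spokes p D := by
    rw [Finset.mem_union, mem_spokes, or_iff_right fun h => hG _ h (Sym2.mem_mk_left _ _)]
  rw [key B, key C]
  exact iff_of_eq (congrArg (s(p, q) ∈ ·) h)

end QuasiPlane

theorem sum_powerset_two_mul_card {α : Type*} (A : Finset α) :
    ∑ B ∈ A.powerset, 2 * B.card = A.card * 2 ^ A.card := by
  induction A using Finset.induction_on with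
  | empty => simp
  | insert a s ha ih =>
    rw [Finset.sum_powerset_insert ha, ih, Finset.card_insert_of_notMem ha]
    have : ∑ B ∈ s.powerset, 2 * (insert a B).card = ∑ B ∈ s.powerset, (2 * B.card + 2) :=
      Finset.sum_congr rfl fun B hB => by
        rw [Finset.card_insert_of_notMem fun h => ha (Finset.mem_powerset.1 hB h), mul_add_one]
    rw [this, Finset.sum_add_distrib, ih, Finset.sum_const, Finset.card_powerset, smul_eq_mul]
    ring

theorem mul_two_pow_le (a : ℕ) : 27 * 2 ^ a ≤ 2 ^ 26 + a * 2 ^ a := by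
  rcases le_or_gt 27 a with h | h
  · exact (Nat.mul_le_mul_right _ h).trans (Nat.le_add_left _ _)
  · interval_cases a <;> norm_num

theorem mul_card_qpGraphs_le {S : Finset Pt} {p : Pt} (hS : GenPos S) (hp : p ∈ S) :
    27 * (qpGraphs 3 S).card ≤
      ∑ G ∈ qpGraphs 3 S, (2 ^ 26 * (if IsXVingQP 3 S G p then 1 else 0) + 2 * vingDeg G p) := by
  have hmaps : ∀ G ∈ qpGraphs 3 S, G.filter (fun e => p ∉ e) ∈
      (qpGraphs 3 S).image fun G => G.filter fun e => p ∉ e :=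
    fun G hG => Finset.mem_image_of_mem _ hG
  rw [Finset.card_eq_sum_card_fiberwise hmaps, ← Finset.sum_fiberwise_of_maps_to hmaps,
    Finset.mul_sum]
  refine Finset.sum_le_sum fun G hG => ?_
  obtain ⟨G', hG', rfl⟩ := Finset.mem_image.1 hG
  have hqp := (mem_qpGraphs.1 hG').mono (Finset.filter_subset (fun e => p ∉ e) G')
  have hG₀ : ∀ e ∈ G'.filter fun e => p ∉ e, p ∉ e := fun e he => (Finset.mem_filter.1 he).2
  generalize G'.filter (fun e => p ∉ e) = G at hqp hG₀
  have hinj := union_spokes_injective hG₀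
  rw [filter_qpGraphs_eq hS hp hG₀ hqp, Finset.card_image_of_injective _ hinj,
    Finset.sum_image hinj.injOn, Finset.card_powerset, Finset.sum_add_distrib]
  simp only [vingDeg_union_spokes hG₀]
  rw [sum_powerset_two_mul_card]
  refine (mul_two_pow_le _).trans (Nat.add_le_add_right ?_ _)
  refine le_trans ?_ (Finset.single_le_sum (fun _ _ => Nat.zero_le _)
    (Finset.mem_powerset_self (candidates S G p)))
  rw [if_pos isXVingQP_union_spokes_candidates, mul_one]

theorem card_mul_card_qpGraphs_le {S : Finset Pt} (hS : GenPos S) :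
    S.card * (qpGraphs 3 S).card ≤ 2 ^ 26 * ∑ G ∈ qpGraphs 3 S, vxQP 3 S G := by
  have h1 := Finset.sum_le_sum fun p (hp : p ∈ S) => mul_card_qpGraphs_le hS hp
  rw [Finset.sum_comm, Finset.sum_const, smul_eq_mul] at h1
  have h2 : ∀ G ∈ qpGraphs 3 S,
      ∑ p ∈ S, (2 ^ 26 * (if IsXVingQP 3 S G p then 1 else 0) + 2 * vingDeg G p) ≤
        2 ^ 26 * vxQP 3 S G + 26 * S.card := by
    intro G hG
    have hG := mem_qpGraphs.1 hG
    have h3 := hG.two_mul_card_le hS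
    have h4 := sum_vingDeg_le S G
    rw [Finset.sum_add_distrib, ← Finset.mul_sum, ← Finset.mul_sum, ← Finset.card_filter]
    change 2 ^ 26 * vxQP 3 S G + _ ≤ _
    omega
  have h5 := h1.trans (Finset.sum_le_sum h2)
  rw [Finset.sum_add_distrib, Finset.sum_const, ← Finset.mul_sum, smul_eq_mul] at h5
  nlinarith

theorem card_div_le_hvxQP {S : Finset Pt} (hS : GenPos S) :
    (S.card : ℝ) / 2 ^ 26 ≤ hvxQP 3 S := by
  have hpos : 0 < (qpGraphs 3 S).card := by
    refine Finset.card_pos.2 ⟨∅, mem_qpGraphs.2 ⟨by simp, ?_⟩⟩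
    rintro ⟨T, hT, h, -⟩
    rw [Finset.subset_empty.1 hT] at h
    simp at h
  rw [hvxQP, div_le_div_iff₀ (by positivity) (by exact_mod_cast hpos), mul_comm (Finset.sum _ _)]
  exact_mod_cast card_mul_card_qpGraphs_le hS

/-- Lemma 3.2. For every set `S` of `N` points in general
position, `ĥv_x^3(S) ≥ N / 2^26`. -/
theorem stmt17 (S : Finset Pt) (hgp : GenPos S) :
    (S.card : ℝ) / 2 ^ 26 ≤ hvxQP 3 S := by
  exact card_div_le_hvxQP hgp
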